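/- Let n ≥ 1 and α = (a₁,a₂,a₃,a₄) be positive integers with a₁+a₂+a₃+a₄ = n. There exists NO continuous Cₙ-equivariant map F : S³ → M(α) if and only if there is a positive integer p such that (a₁,a₂,a₃,a₄) is a cyclic rotation of (p,p,p,p) or of (p,p,p,2p). -/

import Mathlib

noncomputable section

open scoped BigOperators

/-- The cyclic shift `σ(x₁,…,xₙ) = (x₂,…,xₙ,x₁)`, i.e. `(σ x) i = x (i+1)`. -/
def cyclicShift (n : ℕ) (x : Fin n → ℝ) : Fin n → ℝ := fun i => x (finRotate n i)

/-- The hyperplane `Wₙ = {x ∈ ℝⁿ : x₁ + ⋯ + xₙ = 0}`. -/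
def Wset (n : ℕ) : Set (Fin n → ℝ) := {x | ∑ i, x i = 0}

/-- The linear subspace `L(α) ⊆ Wₙ` cut out by the vanishing of the four consecutive
block sums of lengths `a₁, a₂, a₃, a₄`. -/
def Lset (n a₁ a₂ a₃ a₄ : ℕ) : Set (Fin n → ℝ) :=
  {x | x ∈ Wset n ∧
    ∑ i ∈ Finset.univ.filter (fun i : Fin n => (i : ℕ) < a₁), x i = 0 ∧
    ∑ i ∈ Finset.univ.filter (fun i : Fin n => a₁ ≤ (i : ℕ) ∧ (i : ℕ) < a₁ + a₂), x i = 0 ∧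
    ∑ i ∈ Finset.univ.filter
      (fun i : Fin n => a₁ + a₂ ≤ (i : ℕ) ∧ (i : ℕ) < a₁ + a₂ + a₃), x i = 0 ∧
    ∑ i ∈ Finset.univ.filter (fun i : Fin n => a₁ + a₂ + a₃ ≤ (i : ℕ)), x i = 0}

/-- The union `⋃ A(α) = ⋃_{0 ≤ k < n} σᵏ·L(α)` of the minimal `σ`-invariant arrangement
containing `L(α)`. -/
def cycArrangementUnion (n a₁ a₂ a₃ a₄ : ℕ) : Set (Fin n → ℝ) :=
  ⋃ k ∈ Finset.range n, (cyclicShift n)^[k] '' Lset n a₁ a₂ a₃ a₄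

/-- The complement `M(α) = Wₙ \ ⋃ A(α)`. -/
def Mcyc (n a₁ a₂ a₃ a₄ : ℕ) : Set (Fin n → ℝ) :=
  Wset n \ cycArrangementUnion n a₁ a₂ a₃ a₄

/-- The quaternion `η = cos(2π/n) + i·sin(2π/n)`. -/
def etaQ (n : ℕ) : Quaternion ℝ :=
  ⟨Real.cos (2 * Real.pi / n), Real.sin (2 * Real.pi / n), 0, 0⟩

lemma norm_etaQ (n : ℕ) : ‖etaQ n‖ = 1 := by
  have h : Quaternion.normSq (etaQ n) = 1 := by
    rw [Quaternion.normSq_def']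
    show Real.cos (2 * Real.pi / n) ^ 2 + Real.sin (2 * Real.pi / n) ^ 2 + 0 ^ 2 + 0 ^ 2 = 1
    have := Real.cos_sq_add_sin_sq (2 * Real.pi / n)
    nlinarith
  have h2 := Quaternion.normSq_eq_norm_mul_self (etaQ n)
  rw [h] at h2
  nlinarith [norm_nonneg (etaQ n)]

/-- The sphere `S³` of unit quaternions. -/
abbrev UnitQuat : Type := {q : Quaternion ℝ // ‖q‖ = 1}

/-- The unit sphere of `ℂ²`. -/
def sphereC2 : Set (ℂ × ℂ) := {z | ‖z.1‖ ^ 2 + ‖z.2‖ ^ 2 = 1}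

/-- Some continuous function on the sphere is, on every orbit, nonconstant on each translate
of `S`. -/
def Separable (n : ℕ) [NeZero n] (S : Finset (ZMod n)) : Prop :=
  ∃ g : ℂ × ℂ → ℝ, ContinuousOn g sphereC2 ∧ ∀ z ∈ sphereC2, ∃ s ∈ S, ∃ t ∈ S,
    g (ZMod.stdAddChar s • z) ≠ g (ZMod.stdAddChar t • z)

lemma norm_stdAddChar {n : ℕ} [NeZero n] (s : ZMod n) : ‖ZMod.stdAddChar s‖ = 1 := by
  rw [ZMod.stdAddChar_apply]; exact Circle.norm_coe _

lemma smul_mem_sphereC2 {c : ℂ} (hc : ‖c‖ = 1) {z : ℂ × ℂ} (hz : z ∈ sphereC2) :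
    c • z ∈ sphereC2 := by
  simpa [sphereC2, hc] using hz

lemma stdAddChar_smul_mem {n : ℕ} [NeZero n] (s : ZMod n) {z : ℂ × ℂ} (hz : z ∈ sphereC2) :
    ZMod.stdAddChar s • z ∈ sphereC2 := smul_mem_sphereC2 (norm_stdAddChar s) hz

lemma stdAddChar_smul_smul {n : ℕ} [NeZero n] (s t : ZMod n) (z : ℂ × ℂ) :
    (ZMod.stdAddChar s : ℂ) • (ZMod.stdAddChar t : ℂ) • z
      = (ZMod.stdAddChar (s + t) : ℂ) • z := by
  rw [smul_smul, AddChar.map_add_eq_mul]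

lemma isCompact_sphereC2 : IsCompact sphereC2 := by
  apply Metric.isCompact_of_isClosed_isBounded
  · exact isClosed_eq (by fun_prop) continuous_const
  · refine (Metric.isBounded_closedBall (x := (0 : ℂ × ℂ)) (r := 1)).subset ?_
    intro z hz
    have hz : ‖z.1‖ ^ 2 + ‖z.2‖ ^ 2 = 1 := hz
    rw [mem_closedBall_zero_iff, Prod.norm_def]
    apply max_le <;> nlinarith [norm_nonneg z.1, norm_nonneg z.2]

lemma Separable.translate {n : ℕ} [NeZero n] {S T : Finset (ZMod n)} (x : ZMod n)
    (h : ∀ s ∈ S, x + s ∈ T) (hS : Separable n S) : Separable n T := by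
  obtain ⟨g, hg, h'⟩ := hS
  refine ⟨g, hg, fun z hz => ?_⟩
  obtain ⟨s, hs, t, ht, hst⟩ := h' _ (stdAddChar_smul_mem x hz)
  rw [stdAddChar_smul_smul, stdAddChar_smul_smul, add_comm s, add_comm t] at hst
  exact ⟨x + s, h s hs, x + t, h t ht, hst⟩

/-- The unit quaternion with given complex coordinates. -/
def quatOf (z : ℂ × ℂ) : Quaternion ℝ := ⟨z.1.re, z.1.im, z.2.re, z.2.im⟩

/-- The complex coordinates of a quaternion. -/
def coordsOf (q : Quaternion ℝ) : ℂ × ℂ := (⟨q.re, q.imI⟩, ⟨q.imJ, q.imK⟩)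

lemma quatOf_coordsOf (q : Quaternion ℝ) : quatOf (coordsOf q) = q := rfl

lemma coordsOf_quatOf (z : ℂ × ℂ) : coordsOf (quatOf z) = z := rfl

lemma norm_quatOf {z : ℂ × ℂ} (hz : z ∈ sphereC2) : ‖quatOf z‖ = 1 := by
  have hz : ‖z.1‖ ^ 2 + ‖z.2‖ ^ 2 = 1 := hz
  have h2 := Quaternion.normSq_eq_norm_mul_self (quatOf z)
  rw [Quaternion.normSq_def'] at h2
  have h1 : (quatOf z).re = z.1.re ∧ (quatOf z).imI = z.1.im ∧ (quatOf z).imJ = z.2.re ∧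
    (quatOf z).imK = z.2.im := ⟨rfl, rfl, rfl, rfl⟩
  rw [h1.1, h1.2.1, h1.2.2.1, h1.2.2.2] at h2
  rw [← Complex.normSq_eq_norm_sq, ← Complex.normSq_eq_norm_sq, Complex.normSq_apply,
    Complex.normSq_apply] at hz
  have h3 := norm_nonneg (quatOf z)
  nlinarith

lemma coordsOf_mem (q : UnitQuat) : coordsOf q.1 ∈ sphereC2 := by
  have h2 := Quaternion.normSq_eq_norm_mul_self q.1
  rw [Quaternion.normSq_def', q.2] at h2
  simp only [sphereC2, Set.mem_ofPred_eq, coordsOf]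
  rw [← Complex.normSq_eq_norm_sq, ← Complex.normSq_eq_norm_sq, Complex.normSq_apply,
    Complex.normSq_apply]
  dsimp only
  nlinarith

lemma continuous_coordsOf : Continuous coordsOf := by
  unfold coordsOf
  have h : ∀ a b : Quaternion ℝ → ℝ, Continuous a → Continuous b →
      Continuous fun q => (⟨a q, b q⟩ : ℂ) := fun a b ha hb => by
    have := Complex.equivRealProdCLM.symm.continuous.comp (ha.prodMk hb)
    exact this
  exact (h _ _ Quaternion.continuous_re Quaternion.continuous_imI).prodMk
    (h _ _ Quaternion.continuous_imJ Quaternion.continuous_imK)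

lemma continuous_quatOf : Continuous quatOf := by
  have h : Continuous fun z : ℂ × ℂ => (!₂[z.1.re, z.1.im, z.2.re, z.2.im] :
      EuclideanSpace ℝ (Fin 4)) := by
    fun_prop
  exact Quaternion.linearIsometryEquivTuple.symm.continuous.comp h

lemma stdAddChar_one_eq {n : ℕ} [NeZero n] : (ZMod.stdAddChar (1 : ZMod n) : ℂ)
    = ⟨Real.cos (2 * Real.pi / n), Real.sin (2 * Real.pi / n)⟩ := by
  have := ZMod.stdAddChar_coe (N := n) 1
  rw [Int.cast_one] at this
  rw [this]
  have h2 : (2 * (Real.pi : ℂ) * Complex.I * ((1 : ℤ) : ℂ) / n)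
    = ((2 * Real.pi / n : ℝ) : ℂ) * Complex.I := by push_cast; ring
  rw [h2]
  apply Complex.ext
  · rw [Complex.exp_ofReal_mul_I_re]
  · rw [Complex.exp_ofReal_mul_I_im]

lemma coordsOf_etaQ_mul {n : ℕ} [NeZero n] (q : Quaternion ℝ) :
    coordsOf (etaQ n * q) = (ZMod.stdAddChar (1 : ZMod n) : ℂ) • coordsOf q := by
  rw [stdAddChar_one_eq]
  have h1 : (etaQ n).re = Real.cos (2 * Real.pi / n) ∧
    (etaQ n).imI = Real.sin (2 * Real.pi / n) ∧ (etaQ n).imJ = 0 ∧ (etaQ n).imK = 0 :=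
    ⟨rfl, rfl, rfl, rfl⟩
  refine Prod.ext (Complex.ext ?_ ?_) (Complex.ext ?_ ?_)
  all_goals
    simp only [coordsOf, Quaternion.re_mul, Quaternion.imI_mul, Quaternion.imJ_mul,
      Quaternion.imK_mul, h1.1, h1.2.1, h1.2.2.1, h1.2.2.2, Prod.smul_fst, Prod.smul_snd,
      smul_eq_mul, Complex.mul_re, Complex.mul_im]
    ring

lemma sum_block {n : ℕ} [NeZero n] {φ G : ZMod n → ℝ} (hG : ∀ j, G (j + 1) - G j = φ j)
    {a b : ℕ} (hab : a ≤ b) (hb : b ≤ n) :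
    ∑ i ∈ Finset.univ.filter (fun i : Fin n => a ≤ (i : ℕ) ∧ (i : ℕ) < b),
      φ ((i : ℕ) : ZMod n) = G b - G a := by
  rw [Finset.sum_filter, Fin.sum_univ_eq_sum_range
    (fun i : ℕ => if a ≤ i ∧ i < b then φ (i : ZMod n) else 0) n, ← Finset.sum_filter]
  have h : (Finset.range n).filter (fun i => a ≤ i ∧ i < b) = Finset.Ico a b := by
    ext i; simp; omega
  rw [h]
  have := Finset.sum_Ico_sub (fun i : ℕ => G i) hab
  rw [← this]
  refine Finset.sum_congr rfl fun i _ => ?_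
  rw [← hG]; push_cast; rfl

lemma cyclicShift_iterate {n : ℕ} [NeZero n] (φ : ZMod n → ℝ) (k : ℕ) :
    (cyclicShift n)^[k] (fun i : Fin n => φ ((i : ℕ) : ZMod n))
      = fun i : Fin n => φ ((i : ℕ) + k : ZMod n) := by
  induction k with
  | zero => simp
  | succ k ih =>
    rw [Function.iterate_succ_apply', ih]
    funext i
    simp only [cyclicShift]
    congr 1
    obtain ⟨m, rfl⟩ : ∃ m, n = m + 1 := ⟨n - 1, (Nat.succ_pred (NeZero.ne n)).symm⟩
    rw [finRotate_apply]
    have : (((i + 1 : Fin (m + 1)) : ℕ) : ZMod (m + 1)) = (i : ℕ) + 1 := by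
      rw [Fin.val_add]
      simp
    rw [this]; push_cast; ring

lemma exists_zmod_fun {n : ℕ} [NeZero n] (x : Fin n → ℝ) :
    ∃ φ : ZMod n → ℝ, x = fun i : Fin n => φ ((i : ℕ) : ZMod n) :=
  ⟨fun j => x ⟨j.val, j.val_lt⟩, by
    funext i; congr 1; apply Fin.ext; simp [ZMod.val_natCast, Nat.mod_eq_of_lt i.2]⟩

/-- The partial sums of a composition, as residues. -/
def partialSums (n a₁ a₂ a₃ : ℕ) : Finset (ZMod n) :=
  {0, (a₁ : ZMod n), ((a₁ + a₂ : ℕ) : ZMod n), ((a₁ + a₂ + a₃ : ℕ) : ZMod n)}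

lemma mem_Wset_of_sub {n : ℕ} [NeZero n] {φ G : ZMod n → ℝ} (hG : ∀ j, G (j + 1) - G j = φ j) :
    (fun i : Fin n => φ ((i : ℕ) : ZMod n)) ∈ Wset n := by
  have := sum_block hG (Nat.zero_le n) le_rfl
  simpa [Wset] using this

lemma mem_Lset_iff {n a₁ a₂ a₃ a₄ : ℕ} [NeZero n] (hsum : a₁ + a₂ + a₃ + a₄ = n)
    {φ G : ZMod n → ℝ} (hG : ∀ j, G (j + 1) - G j = φ j) :
    (fun i : Fin n => φ ((i : ℕ) : ZMod n)) ∈ Lset n a₁ a₂ a₃ a₄ ↔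
      ∀ s ∈ partialSums n a₁ a₂ a₃, G s = G 0 := by
  have e1 := sum_block hG (Nat.zero_le a₁) (by omega)
  have e2 := sum_block hG (Nat.le_add_right a₁ a₂) (by omega)
  have e3 := sum_block hG (Nat.le_add_right (a₁ + a₂) a₃) (by omega)
  have e4 := sum_block hG (a := a₁ + a₂ + a₃) (b := n) (by omega) le_rfl
  simp only [zero_le, true_and, Fin.is_lt, and_true] at e1 e2 e3 e4
  simp only [Lset, Set.mem_ofPred_eq, mem_Wset_of_sub hG, true_and, e1, e2, e3, e4,
    partialSums, Finset.mem_insert, Finset.mem_singleton, forall_eq_or_imp, forall_eq,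
    Nat.cast_zero, CharP.cast_eq_zero]
  constructor
  · rintro ⟨h1, h2, h3, h4⟩
    refine ⟨?_, ?_, ?_⟩ <;> linarith
  · rintro ⟨h1, h2, h3⟩
    refine ⟨?_, ?_, ?_, ?_⟩ <;> linarith

/-- Existence of an equivariant map in terms of one real function on the sphere. -/
theorem exists_equivariant_iff {n a₁ a₂ a₃ a₄ : ℕ} [NeZero n]
    (hsum : a₁ + a₂ + a₃ + a₄ = n) :
    (∃ F : UnitQuat → {x : Fin n → ℝ // x ∈ Mcyc n a₁ a₂ a₃ a₄},
        Continuous F ∧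
        ∀ q : UnitQuat,
          (F ⟨etaQ n * q.1, by rw [norm_mul, norm_etaQ, q.2, one_mul]⟩).1
            = cyclicShift n (F q).1) ↔ Separable n (partialSums n a₁ a₂ a₃) := by
  constructor
  · rintro ⟨F, hF, hF'⟩
    let Fz : sphereC2 → Fin n → ℝ := fun z => (F ⟨quatOf z.1, norm_quatOf z.2⟩).1
    have hFz : Continuous Fz := continuous_subtype_val.comp (hF.comp
      ((continuous_quatOf.comp continuous_subtype_val).subtype_mk _))
    have hFz1 : ∀ (z : sphereC2), Fz ⟨_, stdAddChar_smul_mem (1 : ZMod n) z.2⟩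
        = cyclicShift n (Fz z) := by
      intro z
      rw [← hF']
      simp only [Fz]
      congr 3
      have := coordsOf_etaQ_mul (n := n) (quatOf z.1)
      rw [coordsOf_quatOf] at this
      rw [← this, quatOf_coordsOf]
    have hFzk : ∀ (k : ℕ) (z : sphereC2), Fz ⟨_, stdAddChar_smul_mem (k : ZMod n) z.2⟩
        = (cyclicShift n)^[k] (Fz z) := by
      intro k
      induction k with
      | zero => intro z; simp
      | succ k ih =>
        intro z
        rw [Function.iterate_succ_apply', ← ih, ← hFz1]
        congr 2
        rw [stdAddChar_smul_smul]; push_cast; rw [add_comm]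
    classical
    let i0 : Fin n := ⟨0, Nat.pos_of_ne_zero (NeZero.ne n)⟩
    let f : ℂ × ℂ → ℝ := fun z => if h : z ∈ sphereC2 then Fz ⟨z, h⟩ i0 else 0
    have hfc : ContinuousOn f sphereC2 := by
      rw [continuousOn_iff_continuous_domRestrict]
      have : sphereC2.domRestrict f = fun z => Fz z i0 := by
        funext z; simp [f]
      rw [this]
      exact (continuous_apply i0).comp hFz
    have hfF : ∀ z : sphereC2, Fz z = fun i : Fin n =>
        f ((ZMod.stdAddChar (((i : ℕ) : ZMod n)) : ℂ) • z.1) := by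
      intro z
      obtain ⟨φ, hφ⟩ := exists_zmod_fun (Fz z)
      funext i
      simp only [f, stdAddChar_smul_mem _ z.2, dif_pos]
      rw [hFzk, hφ, cyclicShift_iterate]
      simp [i0]
    let g : ℂ × ℂ → ℝ := fun z => -(1 / (n : ℝ)) * ∑ j ∈ Finset.range n, ∑ i ∈ Finset.range j,
      f ((ZMod.stdAddChar ((i : ZMod n)) : ℂ) • z)
    refine ⟨g, ?_, ?_⟩
    · apply continuousOn_const.mul
      refine continuousOn_finsetSum _ fun j _ => continuousOn_finsetSum _ fun i _ => ?_
      refine hfc.comp (Continuous.continuousOn (by fun_prop)) ?_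
      exact fun z hz => stdAddChar_smul_mem _ hz
    have hg : ∀ z ∈ sphereC2, g ((ZMod.stdAddChar (1 : ZMod n) : ℂ) • z) - g z = f z := by
      intro z hz
      have hW : ∑ j ∈ Finset.range n, f ((ZMod.stdAddChar ((j : ZMod n)) : ℂ) • z) = 0 := by
        have h1 : Fz ⟨z, hz⟩ ∈ Wset n := ((F ⟨quatOf z, norm_quatOf hz⟩).2).1
        rw [hfF] at h1
        rw [← h1, Finset.sum_range]
      simp only [g]
      rw [← mul_sub, ← Finset.sum_sub_distrib]
      have h2 : ∀ j ∈ Finset.range n, (∑ i ∈ Finset.range j,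
          f ((ZMod.stdAddChar ((i : ZMod n)) : ℂ) • (ZMod.stdAddChar (1 : ZMod n) : ℂ) • z)
          - ∑ i ∈ Finset.range j, f ((ZMod.stdAddChar ((i : ZMod n)) : ℂ) • z))
          = f ((ZMod.stdAddChar ((j : ZMod n)) : ℂ) • z) - f z := by
        intro j _
        rw [← Finset.sum_sub_distrib]
        have := Finset.sum_range_sub
          (fun i : ℕ => f ((ZMod.stdAddChar ((i : ZMod n)) : ℂ) • z)) j
        simp only [Nat.cast_zero, AddChar.map_zero_eq_one, one_smul] at this
        rw [← this]
        refine Finset.sum_congr rfl fun i _ => ?_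
        rw [stdAddChar_smul_smul]; push_cast; rfl
      rw [Finset.sum_congr rfl h2, Finset.sum_sub_distrib, hW]
      have : (n : ℝ) ≠ 0 := Nat.cast_ne_zero.2 (NeZero.ne n)
      simp; field_simp
    intro z hz
    by_contra! hcon
    have hL : Fz ⟨z, hz⟩ ∈ Lset n a₁ a₂ a₃ a₄ := by
      rw [hfF]
      refine (mem_Lset_iff hsum (φ := fun j => f ((ZMod.stdAddChar j : ℂ) • z))
        (G := fun j => g ((ZMod.stdAddChar j : ℂ) • z)) ?_).2 ?_
      · intro j
        rw [← hg _ (stdAddChar_smul_mem j hz), stdAddChar_smul_smul, add_comm]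
      · intro s hs
        exact hcon s hs 0 (by simp [partialSums])
    refine ((F ⟨quatOf z, norm_quatOf hz⟩).2).2 ?_
    simp only [cycArrangementUnion, Set.mem_iUnion]
    exact ⟨0, Finset.mem_range.2 (Nat.pos_of_ne_zero (NeZero.ne n)), _, hL, rfl⟩
  · rintro ⟨g, hg, hgS⟩
    let φ : ℂ × ℂ → ZMod n → ℝ := fun z j =>
      g ((ZMod.stdAddChar (j + 1) : ℂ) • z) - g ((ZMod.stdAddChar j : ℂ) • z)
    have hmem : ∀ q : UnitQuat, (fun i : Fin n => φ (coordsOf q.1) ((i : ℕ) : ZMod n)) ∈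
        Mcyc n a₁ a₂ a₃ a₄ := by
      intro q
      refine ⟨mem_Wset_of_sub (G := fun j => g ((ZMod.stdAddChar j : ℂ) • coordsOf q.1))
        fun j => rfl, ?_⟩
      simp only [cycArrangementUnion, Set.mem_iUnion]
      rintro ⟨k, -, x, hx, hxk⟩
      obtain ⟨ψ, rfl⟩ := exists_zmod_fun x
      rw [cyclicShift_iterate] at hxk
      have hψ : ∀ j, ψ j = φ (coordsOf q.1) (j - (k : ZMod n)) := by
        intro j
        have h := congrFun hxk ⟨(j - k : ZMod n).val, ZMod.val_lt _⟩
        simpa using h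
      rw [mem_Lset_iff hsum
        (G := fun j => g ((ZMod.stdAddChar (j - (k : ZMod n)) : ℂ) • coordsOf q.1)) ?_] at hx
      · obtain ⟨s, hs, t, ht, hst⟩ := hgS _ (stdAddChar_smul_mem (-(k : ZMod n)) (coordsOf_mem q))
        rw [stdAddChar_smul_smul, stdAddChar_smul_smul, ← sub_eq_add_neg, ← sub_eq_add_neg] at hst
        exact hst ((hx s hs).trans (hx t ht).symm)
      · intro j
        rw [hψ]
        simp only [φ]
        congr 5; ring
    refine ⟨fun q => ⟨_, hmem q⟩, ?_, ?_⟩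
    · refine Continuous.subtype_mk (continuous_pi fun i => ?_) _
      have h : ∀ j : ZMod n, Continuous fun q : UnitQuat =>
          g ((ZMod.stdAddChar j : ℂ) • coordsOf q.1) := fun j =>
        hg.comp_continuous ((continuous_const_smul (ZMod.stdAddChar j : ℂ)).comp
          (continuous_coordsOf.comp continuous_subtype_val))
          fun q => stdAddChar_smul_mem _ (coordsOf_mem q)
      exact (h _).sub (h _)
    · intro q
      have := cyclicShift_iterate (φ (coordsOf q.1)) 1
      rw [Function.iterate_one] at this
      simp only
      rw [this]
      funext i
      simp only [φ, coordsOf_etaQ_mul (n := n), stdAddChar_smul_smul, Nat.cast_one]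

lemma sum_range_periodic {A : Type*} [AddCommGroup A] {f : ℕ → A} {T : ℕ}
    (hf : ∀ i, f (i + T) = f i) (N : ℕ) :
    ∑ i ∈ Finset.range T, f (i + N) = ∑ i ∈ Finset.range T, f i := by
  induction N with
  | zero => rfl
  | succ N ih =>
    rw [← ih]
    have h1 := Finset.sum_range_sub (fun i => f (i + N)) T
    have h2 : f (T + N) = f (0 + N) := by rw [add_comm T N, hf, zero_add]
    rw [h2, sub_self, Finset.sum_sub_distrib, sub_eq_zero] at h1
    rw [← h1]
    exact Finset.sum_congr rfl fun i _ => by congr 1; ring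

lemma sum_range_mul {A : Type*} [AddCommGroup A] (f : ℕ → A) (m N : ℕ) :
    ∑ i ∈ Finset.range (m * N), f i
      = ∑ i ∈ Finset.range N, ∑ k ∈ Finset.range m, f (i + N * k) := by
  induction m with
  | zero => simp
  | succ m ih =>
    rw [Nat.succ_mul, Finset.sum_range_add, ih, ← Finset.sum_add_distrib]
    refine Finset.sum_congr rfl fun i _ => ?_
    rw [Finset.sum_range_succ]
    congr 2; ring

/-- A discrete Stokes argument: equivariant labels on a triangulated 3-sphere, with cochains
`α`, `β`, `γ` transgressing to `1`, do not exist. -/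
lemma no_equivariant_labelling {A L : Type*} [CommRing A] [Nontrivial A] (σ : L → L)
    (R : L → L → Prop) (α : L → A) (β : L → L → A) (γ : L → L → L → A) (m N J : ℕ)
    (hα : ∀ v, α (σ v) = α v + 1)
    (hβ0 : ∀ v, β v v = 0)
    (hβ : ∀ v w, R v w → ∑ k ∈ Finset.range m, β (σ^[k] v) (σ^[k] w) = α w - α v)
    (hγl : ∀ u v, γ u u v = 0) (hγr : ∀ u v, γ u v v = 0)
    (hγσ : ∀ u v w, R u v → R u w → R v w →
      γ (σ u) (σ v) (σ w) - γ u v w = β v w - β u w + β u v)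
    (hγ : ∀ u v w x, R u v → R u w → R u x → R v w → R v x → R w x →
      γ v w x - γ u w x + γ u v x - γ u v w = 0)
    (l : ℕ → ℕ → ℕ → L)
    (hR : ∀ i j k i' j' k', i ≤ i' + 1 → i' ≤ i + 1 → j ≤ j' + 1 → j' ≤ j + 1 →
      k ≤ k' + 1 → k' ≤ k + 1 → R (l i j k) (l i' j' k'))
    (hper : ∀ i j k, l (i + m * N) j k = l i j k)
    (hσ : ∀ i j k, l (i + N) j (k + N) = σ (l i j k))
    (h0 : ∀ i k k', l i 0 k = l i 0 k') (hJ : ∀ i i' k, l i J k = l i' J k) : False := by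
  have hcube : ∀ i j k,
      ((γ (l i j (k+1)) (l (i+1) j (k+1)) (l (i+1) (j+1) (k+1))
        - γ (l i j (k+1)) (l i (j+1) (k+1)) (l (i+1) (j+1) (k+1)))
      - (γ (l i j k) (l (i+1) j k) (l (i+1) (j+1) k)
        - γ (l i j k) (l i (j+1) k) (l (i+1) (j+1) k)))
      - ((γ (l i (j+1) k) (l (i+1) (j+1) k) (l (i+1) (j+1) (k+1))
        - γ (l i (j+1) k) (l i (j+1) (k+1)) (l (i+1) (j+1) (k+1)))
      - (γ (l i j k) (l (i+1) j k) (l (i+1) j (k+1))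
        - γ (l i j k) (l i j (k+1)) (l (i+1) j (k+1))))
      + ((γ (l (i+1) j k) (l (i+1) (j+1) k) (l (i+1) (j+1) (k+1))
        - γ (l (i+1) j k) (l (i+1) j (k+1)) (l (i+1) (j+1) (k+1)))
      - (γ (l i j k) (l i (j+1) k) (l i (j+1) (k+1))
        - γ (l i j k) (l i j (k+1)) (l i (j+1) (k+1)))) = 0 := by
    intro i j k
    have t : ∀ a b c a' b' c' a'' b'' c'', (a = i ∨ a = i + 1) → (b = j ∨ b = j + 1) →
      (c = k ∨ c = k + 1) → (a' = i ∨ a' = i + 1) → (b' = j ∨ b' = j + 1) →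
      (c' = k ∨ c' = k + 1) → (a'' = i ∨ a'' = i + 1) → (b'' = j ∨ b'' = j + 1) →
      (c'' = k ∨ c'' = k + 1) → _ := fun a b c a' b' c' a'' b'' c'' h1 h2 h3 h4 h5 h6 h7 h8 h9 =>
      hγ (l i j k) (l a b c) (l a' b' c') (l a'' b'' c'')
      (hR _ _ _ _ _ _ (by omega) (by omega) (by omega) (by omega) (by omega) (by omega))
      (hR _ _ _ _ _ _ (by omega) (by omega) (by omega) (by omega) (by omega) (by omega))
      (hR _ _ _ _ _ _ (by omega) (by omega) (by omega) (by omega) (by omega) (by omega))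
      (hR _ _ _ _ _ _ (by omega) (by omega) (by omega) (by omega) (by omega) (by omega))
      (hR _ _ _ _ _ _ (by omega) (by omega) (by omega) (by omega) (by omega) (by omega))
      (hR _ _ _ _ _ _ (by omega) (by omega) (by omega) (by omega) (by omega) (by omega))
    have t1 := t (i+1) j k (i+1) (j+1) k (i+1) (j+1) (k+1) (by simp) (by simp) (by simp)
      (by simp) (by simp) (by simp) (by simp) (by simp) (by simp)
    have t2 := t (i+1) j k (i+1) j (k+1) (i+1) (j+1) (k+1) (by simp) (by simp) (by simp)
      (by simp) (by simp) (by simp) (by simp) (by simp) (by simp)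
    have t3 := t i (j+1) k (i+1) (j+1) k (i+1) (j+1) (k+1) (by simp) (by simp) (by simp)
      (by simp) (by simp) (by simp) (by simp) (by simp) (by simp)
    have t4 := t i (j+1) k i (j+1) (k+1) (i+1) (j+1) (k+1) (by simp) (by simp) (by simp)
      (by simp) (by simp) (by simp) (by simp) (by simp) (by simp)
    have t5 := t i j (k+1) (i+1) j (k+1) (i+1) (j+1) (k+1) (by simp) (by simp) (by simp)
      (by simp) (by simp) (by simp) (by simp) (by simp) (by simp)
    have t6 := t i j (k+1) i (j+1) (k+1) (i+1) (j+1) (k+1) (by simp) (by simp) (by simp)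
      (by simp) (by simp) (by simp) (by simp) (by simp) (by simp)
    linear_combination t1 - t2 - t3 + t4 + t5 - t6
  set G12 : ℕ → ℕ → ℕ → A := fun i j k => γ (l i j k) (l (i+1) j k) (l (i+1) (j+1) k)
        - γ (l i j k) (l i (j+1) k) (l (i+1) (j+1) k) with hG12
  set G13 : ℕ → ℕ → ℕ → A := fun i j k => γ (l i j k) (l (i+1) j k) (l (i+1) j (k+1))
        - γ (l i j k) (l i j (k+1)) (l (i+1) j (k+1)) with hG13
  set G23 : ℕ → ℕ → ℕ → A := fun i j k => γ (l i j k) (l i (j+1) k) (l i (j+1) (k+1))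
        - γ (l i j k) (l i j (k+1)) (l i (j+1) (k+1)) with hG23
  have hcube' : ∀ i j k, (G12 i j (k+1) - G12 i j k) - (G13 i (j+1) k - G13 i j k)
      + (G23 (i+1) j k - G23 i j k) = 0 := hcube
  have hper' : ∀ j k i, l (i + m * N) j k = l i j k := fun j k i => hper i j k
  have hG13z : ∀ i k, G13 i J k - G13 i 0 k = 0 := by
    intro i k
    simp only [hG13]
    rw [h0 i (k+1) k, h0 (i+1) (k+1) k, hJ (i+1) i k, hJ (i+1) i (k+1), hγl, hγr, hγl, hγr]
    simp
  have hG23z : ∀ j k, G23 (m * N) j k - G23 0 j k = 0 := by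
    intro j k
    have e : ∀ j k, l (m * N) j k = l 0 j k := fun j k => by rw [← hper 0 j k, zero_add]
    simp only [hG23, e, sub_self]
  have hsum : ∑ i ∈ Finset.range (m * N), ∑ j ∈ Finset.range J, (G12 i j N - G12 i j 0) = 0 := by
    have e1 : ∀ i j, ∑ k ∈ Finset.range N, (G12 i j (k+1) - G12 i j k) = G12 i j N - G12 i j 0 :=
      fun i j => Finset.sum_range_sub (fun k => G12 i j k) N
    have e2 : ∑ i ∈ Finset.range (m * N), ∑ j ∈ Finset.range J, ∑ k ∈ Finset.range N,
        (G13 i (j+1) k - G13 i j k) = 0 := by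
      refine Finset.sum_eq_zero fun i _ => ?_
      rw [Finset.sum_comm]
      refine Finset.sum_eq_zero fun k _ => ?_
      rw [Finset.sum_range_sub (fun j => G13 i j k) J]
      exact hG13z i k
    have e3 : ∑ i ∈ Finset.range (m * N), ∑ j ∈ Finset.range J, ∑ k ∈ Finset.range N,
        (G23 (i+1) j k - G23 i j k) = 0 := by
      rw [Finset.sum_comm]
      refine Finset.sum_eq_zero fun j _ => ?_
      rw [Finset.sum_comm]
      refine Finset.sum_eq_zero fun k _ => ?_
      rw [Finset.sum_range_sub (fun i => G23 i j k) (m * N)]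
      exact hG23z j k
    have e4 : ∑ i ∈ Finset.range (m * N), ∑ j ∈ Finset.range J, ∑ k ∈ Finset.range N,
        ((G12 i j (k+1) - G12 i j k) - (G13 i (j+1) k - G13 i j k)
      + (G23 (i+1) j k - G23 i j k)) = 0 := by simp only [hcube', Finset.sum_const_zero]
    simp only [Finset.sum_add_distrib, Finset.sum_sub_distrib (f := fun k => G12 _ _ (k+1) - G12 _ _ k), e1] at e4
    simp only [Finset.sum_sub_distrib] at e1 e2 e3 e4 ⊢
    linear_combination e4 + e2 - e3
  have hshift : ∀ j, ∑ i ∈ Finset.range (m * N), G12 i j N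
      = ∑ i ∈ Finset.range (m * N), (γ (σ (l i j 0)) (σ (l (i+1) j 0)) (σ (l (i+1) (j+1) 0))
        - γ (σ (l i j 0)) (σ (l i (j+1) 0)) (σ (l (i+1) (j+1) 0))) := by
    intro j
    rw [← sum_range_periodic (f := fun i => G12 i j N) _ N]
    · refine Finset.sum_congr rfl fun i _ => ?_
      have e : ∀ i j, l (i + N) j N = σ (l i j 0) := fun i j => by
        rw [← hσ i j 0, zero_add]
      simp only [hG12, add_right_comm _ N 1, e]
    · intro i
      simp only [hG12, add_right_comm _ (m * N) 1, hper]
  have hB : ∀ i j, (γ (σ (l i j 0)) (σ (l (i+1) j 0)) (σ (l (i+1) (j+1) 0))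
        - γ (σ (l i j 0)) (σ (l i (j+1) 0)) (σ (l (i+1) (j+1) 0))) - G12 i j 0
      = (β (l (i+1) j 0) (l (i+1) (j+1) 0) - β (l i j 0) (l i (j+1) 0))
        - (β (l i (j+1) 0) (l (i+1) (j+1) 0) - β (l i j 0) (l (i+1) j 0)) := by
    intro i j
    have t1 := hγσ (l i j 0) (l (i+1) j 0) (l (i+1) (j+1) 0)
      (hR _ _ _ _ _ _ (by omega) (by omega) (by omega) (by omega) (by omega) (by omega))
      (hR _ _ _ _ _ _ (by omega) (by omega) (by omega) (by omega) (by omega) (by omega))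
      (hR _ _ _ _ _ _ (by omega) (by omega) (by omega) (by omega) (by omega) (by omega))
    have t2 := hγσ (l i j 0) (l i (j+1) 0) (l (i+1) (j+1) 0)
      (hR _ _ _ _ _ _ (by omega) (by omega) (by omega) (by omega) (by omega) (by omega))
      (hR _ _ _ _ _ _ (by omega) (by omega) (by omega) (by omega) (by omega) (by omega))
      (hR _ _ _ _ _ _ (by omega) (by omega) (by omega) (by omega) (by omega) (by omega))
    simp only [hG12]
    linear_combination t1 - t2
  have hbot : ∑ i ∈ Finset.range (m * N), β (l i 0 0) (l (i+1) 0 0) = 0 := by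
    rw [Finset.sum_comm] at hsum
    simp only [Finset.sum_sub_distrib, hshift] at hsum
    have h1 : ∑ j ∈ Finset.range J, ∑ i ∈ Finset.range (m * N),
      ((β (l (i+1) j 0) (l (i+1) (j+1) 0) - β (l i j 0) (l i (j+1) 0))
        - (β (l i (j+1) 0) (l (i+1) (j+1) 0) - β (l i j 0) (l (i+1) j 0))) = 0 := by
      simp only [← hB, Finset.sum_sub_distrib]
      exact hsum
    have h2 : ∀ j, ∑ i ∈ Finset.range (m * N),
        (β (l (i+1) j 0) (l (i+1) (j+1) 0) - β (l i j 0) (l i (j+1) 0)) = 0 := by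
      intro j
      rw [Finset.sum_range_sub (fun i => β (l i j 0) (l i (j+1) 0))]
      have e : ∀ j k, l (m * N) j k = l 0 j k := fun j k => by rw [← hper 0 j k, zero_add]
      rw [e, e, sub_self]
    have h3 : ∑ i ∈ Finset.range (m * N), ∑ j ∈ Finset.range J,
        (β (l i (j+1) 0) (l (i+1) (j+1) 0) - β (l i j 0) (l (i+1) j 0)) = 0 := by
      rw [Finset.sum_comm]
      have : ∀ j, ∑ i ∈ Finset.range (m * N),
        (β (l i (j+1) 0) (l (i+1) (j+1) 0) - β (l i j 0) (l (i+1) j 0))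
        = -∑ i ∈ Finset.range (m * N),
      ((β (l (i+1) j 0) (l (i+1) (j+1) 0) - β (l i j 0) (l i (j+1) 0))
        - (β (l i (j+1) 0) (l (i+1) (j+1) 0) - β (l i j 0) (l (i+1) j 0))) := by
        intro j
        rw [Finset.sum_sub_distrib (f := fun i =>
          β (l (i+1) j 0) (l (i+1) (j+1) 0) - β (l i j 0) (l i (j+1) 0)), h2]
        ring
      simp only [this, Finset.sum_neg_distrib, h1, neg_zero]
    have h4 : ∀ i, ∑ j ∈ Finset.range J,
        (β (l i (j+1) 0) (l (i+1) (j+1) 0) - β (l i j 0) (l (i+1) j 0))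
        = -β (l i 0 0) (l (i+1) 0 0) := by
      intro i
      rw [Finset.sum_range_sub (fun j => β (l i j 0) (l (i+1) j 0)), hJ (i+1) i, hβ0, zero_sub]
    simp only [h4, Finset.sum_neg_distrib, neg_eq_zero] at h3
    exact h3
  have hiter : ∀ k i, l (i + N * k) 0 0 = σ^[k] (l i 0 0) := by
    intro k
    induction k with
    | zero => intro i; simp
    | succ k ih =>
      intro i
      rw [Function.iterate_succ_apply', ← ih, ← hσ, h0 _ (0 + N) 0]
      congr 1
      ring
  rw [sum_range_mul] at hbot
  have h1 : ∀ i, ∑ k ∈ Finset.range m, β (l (i + N * k) 0 0) (l (i + N * k + 1) 0 0)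
      = α (l (i + 1) 0 0) - α (l i 0 0) := by
    intro i
    rw [← hβ _ _ (hR _ _ _ _ _ _ (by omega) (by omega) (by omega) (by omega) (by omega)
      (by omega))]
    refine Finset.sum_congr rfl fun k _ => ?_
    rw [← hiter, ← hiter, add_right_comm]
  simp only [h1] at hbot
  have h2 := hiter 1 0
  rw [Finset.sum_range_sub (fun i => α (l i 0 0))] at hbot
  rw [zero_add, mul_one, Function.iterate_one] at h2
  rw [h2, hα, add_sub_cancel_left] at hbot
  exact one_ne_zero hbot

/-- Vertices of the join of two cyclic sets of order `m` and one of order `P`. -/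
abbrev JoinVertex (m P : ℕ) : Type := ZMod m ⊕ ZMod m ⊕ ZMod P

namespace JoinVertex

variable {m P : ℕ}

/-- The cyclic action on vertices. -/
def succ : JoinVertex m P → JoinVertex m P
  | .inl a => .inl (a + 1)
  | .inr (.inl b) => .inr (.inl (b + 1))
  | .inr (.inr c) => .inr (.inr (c + 1))

/-- Two vertices span a simplex of the join. -/
def Compat : JoinVertex m P → JoinVertex m P → Prop
  | .inl a, .inl a' => a = a'
  | .inr (.inl b), .inr (.inl b') => b = b'
  | .inr (.inr c), .inr (.inr c') => c = c'
  | _, _ => True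

/-- The tautological equivariant 0-cochain. -/
def height : JoinVertex m P → ZMod P
  | .inl a => a.cast
  | .inr (.inl b) => b.cast
  | .inr (.inr c) => c

/-- An equivariant 1-cochain transferring to the coboundary of `height`. -/
def edge : JoinVertex m P → JoinVertex m P → ZMod P
  | .inl a, .inr (.inl b) => if a = 0 then b.cast - a.cast else 0
  | .inl a, .inr (.inr c) => if a = 0 then c - a.cast else 0
  | .inr (.inl b), .inr (.inr c) => if b = 0 then c - b.cast else 0
  | .inr (.inl b), .inl a => -if a = 0 then b.cast - a.cast else 0
  | .inr (.inr c), .inl a => -if a = 0 then c - a.cast else 0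
  | .inr (.inr c), .inr (.inl b) => -if b = 0 then c - b.cast else 0
  | _, _ => 0

/-- The value of `face` on a triangle with ordered vertices. -/
def faceAux (a b : ZMod m) (c : ZMod P) : ZMod P :=
  if 0 < a.val ∧ ¬ (0 < b.val ∧ b.val ≤ a.val) then b.cast - c else 0

/-- A 2-cochain whose variation under `succ` is the coboundary of `edge`. -/
def face : JoinVertex m P → JoinVertex m P → JoinVertex m P → ZMod P
  | .inl a, .inr (.inl b), .inr (.inr c) => faceAux a b c
  | .inl a, .inr (.inr c), .inr (.inl b) => -faceAux a b c
  | .inr (.inl b), .inl a, .inr (.inr c) => -faceAux a b c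
  | .inr (.inl b), .inr (.inr c), .inl a => faceAux a b c
  | .inr (.inr c), .inl a, .inr (.inl b) => faceAux a b c
  | .inr (.inr c), .inr (.inl b), .inl a => -faceAux a b c
  | _, _, _ => 0

lemma edge_self (v : JoinVertex m P) : edge v v = 0 := by
  rcases v with a | b | c <;> rfl

lemma face_left (u v : JoinVertex m P) : face u u v = 0 := by
  rcases u with a | b | c <;> rcases v with a' | b' | c' <;> rfl

lemma face_right (u v : JoinVertex m P) : face u v v = 0 := by
  rcases u with a | b | c <;> rcases v with a' | b' | c' <;> rfl

lemma face_outer (u v : JoinVertex m P) : face u v u = 0 := by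
  rcases u with a | b | c <;> rcases v with a' | b' | c' <;> rfl

lemma face_swap_left (u v w : JoinVertex m P) : face v u w = -face u v w := by
  rcases u with a | b | c <;> rcases v with a' | b' | c' <;> rcases w with a'' | b'' | c'' <;>
    simp [face]

lemma face_swap_right (u v w : JoinVertex m P) : face u w v = -face u v w := by
  rcases u with a | b | c <;> rcases v with a' | b' | c' <;> rcases w with a'' | b'' | c'' <;>
    simp [face]

lemma exists_eq_of_compat (u v w x : JoinVertex m P) (huv : Compat u v) (huw : Compat u w)
    (hux : Compat u x) (hvw : Compat v w) (hvx : Compat v x) (hwx : Compat w x) :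
    u = v ∨ u = w ∨ u = x ∨ v = w ∨ v = x ∨ w = x := by
  rcases u with a | b | c <;> rcases v with a' | b' | c' <;> rcases w with a'' | b'' | c'' <;>
    rcases x with d | d | d <;> simp_all [Compat]

lemma face_cocycle (u v w x : JoinVertex m P) (huv : Compat u v) (huw : Compat u w)
    (hux : Compat u x) (hvw : Compat v w) (hvx : Compat v x) (hwx : Compat w x) :
    face v w x - face u w x + face u v x - face u v w = 0 := by
  rcases exists_eq_of_compat u v w x huv huw hux hvw hvx hwx with
    rfl | rfl | rfl | rfl | rfl | rfl
  · rw [face_left, face_left]; ring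
  · rw [face_left, face_swap_left u v x, face_outer]; ring
  · rw [face_outer, face_outer, face_swap_right v u w, face_swap_left u v w]; ring
  · rw [face_left, face_right]; ring
  · rw [face_outer, face_right, face_swap_right u v w]; ring
  · rw [face_right, face_right]; ring

lemma height_succ (hm : ∀ a : ZMod m, ((a + 1).cast : ZMod P) = a.cast + 1)
    (v : JoinVertex m P) : height (succ v) = height v + 1 := by
  rcases v with a | b | c
  · exact hm a
  · exact hm b
  · rfl

lemma face_succ (hm : ∀ (a b : ZMod m) (c : ZMod P),
      faceAux (a + 1) (b + 1) (c + 1) - faceAux a b c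
        = (if b = 0 then c - b.cast else 0) - (if a = 0 then c - a.cast else 0)
          + (if a = 0 then b.cast - a.cast else 0))
    (u v w : JoinVertex m P) (huv : Compat u v) (huw : Compat u w) (hvw : Compat v w) :
    face (succ u) (succ v) (succ w) - face u v w = edge v w - edge u w + edge u v := by
  rcases u with x | x | x <;> rcases v with y | y | y <;> rcases w with z | z | z
  case inl.inr.inl.inr.inr => exact hm x y z
  case inl.inr.inr.inr.inl => simp only [face, succ, edge]; linear_combination -hm x z y
  case inr.inl.inl.inr.inr => simp only [face, succ, edge]; linear_combination -hm y x z
  case inr.inl.inr.inr.inl => simp only [face, succ, edge]; linear_combination hm z x y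
  case inr.inr.inl.inr.inl => simp only [face, succ, edge]; linear_combination hm y z x
  case inr.inr.inr.inl.inl => simp only [face, succ, edge]; linear_combination -hm z y x
  all_goals simp only [Compat] at huv huw hvw; subst_vars; simp [face, succ, edge]

lemma sum_edge (hab : ∀ a b : ZMod m, ∑ k ∈ Finset.range m,
      (if a + (k : ZMod m) = 0 then ((b + (k : ZMod m)).cast : ZMod P) - (a + (k : ZMod m)).cast
        else 0) = b.cast - a.cast)
    (hac : ∀ (a : ZMod m) (c : ZMod P), ∑ k ∈ Finset.range m,
      (if a + (k : ZMod m) = 0 then (c + (k : ZMod P)) - (a + (k : ZMod m)).cast else 0)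
        = c - a.cast)
    (v w : JoinVertex m P) (hvw : Compat v w) :
    ∑ k ∈ Finset.range m, edge (succ^[k] v) (succ^[k] w) = height w - height v := by
  have ha : ∀ (k : ℕ) (a : ZMod m), succ^[k] (.inl a : JoinVertex m P) = .inl (a + k) := by
    intro k a
    induction k with
    | zero => simp
    | succ k ih => rw [Function.iterate_succ_apply', ih]; simp [succ, add_assoc]
  have hb : ∀ (k : ℕ) (b : ZMod m),
      succ^[k] (.inr (.inl b) : JoinVertex m P) = .inr (.inl (b + k)) := by
    intro k a
    induction k with
    | zero => simp
    | succ k ih => rw [Function.iterate_succ_apply', ih]; simp [succ, add_assoc]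
  have hc : ∀ (k : ℕ) (c : ZMod P),
      succ^[k] (.inr (.inr c) : JoinVertex m P) = .inr (.inr (c + k)) := by
    intro k a
    induction k with
    | zero => simp
    | succ k ih => rw [Function.iterate_succ_apply', ih]; simp [succ, add_assoc]
  rcases v with a | b | c <;> rcases w with a' | b' | c' <;>
    first
    | (simp only [Compat] at hvw; subst_vars; simp [edge_self])
    | (simp only [ha, hb, hc, edge, height, Finset.sum_neg_distrib, hab, hac]; try ring)

end JoinVertex

open JoinVertex in
lemma no_labelling_four (N J : ℕ) (l : ℕ → ℕ → ℕ → JoinVertex 4 2)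
    (hR : ∀ i j k i' j' k', i ≤ i' + 1 → i' ≤ i + 1 → j ≤ j' + 1 → j' ≤ j + 1 →
      k ≤ k' + 1 → k' ≤ k + 1 → Compat (l i j k) (l i' j' k'))
    (hper : ∀ i j k, l (i + 4 * N) j k = l i j k)
    (hσ : ∀ i j k, l (i + N) j (k + N) = succ (l i j k))
    (h0 : ∀ i k k', l i 0 k = l i 0 k') (hJ : ∀ i i' k, l i J k = l i' J k) : False :=
  no_equivariant_labelling succ Compat height edge face 4 N J
    (height_succ (by decide)) edge_self (sum_edge (by decide) (by decide)) face_left face_right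
    (face_succ (by decide)) face_cocycle l hR hper hσ h0 hJ

open JoinVertex in
lemma no_labelling_five (N J : ℕ) (l : ℕ → ℕ → ℕ → JoinVertex 5 5)
    (hR : ∀ i j k i' j' k', i ≤ i' + 1 → i' ≤ i + 1 → j ≤ j' + 1 → j' ≤ j + 1 →
      k ≤ k' + 1 → k' ≤ k + 1 → Compat (l i j k) (l i' j' k'))
    (hper : ∀ i j k, l (i + 5 * N) j k = l i j k)
    (hσ : ∀ i j k, l (i + N) j (k + N) = succ (l i j k))
    (h0 : ∀ i k k', l i 0 k = l i 0 k') (hJ : ∀ i i' k, l i J k = l i' J k) : False :=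
  haveI : Fact (Nat.Prime 5) := ⟨by norm_num⟩
  no_equivariant_labelling succ Compat height edge face 5 N J
    (height_succ (by decide)) edge_self (sum_edge (by decide) (by decide)) face_left face_right
    (face_succ (by decide)) face_cocycle l hR hper hσ h0 hJ

/-- The total pairwise variation of a finite family of reals; it vanishes when they agree. -/
def spread {ι : Type*} (y : ι → ℝ) (T : Finset ι) : ℝ := ∑ s ∈ T, ∑ t ∈ T, |y s - y t|

lemma abs_sub_le_spread {ι : Type*} (y : ι → ℝ) {T : Finset ι} {s t : ι} (hs : s ∈ T)
    (ht : t ∈ T) : |y s - y t| ≤ spread y T :=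
  (Finset.single_le_sum (f := fun t => |y s - y t|) (fun _ _ => abs_nonneg _) ht).trans
    (Finset.single_le_sum (f := fun s => ∑ t ∈ T, |y s - y t|)
      (fun _ _ => Finset.sum_nonneg fun _ _ => abs_nonneg _) hs)

lemma spread_nonneg {ι : Type*} (y : ι → ℝ) (T : Finset ι) : 0 ≤ spread y T :=
  Finset.sum_nonneg fun _ _ => Finset.sum_nonneg fun _ _ => abs_nonneg _

lemma spread_le {ι : Type*} {y : ι → ℝ} {T : Finset ι} {c : ℝ}
    (h : ∀ s ∈ T, ∀ t ∈ T, |y s - y t| ≤ c) : spread y T ≤ T.card * (T.card * c) := by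
  unfold spread
  have h1 : ∀ s ∈ T, ∑ t ∈ T, |y s - y t| ≤ T.card * c := fun s hs => by
    have := Finset.sum_le_card_nsmul T (fun t => |y s - y t|) c (h s hs)
    rwa [nsmul_eq_mul] at this
  have := Finset.sum_le_card_nsmul T _ _ h1
  rwa [nsmul_eq_mul] at this

lemma exists_pos_le_of_isCompact {X ι : Type*} [TopologicalSpace X] {K : Set X}
    (hK : IsCompact K) (𝒯 : Finset ι) (h : ι → X → ℝ) (hc : ∀ i ∈ 𝒯, ContinuousOn (h i) K)
    (hpos : ∀ i ∈ 𝒯, ∀ x ∈ K, 0 < h i x) :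
    ∃ ε > 0, ∀ i ∈ 𝒯, ∀ x ∈ K, ε ≤ h i x := by
  classical
  induction 𝒯 using Finset.induction_on with
  | empty => exact ⟨1, one_pos, by simp⟩
  | insert i s _ ih =>
    obtain ⟨ε, hε, h1⟩ := ih (fun j hj => hc j (Finset.mem_insert_of_mem hj))
      (fun j hj => hpos j (Finset.mem_insert_of_mem hj))
    obtain ⟨ε', hε', h2⟩ : ∃ ε' > 0, ∀ x ∈ K, ε' ≤ h i x := by
      rcases K.eq_empty_or_nonempty with rfl | hne
      · exact ⟨1, one_pos, by simp⟩
      · obtain ⟨x, hx, hmin⟩ := hK.exists_isMinOn hne (hc i (Finset.mem_insert_self _ _))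
        exact ⟨h i x, hpos i (Finset.mem_insert_self _ _) x hx, fun y hy => hmin hy⟩
    refine ⟨min ε ε', lt_min hε hε', fun j hj x hx => ?_⟩
    rcases Finset.mem_insert.1 hj with rfl | hj
    · exact (min_le_right _ _).trans (h2 x hx)
    · exact (min_le_left _ _).trans (h1 j hj x hx)

/-- The values of `y` on `B` lie below all others by at least `δ`. -/
def GapBelow {ι : Type*} (δ : ℝ) (y : ι → ℝ) (B : Finset ι) : Prop :=
  ∀ b ∈ B, ∀ a ∉ B, y b + δ ≤ y a

/-- The smallest nonempty set of values separated from above by a gap `δ`, when it has at most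
three elements. -/
def IsLow {ι : Type*} (δ : ℝ) (y : ι → ℝ) (B : Finset ι) : Prop :=
  GapBelow δ y B ∧ 1 ≤ B.card ∧ B.card ≤ 3 ∧
    ∀ B' : Finset ι, GapBelow δ y B' → 1 ≤ B'.card → B.card ≤ B'.card

lemma GapBelow.eq_of_card_eq {ι : Type*} {δ : ℝ} {y y' : ι → ℝ} {B B' : Finset ι}
    (h : GapBelow δ y B) (h' : GapBelow δ y' B') (hcard : B.card = B'.card)
    (hy : ∀ i, |y i - y' i| < δ) : B = B' := by
  by_contra hne
  have h1 : ¬ B ⊆ B' := fun hs => hne (Finset.eq_of_subset_of_card_le hs hcard.ge)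
  have h2 : ¬ B' ⊆ B := fun hs => hne (Finset.eq_of_subset_of_card_le hs hcard.le).symm
  obtain ⟨b, hb, hb'⟩ := Finset.not_subset.1 h1
  obtain ⟨c, hc, hc'⟩ := Finset.not_subset.1 h2
  have e1 := h b hb c hc'
  have e2 := h' c hc b hb'
  have e3 := abs_lt.1 (hy b)
  have e4 := abs_lt.1 (hy c)
  linarith

lemma IsLow.unique {ι : Type*} {δ : ℝ} (hδ : 0 < δ) {y : ι → ℝ} {B B' : Finset ι}
    (h : IsLow δ y B) (h' : IsLow δ y B') : B = B' :=
  h.1.eq_of_card_eq h'.1 (le_antisymm (h.2.2.2 _ h'.1 h'.2.1) (h'.2.2.2 _ h.1 h.2.1))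
    (fun i => by simpa using hδ)

lemma GapBelow.map_equiv {ι : Type*} {δ : ℝ} {y : ι → ℝ} {B : Finset ι} (e : ι ≃ ι)
    (h : GapBelow δ y B) : GapBelow δ (fun i => y (e.symm i)) (B.map e.toEmbedding) := by
  intro b hb a ha
  rw [Finset.mem_map_equiv] at hb ha
  exact h _ hb _ ha

lemma IsLow.map_equiv {ι : Type*} {δ : ℝ} {y : ι → ℝ} {B : Finset ι} (e : ι ≃ ι)
    (h : IsLow δ y B) : IsLow δ (fun i => y (e.symm i)) (B.map e.toEmbedding) := by
  refine ⟨h.1.map_equiv e, by simpa using h.2.1, by simpa using h.2.2.1, fun B' hB' h1 => ?_⟩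
  have := h.2.2.2 (B'.map e.symm.toEmbedding) (by simpa using hB'.map_equiv e.symm)
    (by rw [Finset.card_map]; exact h1)
  simpa using this

lemma exists_isLow {ι : Type*} [Fintype ι] {δ : ℝ} {y : ι → ℝ} (hι : 4 ≤ Fintype.card ι)
    (h : ∀ T : Finset ι, T.card = 4 → ∃ s ∈ T, ∃ t ∈ T, y s + 3 * δ ≤ y t) (hδ : 0 < δ) :
    ∃ B, IsLow δ y B := by
  classical
  suffices hB : ∃ B, GapBelow δ y B ∧ 1 ≤ B.card ∧ B.card ≤ 3 by
    obtain ⟨B₀, hB₀, h1, h3⟩ := hB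
    obtain ⟨B, hB, hmin⟩ := Finset.exists_min_image
      (Finset.univ.filter fun B : Finset ι => GapBelow δ y B ∧ 1 ≤ B.card) Finset.card
      ⟨B₀, by simp [hB₀]; simpa using h1⟩
    have hB' := (Finset.mem_filter.1 hB).2
    have hm : ∀ B' : Finset ι, GapBelow δ y B' → 1 ≤ B'.card → B.card ≤ B'.card :=
      fun B' h1 h2 => hmin B' (Finset.mem_filter.2 ⟨Finset.mem_univ _, h1, h2⟩)
    exact ⟨B, hB'.1, hB'.2, (hm _ hB₀ h1).trans h3, hm⟩
  by_contra! hcon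
  have hstep : ∀ B : Finset ι, B.card < 4 → ∃ b ∉ B, ∀ a ∉ B, y b ≤ y a := by
    intro B hB
    obtain ⟨b, hb, hmin⟩ := Finset.exists_min_image Bᶜ y (by
      rw [← Finset.card_pos, Finset.card_compl]; omega)
    exact ⟨b, Finset.mem_compl.1 hb, fun a ha => hmin a (Finset.mem_compl.2 ha)⟩
  obtain ⟨b1, -, h1⟩ := hstep ∅ (by simp)
  obtain ⟨b2, n2, h2⟩ := hstep {b1} (by simp)
  obtain ⟨b3, n3, h3⟩ := hstep {b2, b1} (by rw [Finset.card_insert_of_notMem n2]; simp)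
  have c3 : ({b3, b2, b1} : Finset ι).card = 3 := by
    rw [Finset.card_insert_of_notMem n3, Finset.card_insert_of_notMem n2]; simp
  obtain ⟨b4, n4, h4⟩ := hstep {b3, b2, b1} (by omega)
  have c4 : ({b4, b3, b2, b1} : Finset ι).card = 4 := by
    rw [Finset.card_insert_of_notMem n4, c3]
  have e1 : ¬ GapBelow δ y {b1} := fun hg => absurd (hcon _ hg (by simp)) (by simp)
  have c2 : ({b2, b1} : Finset ι).card = 2 := by rw [Finset.card_insert_of_notMem n2]; simp
  have e2 : ¬ GapBelow δ y {b2, b1} := fun hg => absurd (hcon _ hg (by omega)) (by omega)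
  have e3 : ¬ GapBelow δ y {b3, b2, b1} := fun hg => absurd (hcon _ hg (by omega)) (by omega)
  simp only [GapBelow, not_forall, not_le] at e1 e2 e3
  obtain ⟨x1, hx1, a1, ha1, l1⟩ := e1
  obtain ⟨x2, hx2, a2, ha2, l2⟩ := e2
  obtain ⟨x3, hx3, a3, ha3, l3⟩ := e3
  have m1 := h2 a1 ha1
  have m2 := h3 a2 ha2
  have m3 := h4 a3 ha3
  have o12 := h1 b2 (by simp)
  have o23 := h2 b3 (by simp at n3 ⊢; tauto)
  have o34 := h3 b4 (by simp at n4 ⊢; tauto)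
  have k1 : y x1 = y b1 := by simp at hx1; rw [hx1]
  have k2 : y x2 ≤ y b2 := by
    simp at hx2; rcases hx2 with rfl | rfl <;> linarith
  have k3 : y x3 ≤ y b3 := by
    simp at hx3; rcases hx3 with rfl | rfl | rfl <;> linarith
  obtain ⟨s, hs, t, ht, hst⟩ := h _ c4
  have ks : y b1 ≤ y s := h1 s (by simp)
  have kt : y t ≤ y b4 := by
    simp at ht; rcases ht with rfl | rfl | rfl | rfl <;> linarith
  linarith

/-- Join coordinates on the sphere of `ℂ²`. -/
def joinPoint (t a b : ℝ) : ℂ × ℂ :=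
  ((Real.cos t : ℂ) * Complex.exp (Complex.I * a), (Real.sin t : ℂ) * Complex.exp (Complex.I * b))

lemma norm_exp_I_mul (a : ℝ) : ‖Complex.exp (Complex.I * a)‖ = 1 := by
  rw [mul_comm]; exact Complex.norm_exp_ofReal_mul_I a

lemma joinPoint_mem (t a b : ℝ) : joinPoint t a b ∈ sphereC2 := by
  simp only [sphereC2, joinPoint, Set.mem_ofPred_eq, norm_mul, norm_exp_I_mul, mul_one,
    Complex.norm_real, Real.norm_eq_abs, sq_abs]
  exact Real.cos_sq_add_sin_sq t

lemma norm_exp_I_mul_sub_le (a b : ℝ) :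
    ‖Complex.exp (Complex.I * a) - Complex.exp (Complex.I * b)‖ ≤ |a - b| := by
  have h : Complex.exp (Complex.I * a) - Complex.exp (Complex.I * b)
      = Complex.exp (Complex.I * b) * (Complex.exp (Complex.I * (a - b : ℝ)) - 1) := by
    rw [mul_sub, ← Complex.exp_add]; push_cast; ring_nf
  rw [h, norm_mul, norm_exp_I_mul, one_mul]
  exact Real.norm_exp_I_mul_ofReal_sub_one_le

lemma norm_mul_exp_sub_le {c c' : ℝ} (hc : |c'| ≤ 1) (a a' : ℝ) :
    ‖(c : ℂ) * Complex.exp (Complex.I * a) - (c' : ℂ) * Complex.exp (Complex.I * a')‖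
      ≤ |c - c'| + |a - a'| := by
  have h : (c : ℂ) * Complex.exp (Complex.I * a) - (c' : ℂ) * Complex.exp (Complex.I * a')
    = ((c - c' : ℝ) : ℂ) * Complex.exp (Complex.I * a)
      + (c' : ℂ) * (Complex.exp (Complex.I * a) - Complex.exp (Complex.I * a')) := by
    push_cast; ring
  rw [h]
  refine (norm_add_le _ _).trans (add_le_add ?_ ?_)
  · rw [norm_mul, norm_exp_I_mul, mul_one, Complex.norm_real, Real.norm_eq_abs]
  · rw [norm_mul, Complex.norm_real, Real.norm_eq_abs]
    have := norm_exp_I_mul_sub_le a a'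
    nlinarith [abs_nonneg c', abs_nonneg (a - a')]

lemma dist_joinPoint_le (t a b t' a' b' : ℝ) :
    dist (joinPoint t a b) (joinPoint t' a' b') ≤ |t - t'| + |a - a'| + |b - b'| := by
  rw [Prod.dist_eq, dist_eq_norm, dist_eq_norm]
  apply max_le
  · have := norm_mul_exp_sub_le (c := Real.cos t) (Real.abs_cos_le_one t') a a'
    have h2 := Real.abs_cos_sub_cos_le t t'
    have h3 := abs_nonneg (b - b')
    simp only [joinPoint]
    linarith
  · have := norm_mul_exp_sub_le (c := Real.sin t) (Real.abs_sin_le_one t') b b'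
    have h2 := Real.abs_sin_sub_sin_le t t'
    have h3 := abs_nonneg (a - a')
    simp only [joinPoint]
    linarith

lemma exp_smul_joinPoint (t a b c : ℝ) :
    Complex.exp (Complex.I * c) • joinPoint t a b = joinPoint t (a + c) (b + c) := by
  have h : ∀ x : ℝ, Complex.exp (Complex.I * ((x + c : ℝ) : ℂ))
      = Complex.exp (Complex.I * c) * Complex.exp (Complex.I * x) := fun x => by
    rw [← Complex.exp_add]; push_cast; ring_nf
  simp only [joinPoint, h]
  refine Prod.ext ?_ ?_ <;> simp only [Prod.smul_fst, Prod.smul_snd, smul_eq_mul] <;> ring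

lemma stdAddChar_one_eq_exp {m : ℕ} [NeZero m] : (ZMod.stdAddChar (1 : ZMod m) : ℂ)
    = Complex.exp (Complex.I * ((2 * Real.pi / m : ℝ) : ℂ)) := by
  have := ZMod.stdAddChar_coe (N := m) 1
  rw [Int.cast_one] at this
  rw [this]
  congr 1
  push_cast; ring

open JoinVertex in
/-- From a function on the sphere with no four equal values on `ℤ/m`-orbits, build an equivariant
labelling of a fine grid. -/
lemma exists_labelling {m P : ℕ} [NeZero m] (hm : 4 ≤ m)
    (lab : Finset (ZMod m) → JoinVertex m P)
    (hlab : ∀ B : Finset (ZMod m), 1 ≤ B.card → B.card ≤ 3 →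
      lab (B.map (Equiv.addRight 1).toEmbedding) = succ (lab B))
    (hcompat : ∀ B B' : Finset (ZMod m), 1 ≤ B.card → B.card ≤ 3 → 1 ≤ B'.card → B'.card ≤ 3 →
      (B.card = B'.card → B = B') → Compat (lab B) (lab B'))
    {g : ℂ × ℂ → ℝ} (hg : ContinuousOn g sphereC2)
    (h : ∀ z ∈ sphereC2, ∀ T : Finset (ZMod m), T.card = 4 → ∃ s ∈ T, ∃ t ∈ T,
      g (ZMod.stdAddChar s • z) ≠ g (ZMod.stdAddChar t • z)) :
    ∃ (N J : ℕ) (l : ℕ → ℕ → ℕ → JoinVertex m P),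
    (∀ i j k i' j' k', i ≤ i' + 1 → i' ≤ i + 1 → j ≤ j' + 1 → j' ≤ j + 1 →
      k ≤ k' + 1 → k' ≤ k + 1 → Compat (l i j k) (l i' j' k')) ∧
    (∀ i j k, l (i + m * N) j k = l i j k) ∧
    (∀ i j k, l (i + N) j (k + N) = succ (l i j k)) ∧
    (∀ i k k', l i 0 k = l i 0 k') ∧ (∀ i i' k, l i J k = l i' J k) := by
  classical
  let y : ℂ × ℂ → ZMod m → ℝ := fun z i => g ((ZMod.stdAddChar (-i) : ℂ) • z)
  have hyc : ∀ i, ContinuousOn (fun z => y z i) sphereC2 := fun i =>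
    hg.comp (continuous_const_smul (ZMod.stdAddChar (-i) : ℂ)).continuousOn
      fun z hz => stdAddChar_smul_mem _ hz
  obtain ⟨ε, hε, hε'⟩ := exists_pos_le_of_isCompact isCompact_sphereC2
    (Finset.univ.filter fun T : Finset (ZMod m) => T.card = 4) (fun T z => spread (y z) T)
    (fun T _ => continuousOn_finsetSum _ fun s _ => continuousOn_finsetSum _ fun t _ =>
      ((hyc s).sub (hyc t)).abs) (by
      intro T hT z hz
      rw [Finset.mem_filter] at hT
      obtain ⟨s, hs, t, ht, hst⟩ := h z hz (T.map (Equiv.neg _).toEmbedding)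
        (by rw [Finset.card_map]; exact hT.2)
      rw [Finset.mem_map_equiv] at hs ht
      refine lt_of_lt_of_le ?_ (abs_sub_le_spread (y z) hs ht)
      rw [abs_pos, sub_ne_zero]
      simpa [y] using hst)
  set δ : ℝ := ε / 49 with hδdef
  have hδ : 0 < δ := by positivity
  have hlow : ∀ z ∈ sphereC2, ∃ B, IsLow δ (y z) B := by
    intro z hz
    refine exists_isLow (by rw [ZMod.card]; exact hm) (fun T hT => ?_) hδ
    by_contra! hcon
    have h1 := hε' T (by simpa using hT) z hz
    have h2 := spread_le (y := y z) (T := T) (c := 3 * δ) (fun s hs t ht => by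
      have e1 := hcon s hs t ht
      have e2 := hcon t ht s hs
      rw [abs_le]; constructor <;> linarith)
    rw [hT] at h2
    push_cast at h2
    linarith
  let low : ℂ × ℂ → Finset (ZMod m) := fun z =>
    if hz : z ∈ sphereC2 then (hlow z hz).choose else ∅
  have hlow' : ∀ z ∈ sphereC2, IsLow δ (y z) (low z) := by
    intro z hz
    simp only [low, hz, dif_pos]
    exact (hlow z hz).choose_spec
  have hlowσ : ∀ z ∈ sphereC2, low ((ZMod.stdAddChar (1 : ZMod m) : ℂ) • z)
      = (low z).map (Equiv.addRight 1).toEmbedding := by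
    intro z hz
    refine (hlow' _ (stdAddChar_smul_mem 1 hz)).unique hδ ?_
    convert (hlow' z hz).map_equiv (Equiv.addRight 1) using 2 with i
    simp only [y, stdAddChar_smul_smul]
    congr 3
    simp [add_comm]
  obtain ⟨ρ, hρ, hunif⟩ := Metric.uniformContinuousOn_iff.1
    (isCompact_sphereC2.uniformContinuousOn_of_continuous hg) δ hδ
  have hnear : ∀ z ∈ sphereC2, ∀ z' ∈ sphereC2, dist z z' < ρ →
      Compat (lab (low z)) (lab (low z')) := by
    intro z hz z' hz' hd
    have l1 := hlow' z hz
    have l2 := hlow' z' hz'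
    refine hcompat _ _ l1.2.1 l1.2.2.1 l2.2.1 l2.2.2.1 fun hc => ?_
    refine l1.1.eq_of_card_eq l2.1 hc fun i => ?_
    rw [← Real.dist_eq]
    refine hunif _ (stdAddChar_smul_mem _ hz) _ (stdAddChar_smul_mem _ hz') ?_
    rw [dist_eq_norm, ← smul_sub, norm_smul, norm_stdAddChar, one_mul, ← dist_eq_norm]
    exact hd
  obtain ⟨N, hN⟩ := exists_nat_gt (20 / ρ)
  have hNpos : (0 : ℝ) < N := lt_trans (by positivity) hN
  have hmpos : (4 : ℝ) ≤ m := by exact_mod_cast hm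
  have hN' : 20 / (N : ℝ) < ρ := by
    rw [div_lt_iff₀ hNpos]; rw [div_lt_iff₀ hρ] at hN; linarith
  let pt : ℕ → ℕ → ℕ → ℂ × ℂ := fun i j k => joinPoint (Real.pi / 2 * (j / N))
    (2 * Real.pi / m * (i / N)) (2 * Real.pi / m * (k / N))
  have hpt : ∀ i j k, pt i j k ∈ sphereC2 := fun i j k => joinPoint_mem _ _ _
  have hper : ∀ i j k, pt (i + m * N) j k = pt i j k := by
    intro i j k
    simp only [pt, joinPoint]
    congr 2
    have : Complex.I * ((2 * Real.pi / m * (((i + m * N : ℕ) : ℝ) / N) : ℝ) : ℂ)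
        = Complex.I * ((2 * Real.pi / m * (i / N) : ℝ) : ℂ) + 2 * Real.pi * Complex.I := by
      have e : (2 * Real.pi / m * (((i + m * N : ℕ) : ℝ) / N) : ℝ)
          = 2 * Real.pi / m * (i / N) + 2 * Real.pi := by
        push_cast; field_simp
      rw [e]; push_cast; ring
    rw [this, Complex.exp_periodic]
  have hσ : ∀ i j k, pt (i + N) j (k + N) = (ZMod.stdAddChar (1 : ZMod m) : ℂ) • pt i j k := by
    intro i j k
    rw [stdAddChar_one_eq_exp]
    simp only [pt]
    rw [exp_smul_joinPoint]
    congr 1 <;> push_cast <;> field_simp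
  refine ⟨N, N, fun i j k => lab (low (pt i j k)), ?_, ?_, ?_, ?_, ?_⟩
  · intro i j k i' j' k' h1 h2 h3 h4 h5 h6
    refine hnear _ (hpt _ _ _) _ (hpt _ _ _) (lt_of_le_of_lt (dist_joinPoint_le _ _ _ _ _ _) ?_)
    have key : ∀ (c : ℝ) (a b : ℕ), 0 ≤ c → c ≤ 2 → a ≤ b + 1 → b ≤ a + 1 →
        |c * (a / N) - c * (b / N)| ≤ 2 / N := by
      intro c a b hc hc2 hab hba
      have : c * ((a : ℝ) / N) - c * (b / N) = c * (a - b) / N := by ring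
      rw [this, abs_div, abs_of_pos hNpos, abs_mul, abs_of_nonneg hc]
      have hab' : (a : ℝ) ≤ b + 1 := by exact_mod_cast hab
      have hba' : (b : ℝ) ≤ a + 1 := by exact_mod_cast hba
      have : |(a : ℝ) - b| ≤ 1 := by rw [abs_le]; constructor <;> linarith
      apply div_le_div_of_nonneg_right _ hNpos.le
      nlinarith [abs_nonneg ((a : ℝ) - b)]
    have hpi := Real.pi_lt_four
    have hpi0 := Real.pi_pos
    have hc : 2 * Real.pi / m ≤ 2 := by
      rw [div_le_iff₀ (by linarith)]; nlinarith
    have k1 := key (Real.pi / 2) j j' (by positivity) (by linarith) h3 h4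
    have k2 := key (2 * Real.pi / m) i i' (by positivity) hc h1 h2
    have k3 := key (2 * Real.pi / m) k k' (by positivity) hc h5 h6
    have : 2 / (N : ℝ) + 2 / N + 2 / N ≤ 20 / N := by
      rw [← add_div, ← add_div]
      apply div_le_div_of_nonneg_right _ hNpos.le
      norm_num
    linarith
  · intro i j k
    simp only [hper]
  · intro i j k
    have hl := hlow' _ (hpt i j k)
    simp only [hσ, hlowσ _ (hpt i j k)]
    exact hlab _ hl.2.1 hl.2.2.1
  · intro i k k'
    simp [pt, joinPoint]
  · intro i i' k
    have : (N : ℝ) / N = 1 := div_self hNpos.ne'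
    simp only [pt, joinPoint, this, mul_one, Real.cos_pi_div_two, Complex.ofReal_zero, zero_mul]

/-- Labels of the low sets for `ℤ/4`. -/
def labelFour (B : Finset (ZMod 4)) : JoinVertex 4 2 :=
  if B.card = 1 then .inl (∑ b ∈ B, b) else if B.card = 3 then .inr (.inl (∑ b ∈ Bᶜ, b))
  else .inr (.inr (if B = {0, 1} ∨ B = {2, 3} ∨ B = {0, 2} then 0 else 1))

/-- Labels of the low sets for `ℤ/5`. -/
def labelFive (B : Finset (ZMod 5)) : JoinVertex 5 5 :=
  if B.card = 1 then .inl (∑ b ∈ B, b) else if B.card = 3 then .inr (.inl (2 * ∑ b ∈ B, b))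
  else .inr (.inr (3 * ∑ b ∈ B, b))

lemma exists_four_eq_on_quarter_orbit {g : ℂ × ℂ → ℝ} (hg : ContinuousOn g sphereC2) :
    ∃ z ∈ sphereC2, ∃ T : Finset (ZMod 4), T.card = 4 ∧ ∀ s ∈ T, ∀ t ∈ T,
      g (ZMod.stdAddChar s • z) = g (ZMod.stdAddChar t • z) := by
  by_contra! hcon
  obtain ⟨N, J, l, h1, h2, h3, h4, h5⟩ := exists_labelling le_rfl labelFour (by decide)
    (fun B B' h1 h3 h1' h3' h => by
      by_cases hc : B.card = B'.card
      · rw [h hc]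
        rcases labelFour B' with a | a | a <;> rfl
      · unfold labelFour
        split_ifs <;> first | trivial | omega) hg hcon
  exact no_labelling_four N J l h1 h2 h3 h4 h5

lemma exists_four_eq_on_fifth_orbit {g : ℂ × ℂ → ℝ} (hg : ContinuousOn g sphereC2) :
    ∃ z ∈ sphereC2, ∃ T : Finset (ZMod 5), T.card = 4 ∧ ∀ s ∈ T, ∀ t ∈ T,
      g (ZMod.stdAddChar s • z) = g (ZMod.stdAddChar t • z) := by
  by_contra! hcon
  obtain ⟨N, J, l, h1, h2, h3, h4, h5⟩ := exists_labelling (by norm_num) labelFive (by decide)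
    (fun B B' h1 h3 h1' h3' h => by
      by_cases hc : B.card = B'.card
      · rw [h hc]
        rcases labelFive B' with a | a | a <;> rfl
      · unfold labelFive
        split_ifs <;> first | trivial | omega) hg hcon
  exact no_labelling_five N J l h1 h2 h3 h4 h5

lemma stdAddChar_mul_cast {n m p : ℕ} [NeZero n] [NeZero m] (hn : n = m * p) (s : ZMod m) :
    (ZMod.stdAddChar ((s.val * p : ℕ) : ZMod n) : ℂ) = ZMod.stdAddChar s := by
  have h1 := ZMod.stdAddChar_coe (N := n) ((s.val * p : ℕ) : ℤ)
  have h2 := ZMod.stdAddChar_coe (N := m) (s.val : ℤ)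
  rw [Int.cast_natCast, ZMod.natCast_zmod_val] at h2
  rw [Int.cast_natCast] at h1
  rw [h1, h2]
  congr 1
  have hm : (m : ℂ) ≠ 0 := Nat.cast_ne_zero.2 (NeZero.ne m)
  have hp : (p : ℂ) ≠ 0 := by
    rintro h
    have : p = 0 := by exact_mod_cast h
    exact NeZero.ne n (by rw [hn, this, mul_zero])
  rw [hn]; push_cast; field_simp

lemma not_separable_of_four_mul {n p : ℕ} [NeZero n] (hn : n = 4 * p) {S : Finset (ZMod n)}
    (hS : ∀ s ∈ S, ∃ i : ℕ, s = (i * p : ℕ)) : ¬ Separable n S := by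
  rintro ⟨g, hg, hsep⟩
  obtain ⟨z, hz, T, hT, h⟩ := exists_four_eq_on_quarter_orbit hg
  have hT' : T = Finset.univ := by
    rw [← Finset.card_eq_iff_eq_univ, hT]; rfl
  obtain ⟨s, hs, t, ht, hst⟩ := hsep z hz
  have key : ∀ s ∈ S, ∃ i : ZMod 4, (ZMod.stdAddChar s : ℂ) = ZMod.stdAddChar i := by
    intro s hs
    obtain ⟨i, rfl⟩ := hS s hs
    refine ⟨(i : ZMod 4), ?_⟩
    rw [← stdAddChar_mul_cast hn]
    congr 1
    rw [ZMod.natCast_eq_natCast_iff, hn, ZMod.val_natCast]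
    exact (Nat.mod_modEq i 4).symm.mul_right' p
  obtain ⟨i, hi⟩ := key s hs
  obtain ⟨j, hj⟩ := key t ht
  rw [hi, hj] at hst
  exact hst (h i (by simp [hT']) j (by simp [hT']))

lemma not_separable_of_five_mul {n p : ℕ} [NeZero n] (hn : n = 5 * p) {S : Finset (ZMod n)}
    {k : ℕ} (hS : ∀ s ∈ S, ∃ i : ℕ, s = (i * p : ℕ) ∧ (i : ZMod 5) ≠ k) : ¬ Separable n S := by
  rintro ⟨g, hg, hsep⟩
  obtain ⟨z, hz, T, hT, h⟩ := exists_four_eq_on_fifth_orbit hg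
  obtain ⟨c, hc⟩ : ∃ c : ZMod 5, ∀ i, i ≠ c → i ∈ T := by
    have h1 : Tᶜ.card = 1 := by rw [Finset.card_compl, hT]; rfl
    obtain ⟨c, hc⟩ := Finset.card_eq_one.1 h1
    refine ⟨c, fun i hi => ?_⟩
    by_contra hiT
    have : i ∈ Tᶜ := Finset.mem_compl.2 hiT
    rw [hc] at this
    exact hi (Finset.mem_singleton.1 this)
  obtain ⟨s, hs, t, ht, hst⟩ := hsep _ (stdAddChar_smul_mem
    ((((c - k : ZMod 5)).val * p : ℕ) : ZMod n) hz)
  have key : ∀ s ∈ S, ∃ i ∈ T, (ZMod.stdAddChar s : ℂ) • (ZMod.stdAddChar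
      ((((c - k : ZMod 5)).val * p : ℕ) : ZMod n) : ℂ) • z = (ZMod.stdAddChar i : ℂ) • z := by
    intro s hs
    obtain ⟨i, rfl, hi⟩ := hS s hs
    refine ⟨(i : ZMod 5) + (c - k), hc _ fun h => hi (by linear_combination h), ?_⟩
    rw [stdAddChar_mul_cast hn, smul_smul, AddChar.map_add_eq_mul, ← stdAddChar_mul_cast hn (i : ZMod 5)]
    congr 3
    rw [ZMod.natCast_eq_natCast_iff, hn, ZMod.val_natCast]
    exact (Nat.mod_modEq i 5).symm.mul_right' p
  obtain ⟨i, hi, hi'⟩ := key s hs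
  obtain ⟨j, hj, hj'⟩ := key t ht
  rw [hi', hj'] at hst
  exact hst (h i hi j hj)

/-- A bump on the plane supported on the open sector of half-angle `π / n` about the positive
real axis. -/
def sectorBump (n : ℕ) (z : ℂ) : ℝ := max 0 (z.re - ‖z‖ * Real.cos (Real.pi / n))

lemma continuous_sectorBump (n : ℕ) : Continuous (sectorBump n) := by
  unfold sectorBump; fun_prop

lemma sectorBump_nonneg (n : ℕ) (z : ℂ) : 0 ≤ sectorBump n z := le_max_left _ _

lemma sectorBump_zero (n : ℕ) : sectorBump n 0 = 0 := by simp [sectorBump]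

lemma abs_arg_lt_of_sectorBump_pos {n : ℕ} (hn : 1 ≤ n) {z : ℂ} (h : 0 < sectorBump n z) :
    |z.arg| < Real.pi / n := by
  have hz : z ≠ 0 := by rintro rfl; simp [sectorBump_zero] at h
  have hz' : 0 < ‖z‖ := norm_pos_iff.2 hz
  have h1 : 0 < z.re - ‖z‖ * Real.cos (Real.pi / n) := by
    unfold sectorBump at h
    rcases lt_max_iff.1 h with h | h
    · exact absurd h (lt_irrefl _)
    · exact h
  rw [← Complex.norm_mul_cos_arg z] at h1
  have h2 : Real.cos (Real.pi / n) < Real.cos |z.arg| := by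
    rw [Real.cos_abs]; nlinarith
  by_contra! hcon
  have hn' : (1 : ℝ) ≤ n := by exact_mod_cast hn
  have := Real.cos_le_cos_of_nonneg_of_le_pi (by positivity) (Complex.abs_arg_le_pi z) hcon
  linarith

lemma sectorBump_pos_of_exp {n : ℕ} (hn : 1 ≤ n) {r θ : ℝ} (hr : 0 < r)
    (hθ : |θ| < Real.pi / n) : 0 < sectorBump n (r * Complex.exp (Complex.I * θ)) := by
  have hn' : (1 : ℝ) ≤ n := by exact_mod_cast hn
  have h1 : ‖(r : ℂ) * Complex.exp (Complex.I * θ)‖ = r := by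
    rw [norm_mul, norm_exp_I_mul, mul_one, Complex.norm_real, Real.norm_eq_abs, abs_of_pos hr]
  have h2 : ((r : ℂ) * Complex.exp (Complex.I * θ)).re = r * Real.cos θ := by
    rw [Complex.re_ofReal_mul, mul_comm Complex.I, Complex.exp_ofReal_mul_I_re]
  unfold sectorBump
  rw [h1, h2]
  refine lt_max_of_lt_right ?_
  have h3 : Real.cos (Real.pi / n) < Real.cos |θ| :=
    Real.cos_lt_cos_of_nonneg_of_le_pi (abs_nonneg _)
      (div_le_self Real.pi_pos.le hn') hθ
  rw [Real.cos_abs] at h3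
  nlinarith

/-- Two rotated sectors meet only if their axes are at angle less than `2π / n`. -/
lemma exists_int_of_sectorBump_pos {n : ℕ} (hn : 1 ≤ n) {z : ℂ} {a b : ℝ}
    (ha : 0 < sectorBump n (Complex.exp (Complex.I * (2 * Real.pi / n * a : ℝ)) * z))
    (hb : 0 < sectorBump n (Complex.exp (Complex.I * (2 * Real.pi / n * b : ℝ)) * z)) :
    ∃ k : ℤ, |a - b + n * k| < 1 := by
  have hn' : (0 : ℝ) < n := by exact_mod_cast hn
  have ha' := abs_lt.1 (abs_arg_lt_of_sectorBump_pos hn ha)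
  have hb' := abs_lt.1 (abs_arg_lt_of_sectorBump_pos hn hb)
  set A := Complex.exp (Complex.I * (2 * Real.pi / n * a : ℝ)) * z with hA
  set B := Complex.exp (Complex.I * (2 * Real.pi / n * b : ℝ)) * z with hB
  have hz : z ≠ 0 := by rintro rfl; simp [hA, sectorBump_zero] at ha
  have key : ∀ c : ℝ, ((Complex.arg (Complex.exp (Complex.I * c) * z) : ℝ) : Real.Angle)
      = c + (z.arg : Real.Angle) := by
    intro c
    rw [Complex.arg_mul_coe_angle (Complex.exp_ne_zero _) hz, mul_comm Complex.I,
      Complex.exp_mul_I, ← Complex.ofReal_cos, ← Complex.ofReal_sin]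
    congr 1
    simpa using Complex.arg_cos_add_sin_mul_I_coe_angle (c : Real.Angle)
  have h1 : ((A.arg - B.arg : ℝ) : Real.Angle)
      = ((2 * Real.pi / n * a - 2 * Real.pi / n * b : ℝ) : Real.Angle) := by
    rw [Real.Angle.coe_sub, Real.Angle.coe_sub, hA, hB, key, key]
    abel
  rw [Real.Angle.angle_eq_iff_two_pi_dvd_sub] at h1
  obtain ⟨k, hk⟩ := h1
  refine ⟨k, ?_⟩
  have h2 : a - b + n * k = (A.arg - B.arg) * n / (2 * Real.pi) := by
    have hpi := Real.pi_pos
    have : A.arg - B.arg = 2 * Real.pi * k + (2 * Real.pi / n * a - 2 * Real.pi / n * b) := by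
      linarith
    rw [this]; field_simp; ring
  rw [h2, abs_div, abs_mul, abs_of_pos hn', abs_of_pos Real.two_pi_pos, div_lt_one Real.two_pi_pos,
    ← lt_div_iff₀ hn', abs_lt]
  have : 2 * Real.pi / n = Real.pi / n + Real.pi / n := by ring
  constructor <;> linarith

lemma exists_sectorBump_pos {n : ℕ} (hn : 1 ≤ n) {z : ℂ} (hz : z ≠ 0) :
    ∃ k : ℤ, 0 < sectorBump n (Complex.exp (Complex.I * (2 * Real.pi / n * (k / 2) : ℝ)) * z) := by
  have hn' : (0 : ℝ) < n := by exact_mod_cast hn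
  have hpi := Real.pi_pos
  refine ⟨-round (z.arg * n / Real.pi), ?_⟩
  set k := round (z.arg * n / Real.pi)
  have h := abs_sub_round (z.arg * n / Real.pi)
  have h1 : Complex.exp (Complex.I * (2 * Real.pi / n * (((-k : ℤ) : ℝ) / 2) : ℝ)) * z
      = ‖z‖ * Complex.exp (Complex.I * ((z.arg - Real.pi / n * k : ℝ) : ℂ)) := by
    conv_lhs => rw [← Complex.norm_mul_exp_arg_mul_I z]
    rw [mul_left_comm, ← Complex.exp_add]
    congr 2
    push_cast; ring
  rw [h1]
  apply sectorBump_pos_of_exp hn (norm_pos_iff.2 hz)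
  have h2 : z.arg - Real.pi / n * k = (z.arg * n / Real.pi - k) * (Real.pi / n) := by
    field_simp
  rw [h2, abs_mul, abs_of_pos (show 0 < Real.pi / n by positivity)]
  have : 0 < Real.pi / n := by positivity
  nlinarith

lemma stdAddChar_intCast {n : ℕ} [NeZero n] (k : ℤ) :
    (ZMod.stdAddChar (k : ZMod n) : ℂ) = Complex.exp (Complex.I * (2 * Real.pi / n * k : ℝ)) := by
  rw [ZMod.stdAddChar_coe]
  congr 1
  push_cast; ring

/-- The bump on the plane about the direction `χ j`. -/
def evenBump (n : ℕ) [NeZero n] (j : ZMod n) (w : ℂ) : ℝ :=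
  sectorBump n (ZMod.stdAddChar (-j) * w)

/-- The bump on the plane about the direction half-way between `χ j` and `χ (j + 1)`. -/
def oddBump (n : ℕ) [NeZero n] (j : ZMod n) (w : ℂ) : ℝ :=
  sectorBump n (Complex.exp (Complex.I * (2 * Real.pi / n * (-(1 / 2)) : ℝ)) *
    (ZMod.stdAddChar (-j) * w))

lemma evenBump_eq {n : ℕ} [NeZero n] (k : ℤ) (w : ℂ) : evenBump n (-k : ℤ) w
    = sectorBump n (Complex.exp (Complex.I * (2 * Real.pi / n * k : ℝ)) * w) := by
  rw [evenBump, ← Int.cast_neg, neg_neg, stdAddChar_intCast]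

lemma oddBump_eq {n : ℕ} [NeZero n] (k : ℤ) (w : ℂ) : oddBump n (-k : ℤ) w
    = sectorBump n (Complex.exp (Complex.I * (2 * Real.pi / n * (k - 1 / 2) : ℝ)) * w) := by
  rw [oddBump, ← Int.cast_neg, neg_neg, stdAddChar_intCast, ← mul_assoc, ← Complex.exp_add]
  congr 3
  push_cast; ring

lemma exists_active {n : ℕ} [NeZero n] (w : ℂ) :
    ∃ j₀ j₁ : ZMod n, (j₁ = j₀ ∨ j₁ = j₀ + 1) ∧ (∀ j, j ≠ j₀ → oddBump n j w = 0) ∧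
      (∀ j, j ≠ j₁ → evenBump n j w = 0) ∧ (w ≠ 0 → 0 < oddBump n j₀ w ∨ 0 < evenBump n j₁ w) := by
  have hn : 1 ≤ n := NeZero.one_le
  have hE : ∀ j, 0 ≤ evenBump n j w := fun j => sectorBump_nonneg _ _
  have hO : ∀ j, 0 ≤ oddBump n j w := fun j => sectorBump_nonneg _ _
  have lift : ∀ j : ZMod n, ∃ k : ℤ, j = ((-k : ℤ) : ZMod n) := fun j => by
    obtain ⟨k, hk⟩ := ZMod.intCast_surjective j
    exact ⟨-k, by rw [neg_neg, hk]⟩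
  have hcast : ∀ a b m : ℤ, a - b + n * m = 0 → ((-a : ℤ) : ZMod n) = ((-b : ℤ) : ZMod n) := by
    intro a b m h
    have := congrArg (Int.cast : ℤ → ZMod n) h
    push_cast at this ⊢
    rw [ZMod.natCast_self] at this
    linear_combination -this
  have EE : ∀ j j', 0 < evenBump n j w → 0 < evenBump n j' w → j = j' := by
    intro j j' h h'
    obtain ⟨a, rfl⟩ := lift j
    obtain ⟨b, rfl⟩ := lift j'
    rw [evenBump_eq] at h h'
    obtain ⟨m, hm⟩ := exists_int_of_sectorBump_pos hn h h'
    exact hcast a b m (Int.abs_lt_one_iff.1 (by exact_mod_cast hm))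
  have OO : ∀ j j', 0 < oddBump n j w → 0 < oddBump n j' w → j = j' := by
    intro j j' h h'
    obtain ⟨a, rfl⟩ := lift j
    obtain ⟨b, rfl⟩ := lift j'
    rw [oddBump_eq] at h h'
    obtain ⟨m, hm⟩ := exists_int_of_sectorBump_pos hn h h'
    rw [sub_sub_sub_cancel_right] at hm
    exact hcast a b m (Int.abs_lt_one_iff.1 (by exact_mod_cast hm))
  have OE : ∀ j j', 0 < oddBump n j w → 0 < evenBump n j' w → j' = j ∨ j' = j + 1 := by
    intro j j' h h'
    obtain ⟨a, rfl⟩ := lift j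
    obtain ⟨b, rfl⟩ := lift j'
    rw [oddBump_eq] at h
    rw [evenBump_eq] at h'
    obtain ⟨m, hm⟩ := exists_int_of_sectorBump_pos hn h h'
    obtain ⟨h1, h2⟩ := abs_lt.1 hm
    have h1' : (-1 : ℤ) < a - b + n * m := by
      have : (-1 : ℝ) < ((a - b + n * m : ℤ) : ℝ) := by push_cast; linarith
      exact_mod_cast this
    have h2' : a - b + n * m < (2 : ℤ) := by
      have : ((a - b + n * m : ℤ) : ℝ) < 2 := by push_cast; linarith
      exact_mod_cast this
    rcases (by omega : a - b + n * m = 0 ∨ a - b + n * m = 1) with h | h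
    · exact Or.inl (hcast a b m h).symm
    · right
      have := congrArg (Int.cast : ℤ → ZMod n) h
      push_cast at this ⊢
      rw [ZMod.natCast_self] at this
      linear_combination this
  have hz : w ≠ 0 → ∃ j, 0 < oddBump n j w ∨ 0 < evenBump n j w := by
    intro hw
    obtain ⟨k, hk⟩ := exists_sectorBump_pos hn hw
    rcases Int.even_or_odd' k with ⟨c, rfl | rfl⟩
    · refine ⟨(-c : ℤ), Or.inr ?_⟩
      rw [evenBump_eq]
      convert hk using 6
      push_cast; ring
    · refine ⟨(-(c + 1) : ℤ), Or.inl ?_⟩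
      rw [oddBump_eq]
      convert hk using 6
      push_cast; ring
  have eqz : ∀ {x : ℝ}, 0 ≤ x → ¬ 0 < x → x = 0 := fun h h' => le_antisymm (not_lt.1 h') h
  by_cases h0 : ∃ j₀, 0 < oddBump n j₀ w
  · obtain ⟨j₀, h0⟩ := h0
    have c0 : ∀ j, j ≠ j₀ → oddBump n j w = 0 := fun j hj =>
      eqz (hO j) fun h => hj (OO _ _ h h0)
    by_cases h1 : ∃ j₁, 0 < evenBump n j₁ w
    · obtain ⟨j₁, h1⟩ := h1
      exact ⟨j₀, j₁, OE _ _ h0 h1, c0, fun j hj => eqz (hE j) fun h => hj (EE _ _ h h1),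
        fun _ => Or.inl h0⟩
    · exact ⟨j₀, j₀, Or.inl rfl, c0, fun j _ => eqz (hE j) fun h => h1 ⟨j, h⟩,
        fun _ => Or.inl h0⟩
  · by_cases h1 : ∃ j₁, 0 < evenBump n j₁ w
    · obtain ⟨j₁, h1⟩ := h1
      exact ⟨j₁, j₁, Or.inl rfl, fun j _ => eqz (hO j) fun h => h0 ⟨j, h⟩,
        fun j hj => eqz (hE j) fun h => hj (EE _ _ h h1), fun _ => Or.inr h1⟩
    · refine ⟨0, 0, Or.inl rfl, fun j _ => eqz (hO j) fun h => h0 ⟨j, h⟩,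
        fun j _ => eqz (hE j) fun h => h1 ⟨j, h⟩, fun hw => ?_⟩
      obtain ⟨j, h | h⟩ := hz hw
      · exact absurd ⟨j, h⟩ h0
      · exact absurd ⟨j, h⟩ h1

lemma continuous_evenBump {n : ℕ} [NeZero n] (j : ZMod n) : Continuous (evenBump n j) :=
  (continuous_sectorBump n).comp (by fun_prop)

lemma continuous_oddBump {n : ℕ} [NeZero n] (j : ZMod n) : Continuous (oddBump n j) :=
  (continuous_sectorBump n).comp (by fun_prop)

/-- The bumps on the two coordinate planes, arranged in four classes. -/
def pairBump (n : ℕ) [NeZero n] (i : Fin 4) (j : ZMod n) (z : ℂ × ℂ) : ℝ :=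
  (![oddBump n j z.1, evenBump n j z.1, oddBump n j z.2, evenBump n j z.2] : Fin 4 → ℝ) i

/-- A combination of the bumps with prescribed weights. -/
def weightedBump (n : ℕ) [NeZero n] (w : Fin 4 → ZMod n → ℝ) (z : ℂ × ℂ) : ℝ :=
  ∑ i, ∑ j, pairBump n i j z * w i j

lemma continuous_weightedBump {n : ℕ} [NeZero n] (w : Fin 4 → ZMod n → ℝ) :
    Continuous (weightedBump n w) := by
  refine continuous_finsetSum _ fun i _ => continuous_finsetSum _ fun j _ => ?_
  refine Continuous.mul ?_ continuous_const
  fin_cases i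
  · exact (continuous_oddBump j).comp continuous_fst
  · exact (continuous_evenBump j).comp continuous_fst
  · exact (continuous_oddBump j).comp continuous_snd
  · exact (continuous_evenBump j).comp continuous_snd

lemma pairBump_smul {n : ℕ} [NeZero n] (i : Fin 4) (j r : ZMod n) (z : ℂ × ℂ) :
    pairBump n i j ((ZMod.stdAddChar r : ℂ) • z) = pairBump n i (j - r) z := by
  have h : ∀ u : ℂ, (ZMod.stdAddChar (-j) : ℂ) * (ZMod.stdAddChar r * u)
      = ZMod.stdAddChar (-(j - r)) * u := fun u => by
    rw [← mul_assoc, ← AddChar.map_add_eq_mul]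
    congr 2; ring
  fin_cases i <;> simp [pairBump, oddBump, evenBump, h]

/-- On the orbit of a nonzero point, a weighted bump is a nontrivial nonnegative combination of
four translates of its weight functions. -/
lemma weightedBump_orbit {n : ℕ} [NeZero n] {z : ℂ × ℂ} (hz : z ≠ 0) :
    ∃ (c : Fin 4 → ℝ) (j : Fin 4 → ZMod n), (∀ i, 0 ≤ c i) ∧ c ≠ 0 ∧
      (j 1 = j 0 ∨ j 1 = j 0 + 1) ∧ (j 3 = j 2 ∨ j 3 = j 2 + 1) ∧
      ∀ (w : Fin 4 → ZMod n → ℝ) (r : ZMod n),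
        weightedBump n w ((ZMod.stdAddChar r : ℂ) • z) = ∑ i, c i * w i (j i + r) := by
  obtain ⟨j₀, j₁, h01, h0, h1, p1⟩ := exists_active (n := n) z.1
  obtain ⟨j₂, j₃, h23, h2, h3, p2⟩ := exists_active (n := n) z.2
  have hne : z.1 ≠ 0 ∨ z.2 ≠ 0 := by
    by_contra! h
    exact hz (Prod.ext h.1 h.2)
  set J : Fin 4 → ZMod n := ![j₀, j₁, j₂, j₃] with hJ
  have hzero : ∀ i j, j ≠ J i → pairBump n i j z = 0 := by
    intro i j hj
    fin_cases i
    · exact h0 j hj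
    · exact h1 j hj
    · exact h2 j hj
    · exact h3 j hj
  refine ⟨fun i => pairBump n i (J i) z, J, fun i => ?_, fun hc => ?_, h01, h23, fun w r => ?_⟩
  · fin_cases i <;> exact sectorBump_nonneg _ _
  · have e0 : oddBump n j₀ z.1 = 0 := congrFun hc 0
    have e1 : evenBump n j₁ z.1 = 0 := congrFun hc 1
    have e2 : oddBump n j₂ z.2 = 0 := congrFun hc 2
    have e3 : evenBump n j₃ z.2 = 0 := congrFun hc 3
    rw [e0, e1] at p1
    rw [e2, e3] at p2
    rcases hne with h | h
    · simpa using p1 h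
    · simpa using p2 h
  · unfold weightedBump
    refine Finset.sum_congr rfl fun i _ => ?_
    rw [Finset.sum_eq_single (J i + r)]
    · rw [pairBump_smul, add_sub_cancel_right]
    · intro b _ hb
      rw [pairBump_smul, hzero, zero_mul]
      intro h
      exact hb (by rw [← h]; ring)
    · simp

/-- There are weights for which no four independent coincidences occur on an orbit. -/
lemma exists_weights (n : ℕ) [NeZero n] : ∃ w : Fin 4 → ZMod n → ℝ,
    ∀ j e b : Fin 4 → ZMod n, Function.Injective e → (∀ k l, b k ≠ e l) →
      (Matrix.of fun k i => w i (j i + e k) - w i (j i + b k)).det ≠ 0 := by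
  classical
  let M : (Fin 4 → ZMod n) → (Fin 4 → ZMod n) → (Fin 4 → ZMod n) →
      Matrix (Fin 4) (Fin 4) (MvPolynomial (Fin 4 × ZMod n) ℝ) := fun j e b =>
    Matrix.of fun k i => MvPolynomial.X (i, j i + e k) - MvPolynomial.X (i, j i + b k)
  have hev : ∀ (x : Fin 4 × ZMod n → ℝ) j e b, MvPolynomial.eval x (M j e b).det
      = (Matrix.of fun k i => x (i, j i + e k) - x (i, j i + b k)).det := by
    intro x j e b
    rw [RingHom.map_det]
    congr 1
    ext k i
    simp [M]
  let s : Finset ((Fin 4 → ZMod n) × (Fin 4 → ZMod n) × (Fin 4 → ZMod n)) :=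
    Finset.univ.filter fun q => Function.Injective q.2.1 ∧ ∀ k l, q.2.2 k ≠ q.2.1 l
  have hne : ∏ q ∈ s, (M q.1 q.2.1 q.2.2).det ≠ 0 := by
    refine Finset.prod_ne_zero_iff.2 ?_
    rintro ⟨j, e, b⟩ hq h0
    obtain ⟨-, he, hb⟩ := Finset.mem_filter.1 hq
    have := hev (fun q => if q.2 = j q.1 + e q.1 then 1 else 0) j e b
    dsimp only at h0 he hb
    rw [h0, map_zero] at this
    have h1 : (Matrix.of fun k i => (if j i + e k = j i + e i then (1 : ℝ) else 0)
        - (if j i + b k = j i + e i then 1 else 0)) = (1 : Matrix (Fin 4) (Fin 4) ℝ) := by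
      ext k i
      simp only [Matrix.of_apply, add_right_inj, he.eq_iff, hb k i, if_false, sub_zero,
        Matrix.one_apply]
    rw [h1, Matrix.det_one] at this
    exact zero_ne_one this
  obtain ⟨x, hx⟩ : ∃ x, MvPolynomial.eval x (∏ q ∈ s, (M q.1 q.2.1 q.2.2).det) ≠ 0 := by
    by_contra! h
    exact hne (MvPolynomial.funext fun x => by rw [h x, map_zero])
  refine ⟨fun i j => x (i, j), fun j e b he hb => ?_⟩
  rw [map_prod, Finset.prod_ne_zero_iff] at hx
  rw [← hev]
  exact hx (j, e, b) (Finset.mem_filter.2 ⟨Finset.mem_univ _, he, hb⟩)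

/-- A function on the plane pairs admitting no four independent coincidences on any orbit. -/
def IsGeneric (n : ℕ) [NeZero n] (g : ℂ × ℂ → ℝ) : Prop :=
  ∀ z, z ≠ 0 → ∀ e b : Fin 4 → ZMod n, Function.Injective e → (∀ k l, b k ≠ e l) →
    ∃ k, g ((ZMod.stdAddChar (e k) : ℂ) • z) ≠ g ((ZMod.stdAddChar (b k) : ℂ) • z)

lemma exists_isGeneric (n : ℕ) [NeZero n] : ∃ g : ℂ × ℂ → ℝ, Continuous g ∧ IsGeneric n g := by
  obtain ⟨w, hw⟩ := exists_weights n
  refine ⟨weightedBump n w, continuous_weightedBump w, fun z hz e b he hb => ?_⟩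
  obtain ⟨c, j, -, hc, -, -, hv⟩ := weightedBump_orbit (n := n) hz
  by_contra! hcon
  refine hc (Matrix.eq_zero_of_mulVec_eq_zero (hw j e b he hb) ?_)
  ext k
  have := hcon k
  rw [hv, hv, ← sub_eq_zero, ← Finset.sum_sub_distrib] at this
  rw [Matrix.mulVec, dotProduct, Pi.zero_apply, ← this]
  refine Finset.sum_congr rfl fun i _ => ?_
  rw [Matrix.of_apply]; ring

lemma ZMod.val_sub_val_of_ne {d : ℕ} [NeZero d] {j : ZMod d} (h : j ≠ -1) :
    (((j + 1).val : ℕ) : ℝ) - (j.val : ℕ) = 1 := by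
  have h1 : j.val + 1 < d := by
    refine lt_of_le_of_ne (ZMod.val_lt j) fun he => h ?_
    have := congrArg (Nat.cast : ℕ → ZMod d) he
    push_cast at this
    rw [ZMod.natCast_zmod_val, ZMod.natCast_self] at this
    linear_combination this
  rcases Nat.lt_or_ge 1 d with hd | hd
  · have : Fact (1 < d) := ⟨hd⟩
    rw [ZMod.val_add_of_lt (by rwa [ZMod.val_one]), ZMod.val_one]
    push_cast; ring
  · omega

/-- For `d ≥ 7` some function increases along one of the first three steps of every orbit. -/
lemma exists_step_of_seven_le {d : ℕ} [NeZero d] (hd : 7 ≤ d) :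
    ∃ g : ℂ × ℂ → ℝ, Continuous g ∧ ∀ z, z ≠ 0 → ∃ r : ℕ, r < 3 ∧
      g ((ZMod.stdAddChar (r : ZMod d) : ℂ) • z)
        ≠ g ((ZMod.stdAddChar ((r + 1 : ℕ) : ZMod d) : ℂ) • z) := by
  let w : Fin 4 → ZMod d → ℝ := ![fun j => ((j - 1).val : ℝ), fun j => ((j - 5).val : ℝ),
    fun j => ((j - 1).val : ℝ), fun j => ((j - 5).val : ℝ)]
  refine ⟨weightedBump d w, continuous_weightedBump w, fun z hz => ?_⟩
  obtain ⟨c, j, hc, hc0, h01, h23, hv⟩ := weightedBump_orbit (n := d) hz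
  have hk : ∀ k : ℤ, |k| < 7 → (k : ZMod d) = 0 → k = 0 := fun k h7 h => by
    rw [ZMod.intCast_zmod_eq_zero_iff_dvd] at h
    refine Int.eq_zero_of_abs_lt_dvd h ?_
    have : (7 : ℤ) ≤ d := by exact_mod_cast hd
    omega
  have hlt : ∀ k : ℤ, -7 < k → k < 7 → |k| < 7 := fun k h1 h2 => abs_lt.2 ⟨h1, h2⟩
  have bad : ∀ a b : ZMod d, (b = a ∨ b = a + 1) → ∃ t : ℕ, ∀ r : ℕ, r < 3 → r ≠ t →
      a + r ≠ 0 ∧ b + r ≠ 4 := by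
    intro a b hab
    by_cases h : ∃ t : ℕ, t < 3 ∧ a + t = 0
    · obtain ⟨t, ht, hat⟩ := h
      refine ⟨t, fun r hr hrt => ⟨fun h' => ?_, fun h' => ?_⟩⟩
      · have := hk (r - t) (hlt _ (by omega) (by omega))
          (by push_cast; linear_combination h' - hat)
        omega
      · rcases hab with rfl | rfl
        · have := hk (r - t - 4) (hlt _ (by omega) (by omega))
            (by push_cast; linear_combination h' - hat)
          omega
        · have := hk (r - t - 3) (hlt _ (by omega) (by omega))
            (by push_cast; linear_combination h' - hat)
          omega
    · by_cases h2 : ∃ t : ℕ, t < 3 ∧ b + t = 4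
      · obtain ⟨t, ht, hbt⟩ := h2
        refine ⟨t, fun r hr hrt => ⟨fun h' => h ⟨r, hr, h'⟩, fun h' => ?_⟩⟩
        have := hk (r - t) (hlt _ (by omega) (by omega))
          (by push_cast; linear_combination h' - hbt)
        omega
      · exact ⟨0, fun r hr _ => ⟨fun h' => h ⟨r, hr, h'⟩, fun h' => h2 ⟨r, hr, h'⟩⟩⟩
  obtain ⟨t, ht⟩ := bad _ _ h01
  obtain ⟨t', ht'⟩ := bad _ _ h23
  obtain ⟨r, hr, h1, h2⟩ : ∃ r : ℕ, r < 3 ∧ r ≠ t ∧ r ≠ t' := by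
    by_contra! h
    have a0 := h 0 (by norm_num)
    have a1 := h 1 (by norm_num)
    have a2 := h 2 (by norm_num)
    omega
  refine ⟨r, hr, fun he => ?_⟩
  rw [hv, hv, eq_comm, ← sub_eq_zero, ← Finset.sum_sub_distrib] at he
  have hone : ∀ i, w i (j i + (r + 1 : ℕ)) - w i (j i + r) = 1 := by
    have key : ∀ (a q : ZMod d), a + r ≠ q - 1 →
        (((a + (r + 1 : ℕ) - q).val : ℕ) : ℝ) - ((a + r - q).val : ℕ) = 1 := by
      intro a q h
      have e : a + (r + 1 : ℕ) - q = (a + r - q) + 1 := by push_cast; ring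
      rw [e]
      exact ZMod.val_sub_val_of_ne fun h' => h (by linear_combination h')
    have h54 : (5 : ZMod d) - 1 = 4 := by ring
    intro i
    fin_cases i
    · exact key _ 1 (by rw [sub_self]; exact (ht r hr h1).1)
    · exact key _ 5 (by rw [h54]; exact (ht r hr h1).2)
    · exact key _ 1 (by rw [sub_self]; exact (ht' r hr h2).1)
    · exact key _ 5 (by rw [h54]; exact (ht' r hr h2).2)
  have hs : ∑ i, c i = 0 := by
    rw [← he]
    refine Finset.sum_congr rfl fun i _ => ?_
    rw [← mul_sub, hone, mul_one]
  rw [Finset.sum_eq_zero_iff_of_nonneg fun i _ => hc i] at hs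
  exact hc0 (funext fun i => hs i (Finset.mem_univ _))

lemma ne_zero_of_mem_sphereC2 {z : ℂ × ℂ} (hz : z ∈ sphereC2) : z ≠ 0 := by
  rintro rfl
  simp [sphereC2] at hz

lemma stdAddChar_nsmul {n : ℕ} [NeZero n] (k : ℕ) (m : ZMod n) :
    (ZMod.stdAddChar (k • m) : ℂ) = ZMod.stdAddChar m ^ k := by
  rw [AddChar.map_nsmul_eq_pow]

/-- An arithmetic progression of four terms whose step has order at least seven. -/
lemma separable_of_progression {n : ℕ} [NeZero n] {S : Finset (ZMod n)} {x m : ZMod n}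
    (hm : 7 ≤ addOrderOf m) (hS : ∀ i : ℕ, i < 4 → x + i • m ∈ S) : Separable n S := by
  set d := addOrderOf m with hd
  have : NeZero d := ⟨by omega⟩
  obtain ⟨g, hg, hg'⟩ := exists_step_of_seven_le hm
  have hprim : IsPrimitiveRoot (ZMod.stdAddChar m : ℂ) d := by
    refine ⟨?_, fun l hl => ?_⟩
    · rw [← stdAddChar_nsmul, hd, addOrderOf_nsmul_eq_zero, AddChar.map_zero_eq_one]
    · rw [← stdAddChar_nsmul, ← AddChar.map_zero_eq_one (ZMod.stdAddChar (N := n))] at hl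
      exact addOrderOf_dvd_of_nsmul_eq_zero (ZMod.injective_stdAddChar hl)
  obtain ⟨l, -, hl⟩ := hprim.eq_pow_of_pow_eq_one
    (show (ZMod.stdAddChar (1 : ZMod d) : ℂ) ^ d = 1 by
      rw [← stdAddChar_nsmul, nsmul_eq_mul, ZMod.natCast_self, zero_mul, AddChar.map_zero_eq_one])
  have hd1 : (ZMod.stdAddChar (1 : ZMod d) : ℂ) ≠ 1 := by
    intro h
    rw [← AddChar.map_zero_eq_one (ZMod.stdAddChar (N := d))] at h
    have h1 := ZMod.injective_stdAddChar h
    have : Fact (1 < d) := ⟨by omega⟩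
    exact one_ne_zero h1
  have hl0 : l ≠ 0 := by rintro rfl; exact hd1 (by rw [← hl, pow_zero])
  have hpow : ∀ k : ℕ, ∀ z : ℂ × ℂ, ((((ZMod.stdAddChar (k • m) : ℂ) • z).1 ^ l,
      ((ZMod.stdAddChar (k • m) : ℂ) • z).2 ^ l) : ℂ × ℂ)
      = (ZMod.stdAddChar (k : ZMod d) : ℂ) • (z.1 ^ l, z.2 ^ l) := by
    intro k z
    have : (ZMod.stdAddChar (k • m) : ℂ) ^ l = ZMod.stdAddChar (k : ZMod d) := by
      rw [stdAddChar_nsmul, pow_right_comm, hl, ← stdAddChar_nsmul, nsmul_one]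
    refine Prod.ext ?_ ?_ <;>
      simp only [Prod.smul_fst, Prod.smul_snd, smul_eq_mul, mul_pow, this]
  refine Separable.translate x (S := S.image fun s => s - x) (fun s hs => ?_) ?_
  · obtain ⟨t, ht, rfl⟩ := Finset.mem_image.1 hs
    simpa using ht
  refine ⟨fun z => g (z.1 ^ l, z.2 ^ l), (hg.comp (by fun_prop)).continuousOn, fun z hz => ?_⟩
  have hz0 := ne_zero_of_mem_sphereC2 hz
  obtain ⟨r, hr, h⟩ := hg' (z.1 ^ l, z.2 ^ l) fun h0 => hz0 (Prod.ext
    (pow_eq_zero_iff hl0 |>.1 (congrArg Prod.fst h0)) (pow_eq_zero_iff hl0 |>.1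
      (congrArg Prod.snd h0)))
  refine ⟨r • m, Finset.mem_image.2 ⟨x + r • m, hS r (by omega), by ring⟩, (r + 1) • m,
    Finset.mem_image.2 ⟨x + (r + 1) • m, hS (r + 1) (by omega), by ring⟩, ?_⟩
  dsimp only
  rw [hpow, hpow]
  exact h

lemma Separable.of_base {n : ℕ} [NeZero n] {S : Finset (ZMod n)} (x : ZMod n) {g : ℂ × ℂ → ℝ}
    (hg : Continuous g) (h : ∀ z : ℂ × ℂ, z ≠ 0 → ¬ ∀ s t, x + s ∈ S → x + t ∈ S →
      g ((ZMod.stdAddChar s : ℂ) • z) = g ((ZMod.stdAddChar t : ℂ) • z)) : Separable n S := by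
  refine Separable.translate x (S := S.image fun s => s - x) (fun s hs => ?_) ?_
  · obtain ⟨t, ht, rfl⟩ := Finset.mem_image.1 hs
    simpa using ht
  refine ⟨g, hg.continuousOn, fun z hz => ?_⟩
  have := h z (ne_zero_of_mem_sphereC2 hz)
  push Not at this
  obtain ⟨s, t, hs, ht, hst⟩ := this
  exact ⟨s, Finset.mem_image.2 ⟨_, hs, by ring⟩, t, Finset.mem_image.2 ⟨_, ht, by ring⟩, hst⟩

lemma coords_of_sq_eq {w : ℂ} (hw : w ^ 2 = w - 1) : w.re = 1 / 2 ∧ w.im ^ 2 = 3 / 4 := by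
  have h1 := congrArg Complex.re hw
  have h2 := congrArg Complex.im hw
  simp only [pow_two, Complex.mul_re, Complex.mul_im, Complex.sub_re, Complex.sub_im,
    Complex.one_re, Complex.one_im] at h1 h2
  have h3 : w.im * (2 * w.re - 1) = 0 := by linarith
  rcases mul_eq_zero.1 h3 with h | h
  · rw [h] at h1
    nlinarith [sq_nonneg (w.re - 1 / 2)]
  · have : w.re = 1 / 2 := by linarith
    refine ⟨this, ?_⟩
    rw [this] at h1
    nlinarith

/-- An arithmetic progression of four terms whose step has order six. -/
lemma separable_of_progression_six {n : ℕ} [NeZero n] {S : Finset (ZMod n)} {x m : ZMod n}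
    (hm : (ZMod.stdAddChar m : ℂ) ^ 2 = ZMod.stdAddChar m - 1)
    (hS : ∀ i : ℕ, i < 4 → x + i • m ∈ S) : Separable n S := by
  refine Separable.of_base x (g := fun z => (z.2 ^ 2 - (starRingEnd ℂ) z.1 ^ 4).re
    + (z.2 * z.1 ^ 2).re) (by fun_prop) fun z hz hcon => ?_
  have e01 := hcon _ _ (hS 0 (by norm_num)) (hS 1 (by norm_num))
  have e12 := hcon _ _ (hS 1 (by norm_num)) (hS 2 (by norm_num))
  have e23 := hcon _ _ (hS 2 (by norm_num)) (hS 3 (by norm_num))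
  simp only [stdAddChar_nsmul] at e01 e12 e23
  set w : ℂ := ZMod.stdAddChar m
  obtain ⟨hre, him⟩ := coords_of_sq_eq hm
  have hconj : (starRingEnd ℂ) w = 1 - w := by
    apply Complex.ext <;> simp [hre]; norm_num
  obtain ⟨u, v⟩ := z
  set Q := v ^ 2 - (starRingEnd ℂ) u ^ 4 with hQ
  set P := v * u ^ 2 with hP
  have hval : ∀ c : ℂ, (starRingEnd ℂ) c ^ 4 = c ^ 2 →
      ((c * v) ^ 2 - (starRingEnd ℂ) (c * u) ^ 4).re + ((c * v) * (c * u) ^ 2).re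
        = (c ^ 2 * Q).re + (c ^ 3 * P).re := by
    intro c hc
    rw [map_mul, mul_pow ((starRingEnd ℂ) c), hc, hQ, hP]
    congr 2 <;> ring
  have h3 : w ^ 3 = -1 := by linear_combination (w + 1) * hm
  have hw4 : w ^ 4 = -w := by linear_combination w * h3
  have hc1 : (starRingEnd ℂ) w ^ 4 = w ^ 2 := by
    rw [hconj]; linear_combination (w ^ 2 - 3 * w + 1) * hm
  simp only [Prod.smul_fst, Prod.smul_snd, smul_eq_mul] at e01 e12 e23
  have hck : ∀ k : ℕ, (starRingEnd ℂ) (w ^ k) ^ 4 = (w ^ k) ^ 2 := fun k => by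
    rw [map_pow, ← pow_mul, mul_comm k 4, pow_mul, hc1, ← pow_mul, ← pow_mul, mul_comm]
  rw [hval _ (hck 0), hval _ (hck 1)] at e01
  rw [hval _ (hck 1), hval _ (hck 2)] at e12
  rw [hval _ (hck 2), hval _ (hck 3)] at e23
  have p2 : (w ^ 2) ^ 2 = -w := by rw [← pow_mul, hw4]
  have p3 : (w ^ 2) ^ 3 = 1 := by rw [← pow_mul, mul_comm, pow_mul, h3]; norm_num
  rw [p2, p3] at e12 e23
  rw [h3] at e23
  rw [pow_one, h3, hm] at e12 e01
  simp only [pow_zero, one_pow, Complex.mul_re, Complex.sub_re, Complex.sub_im, Complex.one_re,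
    Complex.one_im, Complex.neg_re, Complex.neg_im, hre] at e01 e12 e23
  norm_num at e01 e12 e23
  have hPre : P.re = 0 := by linarith
  have hQre : Q.re = 0 := by linarith
  have hQim : Q.im = 0 := by
    have h0 : w.im * Q.im = 0 := by linarith
    rcases mul_eq_zero.1 h0 with h | h
    · rw [h] at him; norm_num at him
    · exact h
  have hQ0 : v ^ 2 = ((starRingEnd ℂ) u ^ 2) ^ 2 := by
    rw [← pow_mul, ← sub_eq_zero]
    exact Complex.ext hQre hQim
  have hu4 : ((starRingEnd ℂ) u ^ 2 * u ^ 2).re = 0 := by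
    rcases sq_eq_sq_iff_eq_or_eq_neg.1 hQ0 with h | h
    · rw [hP, h] at hPre; exact hPre
    · rw [hP, h, neg_mul, Complex.neg_re] at hPre; linarith
  rw [← mul_pow, mul_comm, Complex.mul_conj, ← Complex.ofReal_pow, Complex.ofReal_re] at hu4
  have hu : u = 0 := Complex.normSq_eq_zero.1 (pow_eq_zero_iff two_ne_zero |>.1 hu4)
  have hv : v = 0 := by
    rw [hu] at hQ0
    simpa using hQ0
  exact hz (by rw [hu, hv]; rfl)

/-- Two antipodal pairs whose difference has order six. -/
lemma separable_of_rectangle_six {n : ℕ} [NeZero n] {S : Finset (ZMod n)} {x u h : ZMod n}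
    (hu : (ZMod.stdAddChar u : ℂ) ^ 2 = ZMod.stdAddChar u - 1)
    (hh : (ZMod.stdAddChar h : ℂ) = -1) (h0 : x + 0 ∈ S) (h1 : x + u ∈ S) (h2 : x + h ∈ S)
    (h3 : x + (u + h) ∈ S) : Separable n S := by
  set w : ℂ := ZMod.stdAddChar u with hw
  let o : ℂ × ℂ → ℝ := fun z => z.1.re * Complex.normSq z.1 + (z.1 ^ 3).re / 2 + (z.2 ^ 3).re
    + 2 * (w * z.1 ^ 2 * z.2).re
  let e : ℂ × ℂ → ℝ := fun z => ((1 - w ^ 2)⁻¹ * (z.2 ^ 2 + w * z.1 ^ 2)).re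
  have hoc : Continuous o := by
    have := Complex.continuous_normSq
    fun_prop
  have hec : Continuous e := by fun_prop
  have hodd : ∀ z, o ((-1 : ℂ) • z) = - o z := fun z => by
    simp only [o, Prod.smul_fst, Prod.smul_snd, smul_eq_mul, neg_one_mul, Complex.normSq_neg,
      Complex.neg_re, Odd.neg_pow (by decide : Odd 3), neg_sq, mul_neg]
    ring
  have heven : ∀ z, e ((-1 : ℂ) • z) = e z := fun z => by
    simp only [e, Prod.smul_fst, Prod.smul_snd, smul_eq_mul, neg_one_mul, neg_sq]
  obtain ⟨hre, him⟩ := coords_of_sq_eq hu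
  have hw3 : w ^ 3 = -1 := by linear_combination (w + 1) * hu
  refine Separable.of_base x (g := fun z => o z + e z) (hoc.add hec) fun z hz hcon => ?_
  have a1 := hcon _ _ h0 h2
  have a2 := hcon _ _ h1 h3
  have a3 := hcon _ _ h0 h1
  simp only [AddChar.map_zero_eq_one, one_smul, AddChar.map_add_eq_mul, hh, ← hw] at a1 a2 a3
  rw [mul_comm, mul_smul] at a2
  rw [hodd, heven] at a1 a2
  have o0 : o z = 0 := by linarith
  have o1 : o (w • z) = 0 := by linarith
  have he : e z = e (w • z) := by linarith
  obtain ⟨p, v⟩ := z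
  have hn1 : 1 - w ^ 2 ≠ 0 := by
    intro h
    have := congrArg Complex.re h
    rw [hu] at this
    simp [hre] at this
    norm_num at this
  have hE : (v ^ 2 + w * p ^ 2).re = 0 := by
    have : v ^ 2 + w * p ^ 2 = (1 - w ^ 2)⁻¹ * (v ^ 2 + w * p ^ 2)
        - (1 - w ^ 2)⁻¹ * ((w * v) ^ 2 + w * (w * p) ^ 2) := by
      field_simp
    rw [this, Complex.sub_re]
    exact sub_eq_zero.2 he
  have hsum : o (p, v) + o (w • (p, v)) = (p + w * p).re * Complex.normSq p := by
    have hnw : Complex.normSq w = 1 := by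
      rw [Complex.normSq_apply, hre]; nlinarith
    simp only [o, Prod.smul_fst, Prod.smul_snd, smul_eq_mul, map_mul, hnw, mul_pow, hw3]
    have : w * (w ^ 2 * p ^ 2) * (w * v) = - (w * p ^ 2 * v) := by
      linear_combination w * p ^ 2 * v * hw3
    rw [this]
    simp only [neg_mul, one_mul, Complex.neg_re, Complex.add_re]
    ring
  rw [o0, o1, add_zero] at hsum
  have hp : p.im = 2 * w.im * p.re := by
    rcases mul_eq_zero.1 hsum.symm with h | h
    · simp only [Complex.add_re, Complex.mul_re, hre] at h
      have : w.im * p.im = 3 / 2 * p.re := by linarith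
      linear_combination 4 / 3 * w.im * this - 4 / 3 * p.im * him
    · rw [Complex.normSq_eq_zero.1 h]; simp
  have hps : p = (2 * p.re : ℝ) * w := by
    apply Complex.ext
    · rw [Complex.re_ofReal_mul, hre]; ring
    · rw [Complex.im_ofReal_mul, hp]; ring
  set s := 2 * p.re with hs
  have hp2 : w * p ^ 2 = ((-s ^ 2 : ℝ) : ℂ) := by
    rw [hps]; push_cast
    linear_combination (s : ℂ) ^ 2 * hw3
  have hp3 : p ^ 3 = ((-s ^ 3 : ℝ) : ℂ) := by
    rw [hps]; push_cast
    linear_combination (s : ℂ) ^ 3 * hw3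
  have hpn : Complex.normSq p = s ^ 2 := by
    rw [Complex.normSq_apply, hp, hs]; nlinarith
  rw [hp2] at hE
  simp only [o] at o0
  rw [hp2, hp3, hpn, Complex.re_ofReal_mul, Complex.ofReal_re] at o0
  simp only [pow_succ, pow_zero, one_mul, Complex.add_re, Complex.mul_re, Complex.mul_im,
    Complex.ofReal_re] at hE o0
  have f1 : v.re * (v.re ^ 2 - 3 * v.im ^ 2 - 2 * s ^ 2) = 0 := by
    have : p.re = s / 2 := by rw [hs]; ring
    rw [this] at o0
    linarith
  have f2 : v.re ^ 2 - v.im ^ 2 - s ^ 2 = 0 := by linarith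
  have f3 : v.im ^ 2 = 0 ∧ s ^ 2 = 0 := by
    have i1 := sq_nonneg v.im
    have i2 := sq_nonneg s
    rcases mul_eq_zero.1 f1 with h | h
    · rw [h] at f2
      constructor <;> linarith
    · constructor <;> linarith
  rw [f3.1, f3.2, sub_zero, sub_zero] at f2
  have f4 := pow_eq_zero_iff two_ne_zero |>.1 f2
  have f5 := pow_eq_zero_iff two_ne_zero |>.1 f3.1
  have f6 := pow_eq_zero_iff two_ne_zero |>.1 f3.2
  have hp0 : p = 0 := by rw [hps, f6]; simp
  have hv0 : v = 0 := Complex.ext f4 f5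
  exact hz (by rw [hp0, hv0]; rfl)

lemma eq_zero_of_forall_re_eq_zero {w p q : ℂ} (hw : ‖w‖ = 1) (h4 : w ^ 4 ≠ 1) (h6 : w ^ 6 ≠ 1)
    (h : ∀ j : ℕ, j < 4 → (w ^ j * p + (w ^ j) ^ 3 * q).re = 0) : p = 0 ∧ q = 0 := by
  have hw0 : w ≠ 0 := by rintro rfl; simp at hw
  have hconj : (starRingEnd ℂ) w = w⁻¹ := by
    rw [Complex.inv_def, Complex.normSq_eq_norm_sq, hw]; simp
  have h2 : w ^ 2 ≠ 1 := fun h => h4 (by rw [show 4 = 2 * 2 from rfl, pow_mul, h, one_pow])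
  let f : Fin 4 → ℂ := ![w, w⁻¹, w ^ 3, (w⁻¹) ^ 3]
  have hf : Function.Injective f := by
    have n1 : w ≠ w⁻¹ := fun h => h2 (by field_simp at h; exact h)
    have n2 : w ≠ w ^ 3 := fun h => h2 (mul_left_cancel₀ hw0 (by rw [mul_one]; linear_combination -h))
    have n3 : w ≠ (w⁻¹) ^ 3 := fun h => h4 (by field_simp at h; linear_combination h)
    have n4 : w⁻¹ ≠ w ^ 3 := fun h => h4 (by field_simp at h; linear_combination -h)
    have n5 : w⁻¹ ≠ (w⁻¹) ^ 3 := fun h => h2 (by field_simp at h; linear_combination h)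
    have n6 : w ^ 3 ≠ (w⁻¹) ^ 3 := fun h => h6 (by field_simp at h; linear_combination h)
    intro i j hij
    fin_cases i <;> fin_cases j <;> first | rfl | (exfalso; simp only [f] at hij; first
      | exact n1 hij | exact n2 hij | exact n3 hij | exact n4 hij | exact n5 hij | exact n6 hij
      | exact n1 hij.symm | exact n2 hij.symm | exact n3 hij.symm | exact n4 hij.symm
      | exact n5 hij.symm | exact n6 hij.symm)
  have key := Matrix.eq_zero_of_forall_pow_sum_mul_pow_eq_zero
    (v := ![p, (starRingEnd ℂ) p, q, (starRingEnd ℂ) q]) hf (fun i => ?_)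
  · exact ⟨congrFun key 0, congrFun key 2⟩
  · have h0 := h i i.2
    have h1 := Complex.add_conj (w ^ (i : ℕ) * p + (w ^ (i : ℕ)) ^ 3 * q)
    rw [h0] at h1
    simp only [map_add, map_mul, map_pow, hconj] at h1
    simp only [Fin.sum_univ_four, f, Matrix.cons_val]
    rw [← pow_mul w 3, ← pow_mul w⁻¹ 3, mul_comm 3, pow_mul, pow_mul]
    rw [mul_zero, Complex.ofReal_zero] at h1
    linear_combination h1

/-- Two antipodal pairs whose difference has order other than four and six. -/
lemma separable_of_rectangle {n : ℕ} [NeZero n] {S : Finset (ZMod n)} {x u h : ZMod n}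
    (hu4 : (ZMod.stdAddChar u : ℂ) ^ 4 ≠ 1) (hu6 : (ZMod.stdAddChar u : ℂ) ^ 6 ≠ 1)
    (hh : (ZMod.stdAddChar h : ℂ) = -1) (h0 : x + 0 ∈ S) (h1 : x + u ∈ S) (h2 : x + h ∈ S)
    (h3 : x + (u + h) ∈ S) : Separable n S := by
  have hw1 := norm_stdAddChar u
  set w : ℂ := ZMod.stdAddChar u with hw
  let o : ℂ × ℂ → ℝ := fun z => (z.1 + z.2 ^ 3).re
  let t : ℕ → ℂ × ℂ → ℝ := fun j z => 1 - min 1 |o (w ^ j • z)|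
  let e : ℂ × ℂ → ℝ := fun z => t 0 z * t 1 z + t 0 z * t 1 z * t 2 z
  have hoc : Continuous o := by fun_prop
  have htc : ∀ j, Continuous (t j) := fun j => by
    have : Continuous fun z : ℂ × ℂ => o (w ^ j • z) := hoc.comp (continuous_const_smul _)
    fun_prop
  have hec : Continuous e := by fun_prop
  have hodd : ∀ z, o ((-1 : ℂ) • z) = - o z := fun z => by
    simp only [o, Prod.smul_fst, Prod.smul_snd, smul_eq_mul, neg_one_mul,
      Odd.neg_pow (by decide : Odd 3), Complex.add_re, Complex.neg_re]
    ring
  have hteven : ∀ j z, t j ((-1 : ℂ) • z) = t j z := fun j z => by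
    simp only [t]
    rw [smul_comm, hodd, abs_neg]
  have heven : ∀ z, e ((-1 : ℂ) • z) = e z := fun z => by simp only [e, hteven]
  have ht1 : ∀ j z, o (w ^ j • z) = 0 → t j z = 1 := fun j z h => by simp [t, h]
  have ht0 : ∀ j z, 0 ≤ t j z := fun j z => sub_nonneg.2 (min_le_left _ _)
  have htle : ∀ j z, t j z ≤ 1 := fun j z =>
    sub_le_self _ (le_min zero_le_one (abs_nonneg _))
  have hto : ∀ j z, t j z = 1 → o (w ^ j • z) = 0 := fun j z h => by
    have h' : min 1 |o (w ^ j • z)| = 0 := by simp only [t] at h; linarith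
    rcases min_choice 1 |o (w ^ j • z)| with h'' | h'' <;> rw [h''] at h'
    · exact absurd h' one_ne_zero
    · exact abs_eq_zero.1 h'
  have hshift : ∀ j z, t j (w • z) = t (j + 1) z := fun j z => by
    simp only [t]
    rw [smul_smul, ← pow_succ]
  refine Separable.of_base x (g := fun z => o z + e z) (hoc.add hec) fun z hz hcon => ?_
  have a1 := hcon _ _ h0 h2
  have a2 := hcon _ _ h1 h3
  have a3 := hcon _ _ h0 h1
  simp only [AddChar.map_zero_eq_one, one_smul, AddChar.map_add_eq_mul, hh, ← hw] at a1 a2 a3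
  rw [mul_comm, mul_smul] at a2
  rw [hodd, heven] at a1 a2
  have o0 : o z = 0 := by linarith
  have o1 : o (w • z) = 0 := by linarith
  have he : e z = e (w • z) := by linarith
  simp only [e, hshift, zero_add] at he
  rw [ht1 0 z (by simpa using o0), ht1 1 z (by simpa using o1)] at he
  norm_num at he
  have hprod : t 2 z * t 3 z = 1 := by linarith
  have b2 := htle 2 z
  have b3 := htle 3 z
  have c2 := ht0 2 z
  have c3 := ht0 3 z
  have t2 : t 2 z = 1 := by nlinarith
  have t3 : t 3 z = 1 := by nlinarith
  have o2 := hto 2 z t2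
  have o3 := hto 3 z t3
  obtain ⟨p, q⟩ := z
  have := eq_zero_of_forall_re_eq_zero (p := p) (q := q ^ 3) hw1 hu4 hu6 (fun j hj => by
    have hj' : o (w ^ j • (p, q)) = 0 := by
      interval_cases j
      · simpa using o0
      · simpa using o1
      · exact o2
      · exact o3
    simp only [o, Prod.smul_fst, Prod.smul_snd, smul_eq_mul, mul_pow] at hj'
    exact hj')
  exact hz (by rw [this.1, (pow_eq_zero_iff three_ne_zero).1 this.2]; rfl)

lemma spread_eq_zero {ι : Type*} {y : ι → ℝ} {T : Finset ι} (h : ∀ s ∈ T, ∀ t ∈ T, y s = y t) :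
    spread y T = 0 :=
  Finset.sum_eq_zero fun s hs => Finset.sum_eq_zero fun t ht => by rw [h s hs t ht]; simp

lemma eq_of_spread_eq_zero {ι : Type*} {y : ι → ℝ} {T : Finset ι} (h : spread y T = 0) :
    ∀ s ∈ T, ∀ t ∈ T, y s = y t := fun _ hs _ ht =>
  sub_eq_zero.1 (abs_nonpos_iff.1 (h ▸ abs_sub_le_spread y hs ht))

lemma spread_add_left {G : Type*} [AddCommGroup G] {y : G → ℝ} {T : Finset G} {d : G}
    (h : ∀ s ∈ T, d + s ∈ T) : spread (fun s => y (d + s)) T = spread y T := by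
  classical
  have himg : T.image (fun s => d + s) = T :=
    Finset.eq_of_subset_of_card_le (fun a ha => by
      obtain ⟨s, hs, rfl⟩ := Finset.mem_image.1 ha
      exact h s hs) (by rw [Finset.card_image_of_injective _ (add_right_injective d)])
  have key : ∀ f : G → ℝ, ∑ s ∈ T, f (d + s) = ∑ s ∈ T, f s := fun f => by
    conv_rhs => rw [← himg]
    rw [Finset.sum_image fun a _ b _ hab => add_right_injective d hab]
  unfold spread
  rw [← key fun s => ∑ t ∈ T, |y s - y t|]
  exact Finset.sum_congr rfl fun s _ => key fun t => |y (d + s) - y t|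

/-- The values of `g` along the orbit of `z`. -/
def orbitVal {n : ℕ} [NeZero n] (g : ℂ × ℂ → ℝ) (z : ℂ × ℂ) (s : ZMod n) : ℝ :=
  g ((ZMod.stdAddChar s : ℂ) • z)

lemma continuous_orbitVal {n : ℕ} [NeZero n] {g : ℂ × ℂ → ℝ} (hg : Continuous g) (s : ZMod n) :
    Continuous fun z => orbitVal g z s := hg.comp (continuous_const_smul _)

lemma orbitVal_smul {n : ℕ} [NeZero n] (g : ℂ × ℂ → ℝ) (z : ℂ × ℂ) (s t : ZMod n) :
    orbitVal g ((ZMod.stdAddChar t : ℂ) • z) s = orbitVal g z (s + t) := by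
  unfold orbitVal
  rw [stdAddChar_smul_smul]

lemma continuous_spread {ι X : Type*} [TopologicalSpace X] {y : ι → X → ℝ}
    (hy : ∀ i, Continuous (y i)) (T : Finset ι) : Continuous fun x => spread (fun i => y i x) T :=
  continuous_finsetSum _ fun s _ => continuous_finsetSum _ fun t _ =>
    ((hy s).sub (hy t)).abs

/-- Adding a tall bump where `g` is nearly constant on `S \ {x}` separates `S`, unless `g` has
many coincidences on some orbit. -/
lemma Separable.push {n : ℕ} [NeZero n] {S : Finset (ZMod n)} {x : ZMod n} (hx : x ∈ S)
    (hne : (S.erase x).Nonempty) {g : ℂ × ℂ → ℝ} (hg : Continuous g)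
    (h : ∀ z ∈ sphereC2, ∀ U ⊆ S, (∃ i ∈ U, i ≠ x) →
      (∀ j ∈ U, ∀ s ∈ S.erase x, ∀ t ∈ S.erase x,
        orbitVal g z (j - x + s) = orbitVal g z (j - x + t)) →
      (∀ s ∈ S \ U, ∀ t ∈ S \ U, orbitVal g z s = orbitVal g z t) →
      ¬ ∀ j ∈ S, ∀ k ∈ S, (∀ s ∈ S.erase x, j - k + s ∈ S.erase x) →
        orbitVal g z j = orbitVal g z k) : Separable n S := by
  classical
  set T := S.erase x with hT
  let ρ : ZMod n → ℂ × ℂ → ℝ := fun j z => spread (fun s => orbitVal g z (j - x + s)) T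
  have hρc : ∀ j, Continuous (ρ j) := fun j =>
    continuous_spread (fun s => continuous_orbitVal hg _) T
  let P : Finset (ZMod n × ZMod n) := (S ×ˢ S).filter fun q => ∀ s ∈ T, q.1 - q.2 + s ∈ T
  let E : Finset (ZMod n) → ℂ × ℂ → ℝ := fun U z => ∑ j ∈ U, ρ j z
    + spread (orbitVal g z) (S \ U) + ∑ q ∈ P, |orbitVal g z q.1 - orbitVal g z q.2|
  have hEc : ∀ U, Continuous (E U) := fun U =>
    ((continuous_finsetSum _ fun j _ => hρc j).add
      (continuous_spread (fun s => continuous_orbitVal hg s) _)).add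
      (continuous_finsetSum _ fun q _ => ((continuous_orbitVal hg _).sub
        (continuous_orbitVal hg _)).abs)
  let 𝒰 := S.powerset.filter fun U => ∃ i ∈ U, i ≠ x
  obtain ⟨ε, hε, hE⟩ := exists_pos_le_of_isCompact isCompact_sphereC2 𝒰 E
    (fun U _ => (hEc U).continuousOn) (fun U hU z hz => by
      obtain ⟨hUS, hi⟩ := Finset.mem_filter.1 hU
      have p1 : 0 ≤ ∑ j ∈ U, ρ j z := Finset.sum_nonneg fun j _ => spread_nonneg _ _
      have p2 : 0 ≤ spread (orbitVal g z) (S \ U) := spread_nonneg _ _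
      have p3 : 0 ≤ ∑ q ∈ P, |orbitVal g z q.1 - orbitVal g z q.2| :=
        Finset.sum_nonneg fun _ _ => abs_nonneg _
      by_contra! hle
      have hle' : ∑ j ∈ U, ρ j z + spread (orbitVal g z) (S \ U)
        + ∑ q ∈ P, |orbitVal g z q.1 - orbitVal g z q.2| ≤ 0 := hle
      have e1 : ∑ j ∈ U, ρ j z = 0 := by linarith
      have e2 : spread (orbitVal g z) (S \ U) = 0 := by linarith
      have e3 : ∑ q ∈ P, |orbitVal g z q.1 - orbitVal g z q.2| = 0 := by linarith
      rw [Finset.sum_eq_zero_iff_of_nonneg fun j _ => spread_nonneg _ _] at e1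
      rw [Finset.sum_eq_zero_iff_of_nonneg fun j _ => abs_nonneg _] at e3
      refine h z hz U (Finset.mem_powerset.1 hUS) hi (fun j hj => eq_of_spread_eq_zero (e1 j hj))
        (eq_of_spread_eq_zero e2) fun j hj k hk hjk => ?_
      exact sub_eq_zero.1 (abs_eq_zero.1 (e3 (j, k) (Finset.mem_filter.2
        ⟨Finset.mem_product.2 ⟨hj, hk⟩, hjk⟩))))
  obtain ⟨M, hM⟩ := isCompact_sphereC2.exists_bound_of_continuousOn hg.continuousOn
  set K : ℝ := (S.card + 1) / ε with hK
  have hKpos : 0 < K := by positivity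
  let r : ℂ × ℂ → ℝ := fun z => (2 * M + 1) * max 0 (1 - K * ρ 0 z)
  have hrc : Continuous r := continuous_const.mul
    (continuous_const.max (continuous_const.sub (continuous_const.mul (hρc 0))))
  have hr : ∀ j z, r ((ZMod.stdAddChar j : ℂ) • z) = (2 * M + 1) * max 0 (1 - K * ρ j z) := by
    intro j z
    have : ρ 0 ((ZMod.stdAddChar j : ℂ) • z) = ρ j z := by
      simp only [ρ, orbitVal_smul]
      congr 1
      funext s
      congr 1
      ring
    simp only [r, this]
  refine ⟨fun z => g z + r z, (hg.add hrc).continuousOn, fun z hz => ?_⟩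
  by_contra! hcon
  have hval : ∀ s ∈ S, ∀ t ∈ S, orbitVal g z s + (2 * M + 1) * max 0 (1 - K * ρ s z)
      = orbitVal g z t + (2 * M + 1) * max 0 (1 - K * ρ t z) := by
    intro s hs t ht
    have := hcon s hs t ht
    rwa [hr, hr] at this
  set U := S.filter fun j => K * ρ j z < 1 with hU
  have hout : ∀ j, ¬ K * ρ j z < 1 → (2 * M + 1) * max 0 (1 - K * ρ j z) = 0 := fun j hj => by
    rw [max_eq_left (by linarith), mul_zero]
  have hi : ∃ i ∈ U, i ≠ x := by
    by_contra! hno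
    have hyT : ∀ s ∈ T, ∀ t ∈ T, orbitVal g z s = orbitVal g z t := by
      have : ∀ s ∈ T, ¬ K * ρ s z < 1 := fun s hs hlt =>
        Finset.ne_of_mem_erase hs (hno s (Finset.mem_filter.2 ⟨Finset.mem_of_mem_erase hs, hlt⟩))
      intro s hs t ht
      have := hval s (Finset.mem_of_mem_erase hs) t (Finset.mem_of_mem_erase ht)
      rwa [hout s (by apply_assumption; exact hs), hout t (by apply_assumption; exact ht),
        add_zero, add_zero] at this
    have hρx : ρ x z = 0 := spread_eq_zero fun s hs t ht => by
      rw [sub_self, zero_add, zero_add]; exact hyT s hs t ht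
    obtain ⟨t, ht⟩ := hne
    have htx : ¬ K * ρ t z < 1 := fun hlt =>
        Finset.ne_of_mem_erase ht (hno t (Finset.mem_filter.2 ⟨Finset.mem_of_mem_erase ht, hlt⟩))
    have := hval x hx t (Finset.mem_of_mem_erase ht)
    rw [hout t htx, hρx, mul_zero, sub_zero, max_eq_right zero_le_one, mul_one, add_zero] at this
    have b1 := abs_le.1 (hM _ (stdAddChar_smul_mem x hz))
    have b2 := abs_le.1 (hM _ (stdAddChar_smul_mem t hz))
    simp only [orbitVal] at this
    linarith [b1.1, b2.2]
  have hUmem : U ∈ 𝒰 := Finset.mem_filter.2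
    ⟨Finset.mem_powerset.2 (Finset.filter_subset _ _), hi⟩
  have hlow := hE U hUmem z hz
  have q1 : ∑ j ∈ U, ρ j z ≤ S.card * (1 / K) := by
    calc ∑ j ∈ U, ρ j z ≤ ∑ j ∈ U, 1 / K := Finset.sum_le_sum fun j hj => by
          rw [le_div_iff₀ hKpos, mul_comm]; exact (Finset.mem_filter.1 hj).2.le
      _ = U.card * (1 / K) := by rw [Finset.sum_const, nsmul_eq_mul]
      _ ≤ S.card * (1 / K) := by
          gcongr
          exact Finset.filter_subset _ _
  have q2 : spread (orbitVal g z) (S \ U) = 0 := spread_eq_zero fun s hs t ht => by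
    have out : ∀ s ∈ S \ U, s ∈ S ∧ ¬ K * ρ s z < 1 := fun s hs => by
      obtain ⟨a, b⟩ := Finset.mem_sdiff.1 hs
      exact ⟨a, fun hlt => b (Finset.mem_filter.2 ⟨a, hlt⟩)⟩
    have := hval s (out s hs).1 t (out t ht).1
    rwa [hout s (out s hs).2, hout t (out t ht).2, add_zero, add_zero] at this
  have q3 : ∑ q ∈ P, |orbitVal g z q.1 - orbitVal g z q.2| = 0 := by
    refine Finset.sum_eq_zero fun q hq => ?_
    obtain ⟨hq1, hq2⟩ := Finset.mem_filter.1 hq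
    obtain ⟨ha, hb⟩ := Finset.mem_product.1 hq1
    have hρ : ρ q.1 z = ρ q.2 z := by
      simp only [ρ]
      rw [← spread_add_left (y := fun s => orbitVal g z (q.2 - x + s)) hq2]
      congr 1
      funext s
      congr 1
      ring
    have := hval _ ha _ hb
    rw [hρ] at this
    rw [add_right_cancel this, sub_self, abs_zero]
  have hE' : E U z ≤ S.card * (1 / K) := by
    show ∑ j ∈ U, ρ j z + spread (orbitVal g z) (S \ U)
      + ∑ q ∈ P, |orbitVal g z q.1 - orbitVal g z q.2| ≤ _
    rw [q2, q3]; linarith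
  have : (S.card : ℝ) * (1 / K) < ε := by
    rw [hK, one_div_div, ← mul_div_assoc, div_lt_iff₀ (by positivity)]
    nlinarith
  linarith

/-- Two triples sharing at least two entries. -/
def TwoMatch {G : Type*} (s₁ s₂ s₃ t₁ t₂ t₃ : G) : Prop :=
  (s₁ = t₁ ∧ (s₂ = t₂ ∨ s₂ = t₃ ∨ s₃ = t₂ ∨ s₃ = t₃)) ∨
    (s₁ = t₂ ∧ (s₂ = t₁ ∨ s₂ = t₃ ∨ s₃ = t₁ ∨ s₃ = t₃)) ∨
    (s₁ = t₃ ∧ (s₂ = t₁ ∨ s₂ = t₂ ∨ s₃ = t₁ ∨ s₃ = t₂)) ∨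
    (s₂ = t₁ ∧ (s₃ = t₂ ∨ s₃ = t₃)) ∨ (s₂ = t₂ ∧ (s₃ = t₁ ∨ s₃ = t₃)) ∨
    (s₂ = t₃ ∧ (s₃ = t₁ ∨ s₃ = t₂))

lemma IsGeneric.not_four {n : ℕ} [NeZero n] {g : ℂ × ℂ → ℝ} (hg : IsGeneric n g) {z : ℂ × ℂ}
    (hz : z ≠ 0) {b₁ b₂ e₁ e₂ e₃ e₄ : ZMod n} (he : [e₁, e₂, e₃, e₄].Nodup)
    (h₁ : b₁ ∉ [e₁, e₂, e₃, e₄]) (h₂ : b₂ ∉ [e₁, e₂, e₃, e₄])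
    (y₁ : orbitVal g z e₁ = orbitVal g z b₁) (y₂ : orbitVal g z e₂ = orbitVal g z b₁)
    (y₃ : orbitVal g z e₃ = orbitVal g z b₂) (y₄ : orbitVal g z e₄ = orbitVal g z b₂) : False := by
  obtain ⟨k, hk⟩ := hg z hz ![e₁, e₂, e₃, e₄] ![b₁, b₁, b₂, b₂] (by
    simp only [List.nodup_cons, List.mem_cons, List.not_mem_nil] at he
    intro i j hij
    fin_cases i <;> fin_cases j <;> simp at hij <;> grind) (by
    simp only [List.mem_cons, List.not_mem_nil] at h₁ h₂
    intro i j hij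
    fin_cases i <;> fin_cases j <;> simp at hij <;> grind)
  fin_cases k
  · exact hk y₁
  · exact hk y₂
  · exact hk y₃
  · exact hk y₄

set_option maxHeartbeats 2000000 in
lemma IsGeneric.twoMatch {n : ℕ} [NeZero n] {g : ℂ × ℂ → ℝ} (hg : IsGeneric n g) {z : ℂ × ℂ}
    (hz : z ≠ 0) {s₁ s₂ s₃ t₁ t₂ t₃ : ZMod n} (hs : [s₁, s₂, s₃].Nodup) (ht : [t₁, t₂, t₃].Nodup)
    (a₂ : orbitVal g z s₁ = orbitVal g z s₂) (a₃ : orbitVal g z s₁ = orbitVal g z s₃)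
    (b₂ : orbitVal g z t₁ = orbitVal g z t₂) (b₃ : orbitVal g z t₁ = orbitVal g z t₃) :
    TwoMatch s₁ s₂ s₃ t₁ t₂ t₃ := by
  have key : ∀ s₁ s₂ s₃ t₁ t₂ t₃ : ZMod n, s₁ ≠ s₂ → s₁ ≠ s₃ → s₂ ≠ s₃ → t₁ ≠ t₂ → t₁ ≠ t₃ →
      t₂ ≠ t₃ → s₂ ≠ t₁ → s₂ ≠ t₂ → s₂ ≠ t₃ → s₃ ≠ t₁ → s₃ ≠ t₂ → s₃ ≠ t₃ → s₁ ≠ t₂ → s₁ ≠ t₃ →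
      orbitVal g z s₁ = orbitVal g z s₂ → orbitVal g z s₁ = orbitVal g z s₃ →
      orbitVal g z t₁ = orbitVal g z t₂ → orbitVal g z t₁ = orbitVal g z t₃ → False := by
    intro s₁ s₂ s₃ t₁ t₂ t₃ _ _ _ _ _ _ _ _ _ _ _ _ _ _ c₂ c₃ d₂ d₃
    refine hg.not_four hz (b₁ := s₁) (b₂ := t₁) (e₁ := s₂) (e₂ := s₃) (e₃ := t₂) (e₄ := t₃)
      ?_ ?_ ?_ c₂.symm c₃.symm d₂.symm d₃.symm
    all_goals
      simp only [List.nodup_cons, List.mem_cons, List.not_mem_nil]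
      grind
  simp only [List.nodup_cons, List.mem_cons, List.not_mem_nil, or_false, not_or] at hs ht
  obtain ⟨⟨s12, s13⟩, s23, -⟩ := hs
  obtain ⟨⟨t12, t13⟩, t23, -⟩ := ht
  unfold TwoMatch
  by_contra hno
  simp only [not_or, not_and] at hno
  obtain ⟨n11, n12, n13, n21, n22, n23⟩ := hno
  have a23 := a₂.symm.trans a₃
  have b23 := b₂.symm.trans b₃
  by_cases e11 : s₁ = t₁
  · apply key s₁ s₂ s₃ t₁ t₂ t₃ <;> grind
  by_cases e12 : s₁ = t₂
  · apply key s₁ s₂ s₃ t₂ t₁ t₃ <;> grind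
  by_cases e13 : s₁ = t₃
  · apply key s₁ s₂ s₃ t₃ t₁ t₂ <;> grind
  by_cases e21 : s₂ = t₁
  · apply key s₂ s₁ s₃ t₁ t₂ t₃ <;> grind
  by_cases e22 : s₂ = t₂
  · apply key s₂ s₁ s₃ t₂ t₁ t₃ <;> grind
  by_cases e23 : s₂ = t₃
  · apply key s₂ s₁ s₃ t₃ t₁ t₂ <;> grind
  by_cases e31 : s₃ = t₁
  · apply key s₃ s₁ s₂ t₁ t₂ t₃ <;> grind
  by_cases e32 : s₃ = t₂
  · apply key s₃ s₁ s₂ t₂ t₁ t₃ <;> grind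
  by_cases e33 : s₃ = t₃
  · apply key s₃ s₁ s₂ t₃ t₁ t₂ <;> grind
  apply key s₁ s₂ s₃ t₁ t₂ t₃ <;> grind

/-- No four-term arithmetic progression, no coset of the subgroup of order three and no
antipodal pair of antipodal pairs in a set. -/
structure Irregular {G : Type*} [AddCommGroup G] (S : Finset G) : Prop where
  progression : ∀ p ∈ S, ∀ q ∈ S, ∀ r ∈ S, ∀ s ∈ S, [p, q, r, s].Nodup →
    ¬ (q + q = p + r ∧ r + r = q + s)
  coset : ∀ p ∈ S, ∀ q ∈ S, ∀ r ∈ S, [p, q, r].Nodup → ¬ (q + q = p + r ∧ r + r = p + q)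
  rectangle : ∀ p ∈ S, ∀ q ∈ S, ∀ r ∈ S, ∀ s ∈ S, [p, q, r, s].Nodup →
    ¬ (p + p = q + q ∧ p + r = q + s)

lemma nodup_four {G : Type*} {p q r s : G} : [p, q, r, s].Nodup ↔
    p ≠ q ∧ p ≠ r ∧ p ≠ s ∧ q ≠ r ∧ q ≠ s ∧ r ≠ s := by
  simp; tauto

lemma nodup_three {G : Type*} {p q r : G} : [p, q, r].Nodup ↔ p ≠ q ∧ p ≠ r ∧ q ≠ r := by
  simp; tauto

lemma Irregular.instances {G : Type*} [AddCommGroup G] {S : Finset G} (hS : Irregular S)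
    {a b c x : G} (ha : a ∈ S) (hb : b ∈ S) (hc : c ∈ S) (hx : x ∈ S) (h : [a, b, c, x].Nodup) :
    ¬ (b + b = a + c ∧ c + c = b + x) ∧ ¬ (b + b = a + c ∧ c + c = a + b) ∧
      ¬ (a + a = b + b ∧ a + c = b + x) := by
  have h' := nodup_four.1 h
  exact ⟨hS.progression a ha b hb c hc x hx h,
    hS.coset a ha b hb c hc (nodup_three.2 ⟨h'.1, h'.2.1, h'.2.2.2.1⟩),
    hS.rectangle a ha b hb c hc x hx h⟩

lemma Irregular.not_twoMatch_base {n : ℕ} {S : Finset (ZMod n)} (hS : Irregular S)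
    {a b c x : ZMod n} (ha : a ∈ S) (hb : b ∈ S) (hc : c ∈ S) (hx : x ∈ S)
    (h : [a, b, c, x].Nodup) :
    ¬ TwoMatch a b c (a - x + a) (a - x + b) (a - x + c) := by
  have h' := nodup_four.1 h
  have h1 := hS.instances hx ha hb hc (by rw [nodup_four]; grind)
  have h2 := hS.instances hx ha hc hb (by rw [nodup_four]; grind)
  unfold TwoMatch
  grind

lemma Irregular.not_twoMatch_compl {n : ℕ} {S : Finset (ZMod n)} (hS : Irregular S)
    {a b c x : ZMod n} (ha : a ∈ S) (hb : b ∈ S) (hc : c ∈ S) (hx : x ∈ S)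
    (h : [a, b, c, x].Nodup) :
    ¬ TwoMatch b c x (a - x + a) (a - x + b) (a - x + c) := by
  have h' := nodup_four.1 h
  have h1 := hS.instances hx ha hb hc (by rw [nodup_four]; grind)
  have h2 := hS.instances hx ha hc hb (by rw [nodup_four]; grind)
  have h3 := hS.instances hb hx ha hc (by rw [nodup_four]; grind)
  have h4 := hS.instances hc hx ha hb (by rw [nodup_four]; grind)
  have h5 := hS.instances ha hx hb hc (by rw [nodup_four]; grind)
  have h6 := hS.instances ha hx hc hb (by rw [nodup_four]; grind)
  clear h
  unfold TwoMatch
  grind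

lemma TwoMatch.pair {n : ℕ} {a b c x : ZMod n} (h : [a, b, c, x].Nodup)
    (hm : TwoMatch (a - x + a) (a - x + b) (a - x + c) (b - x + a) (b - x + b) (b - x + c)) :
    a + a = b + b ∨ a + a = b + c ∨ b + b = a + c := by
  have h' := nodup_four.1 h
  unfold TwoMatch at hm
  grind

lemma exists_third {G : Type*} {S : Finset G} (hS : S.card = 4) (i j x : G) :
    ∃ k ∈ S, k ≠ i ∧ k ≠ j ∧ k ≠ x := by
  classical
  have hc : ({i, j, x} : Finset G).card < S.card := by
    have := Finset.card_le_three (a := i) (b := j) (c := x)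
    omega
  obtain ⟨k, hk, hk'⟩ := Finset.exists_mem_notMem_of_card_lt_card hc
  simp only [Finset.mem_insert, Finset.mem_singleton, not_or] at hk'
  exact ⟨k, hk, hk'⟩

lemma mem_iff_of_card_four {G : Type*} {S : Finset G} (hS : S.card = 4) {a b c x : G}
    (ha : a ∈ S) (hb : b ∈ S) (hc : c ∈ S) (hx : x ∈ S) (h : [a, b, c, x].Nodup) (s : G) :
    s ∈ S ↔ s = a ∨ s = b ∨ s = c ∨ s = x := by
  classical
  have h' := nodup_four.1 h
  have hsub : ({a, b, c, x} : Finset G) ⊆ S := by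
    intro t ht
    simp only [Finset.mem_insert, Finset.mem_singleton] at ht
    rcases ht with rfl | rfl | rfl | rfl <;> assumption
  have hcard : ({a, b, c, x} : Finset G).card = 4 := by
    simp [Finset.card_insert_of_notMem, h'.1, h'.2.1, h'.2.2.1, h'.2.2.2.1, h'.2.2.2.2.1,
      h'.2.2.2.2.2]
  have := Finset.eq_of_subset_of_card_le hsub (by omega)
  rw [← this]
  simp

/-- If the elements of `S \ {x}` are related neither by antipodes nor by midpoints, a generic
function can be pushed to separate `S`. It suffices to exclude two coincidences. -/
lemma Irregular.separable_of_pair {n : ℕ} [NeZero n] {S : Finset (ZMod n)} (hS : Irregular S)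
    (hcard : S.card = 4) {x : ZMod n} (hx : x ∈ S)
    (h : ∀ g, IsGeneric n g → ∀ z ∈ sphereC2, ∀ U ⊆ S, x ∉ U →
      (∀ j ∈ U, ∀ s ∈ S.erase x, ∀ t ∈ S.erase x,
        orbitVal g z (j - x + s) = orbitVal g z (j - x + t)) →
      (∀ s ∈ S \ U, ∀ t ∈ S \ U, orbitVal g z s = orbitVal g z t) →
      ∀ i ∈ U, ∀ j ∈ U, i ≠ j → False) : Separable n S := by
  obtain ⟨g, hgc, hg⟩ := exists_isGeneric n
  have hne : (S.erase x).Nonempty := by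
    rw [← Finset.card_pos, Finset.card_erase_of_mem hx]
    omega
  refine Separable.push hx hne hgc ?_
  rintro z hz U hU ⟨i, hi, hix⟩ hc hd -
  have hz0 := ne_zero_of_mem_sphereC2 hz
  obtain ⟨j, hj, hji, hjx, -⟩ := exists_third hcard i x x
  obtain ⟨k, hk, hki, hkj, hkx⟩ := exists_third hcard i j x
  have hnd : [i, j, k, x].Nodup := nodup_four.2
    ⟨hji.symm, hki.symm, hix, hkj.symm, hjx, hkx⟩
  have hiS := hU hi
  have ei : i ∈ S.erase x := Finset.mem_erase.2 ⟨hix, hiS⟩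
  have ej : j ∈ S.erase x := Finset.mem_erase.2 ⟨hjx, hj⟩
  have ek : k ∈ S.erase x := Finset.mem_erase.2 ⟨hkx, hk⟩
  have hTi : [i - x + i, i - x + j, i - x + k].Nodup := nodup_three.2
    ⟨by simpa using hji.symm, by simpa using hki.symm, by simpa using hkj.symm⟩
  by_cases hxU : x ∈ U
  · refine hS.not_twoMatch_base hiS hj hk hx hnd (hg.twoMatch hz0
      (nodup_three.2 ⟨hji.symm, hki.symm, hkj.symm⟩) hTi ?_ ?_
      (hc i hi _ ei _ ej) (hc i hi _ ei _ ek))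
    · simpa using hc x hxU _ ei _ ej
    · simpa using hc x hxU _ ei _ ek
  by_cases hjU : j ∈ U
  · exact h g hg z hz U hU hxU hc hd i hi j hjU hji.symm
  by_cases hkU : k ∈ U
  · exact h g hg z hz U hU hxU hc hd i hi k hkU hki.symm
  have dj : j ∈ S \ U := Finset.mem_sdiff.2 ⟨hj, hjU⟩
  have dk : k ∈ S \ U := Finset.mem_sdiff.2 ⟨hk, hkU⟩
  have dx : x ∈ S \ U := Finset.mem_sdiff.2 ⟨hx, hxU⟩
  exact hS.not_twoMatch_compl hiS hj hk hx hnd (hg.twoMatch hz0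
    (nodup_three.2 ⟨hkj.symm, hjx, hkx⟩) hTi (hd _ dj _ dk) (hd _ dj _ dx)
    (hc i hi _ ei _ ej) (hc i hi _ ei _ ek))

lemma IsGeneric.pair_relation {n : ℕ} [NeZero n] {g : ℂ × ℂ → ℝ} (hg : IsGeneric n g)
    {z : ℂ × ℂ} (hz : z ∈ sphereC2) {S U : Finset (ZMod n)} {x : ZMod n}
    (hc : ∀ j ∈ U, ∀ s ∈ S.erase x, ∀ t ∈ S.erase x,
      orbitVal g z (j - x + s) = orbitVal g z (j - x + t))
    {i j k : ZMod n} (hi : i ∈ U) (hj : j ∈ U) (hiS : i ∈ S) (hjS : j ∈ S) (hkS : k ∈ S)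
    (hnd : [i, j, k, x].Nodup) : i + i = j + j ∨ i + i = j + k ∨ j + j = i + k := by
  obtain ⟨hij, hik, hix, hjk, hjx, hkx⟩ := nodup_four.1 hnd
  have ei : i ∈ S.erase x := Finset.mem_erase.2 ⟨hix, hiS⟩
  have ej : j ∈ S.erase x := Finset.mem_erase.2 ⟨hjx, hjS⟩
  have ek : k ∈ S.erase x := Finset.mem_erase.2 ⟨hkx, hkS⟩
  refine TwoMatch.pair hnd (hg.twoMatch (ne_zero_of_mem_sphereC2 hz) ?_ ?_
    (hc i hi _ ei _ ej) (hc i hi _ ei _ ek) (hc j hj _ ei _ ej) (hc j hj _ ei _ ek))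
  all_goals exact nodup_three.2 ⟨by simpa using hij, by simpa using hik, by simpa using hjk⟩

lemma Irregular.separable_of_free {n : ℕ} [NeZero n] {S : Finset (ZMod n)} (hS : Irregular S)
    (hcard : S.card = 4) {x : ZMod n} (hx : x ∈ S)
    (hfree : ∀ i ∈ S, ∀ j ∈ S, ∀ k ∈ S, [i, j, k, x].Nodup → i + i ≠ j + j ∧ i + i ≠ j + k) :
    Separable n S := by
  refine hS.separable_of_pair hcard hx fun g hg z hz U hU hxU hc _ i hi j hj hij => ?_
  obtain ⟨k, hk, hki, hkj, hkx⟩ := exists_third hcard i j x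
  have hix : i ≠ x := fun e => hxU (e ▸ hi)
  have hjx : j ≠ x := fun e => hxU (e ▸ hj)
  have h1 := hfree i (hU hi) j (hU hj) k hk
    (nodup_four.2 ⟨hij, hki.symm, hix, hkj.symm, hjx, hkx⟩)
  have h2 := hfree j (hU hj) i (hU hi) k hk
    (nodup_four.2 ⟨hij.symm, hkj.symm, hjx, hki.symm, hix, hkx⟩)
  have h3 := hg.pair_relation hz hc hi hj (hU hi) (hU hj) hk
    (nodup_four.2 ⟨hij, hki.symm, hix, hkj.symm, hjx, hkx⟩)
  rcases h3 with h3 | h3 | h3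
  · exact h1.1 h3
  · exact h1.2 h3
  · exact h2.2 h3

lemma ZMod.eq_of_add_self {n : ℕ} [NeZero n] {u v : ZMod n} (hu : u + u = 0) (hv : v + v = 0)
    (hu0 : u ≠ 0) (hv0 : v ≠ 0) : u = v := by
  have key : ∀ w : ZMod n, w + w = 0 → w ≠ 0 → 2 * w.val = n := by
    intro w hw hw0
    have h1 : n ∣ 2 * w.val := by
      rw [← ZMod.natCast_eq_zero_iff]
      push_cast
      rw [ZMod.natCast_zmod_val]
      linear_combination hw
    have h2 := w.val_lt
    have h3 : w.val ≠ 0 := by rwa [Ne, ZMod.val_eq_zero]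
    obtain ⟨k, hk⟩ := h1
    have : k = 1 := by
      rcases Nat.lt_or_ge k 2 with h | h
      · interval_cases k <;> omega
      · nlinarith
    rw [hk, this, mul_one]
  apply ZMod.val_injective
  have h1 := key u hu hu0
  have h2 := key v hv hv0
  omega

/-- The case of an antipodal pair with a common midpoint of the other two elements. -/
lemma Irregular.separable_of_special {n : ℕ} [NeZero n] {S : Finset (ZMod n)} (hS : Irregular S)
    (hcard : S.card = 4) {a b c x : ZMod n} (ha : a ∈ S) (hb : b ∈ S) (hc : c ∈ S) (hx : x ∈ S)
    (hnd : [a, b, c, x].Nodup) (hax : a + a = x + x) (hbc : a + a = b + c) : Separable n S := by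
  obtain ⟨hab, hac, hax', hbc', hbx, hcx⟩ := nodup_four.1 hnd
  have hmem := mem_iff_of_card_four hcard ha hb hc hx hnd
  have key : ∀ b c : ZMod n, b ∈ S → c ∈ S → [a, b, c, x].Nodup → a + a = b + c →
      ¬ (b + b = c + a) ∧ ¬ (x + b = a + c) ∧ ¬ (b + b = x + c) := by
    intro b c hb hc hnd hbc
    obtain ⟨hab, hac, hax', hbc', hbx, hcx⟩ := nodup_four.1 hnd
    refine ⟨fun e => ?_, fun e => ?_, fun e => ?_⟩
    · exact hS.coset c hc b hb a ha (nodup_three.2 ⟨hbc'.symm, hac.symm, hab.symm⟩)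
        ⟨e, by rw [hbc, add_comm]⟩
    · exact hS.rectangle x hx a ha b hb c hc (nodup_four.2
        ⟨hax'.symm, hbx.symm, hcx.symm, hab, hac, hbc'⟩) ⟨hax.symm, e⟩
    · exact hS.coset c hc b hb x hx (nodup_three.2 ⟨hbc'.symm, hcx, hbx⟩)
        ⟨by rw [e, add_comm], by rw [← hax, hbc, add_comm]⟩
  have hnd' : [a, c, b, x].Nodup := nodup_four.2 ⟨hac, hab, hax', hbc'.symm, hcx, hbx⟩
  have hcb : a + a = c + b := by rw [hbc, add_comm]
  obtain ⟨k1, k2, k3⟩ := key b c hb hc hnd hbc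
  obtain ⟨l1, l2, l3⟩ := key c b hc hb hnd' hcb
  have hh0 : x - a ≠ 0 := sub_ne_zero.2 hax'.symm
  have hh : (x - a) + (x - a) = 0 := by linear_combination -hax
  have hbb : b + b ≠ c + c := by
    intro e
    have := ZMod.eq_of_add_self (u := b - c) (by linear_combination e) hh
      (sub_ne_zero.2 hbc') hh0
    exact l2 (by linear_combination -this)
  refine hS.separable_of_pair hcard hx fun g hg z hz U hU hxU hcon hd i hi j hj hij => ?_
  have hbcU : ¬ (b ∈ U ∧ c ∈ U) := by
    rintro ⟨hbU, hcU⟩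
    rcases hg.pair_relation hz hcon hbU hcU hb hc ha
      (nodup_four.2 ⟨hbc', hab.symm, hbx, hac.symm, hcx, hax'⟩) with e | e | e
    · exact hbb e
    · exact k1 e
    · exact l1 e
  have ea : a ∈ S.erase x := Finset.mem_erase.2 ⟨hax', ha⟩
  have main : ∀ b c : ZMod n, b ∈ S → c ∈ S → [a, b, c, x].Nodup → a + a = b + c →
      a ∈ U → b ∈ U → c ∉ U → False := by
    intro b c hb hc hnd hbc haU hbU hcU
    obtain ⟨k1, k2, k3⟩ := key b c hb hc hnd hbc
    obtain ⟨hab, hac, hax', hbc', hbx, hcx⟩ := nodup_four.1 hnd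
    have eb : b ∈ S.erase x := Finset.mem_erase.2 ⟨hbx, hb⟩
    have ec : c ∈ S.erase x := Finset.mem_erase.2 ⟨hcx, hc⟩
    have y1 := hcon a haU _ eb _ ea
    have y2 := hcon a haU _ ec _ ea
    have y3 := hcon b hbU _ eb _ ec
    have y4 := hd c (Finset.mem_sdiff.2 ⟨hc, hcU⟩) x (Finset.mem_sdiff.2 ⟨hx, hxU⟩)
    have q1 : a - x + a = x := by linear_combination hax
    have q2 : b - x + c = x := by linear_combination hax - hbc
    rw [q1] at y1 y2
    rw [q2] at y3
    refine hg.not_four (ne_zero_of_mem_sphereC2 hz) ?_ ?_ ?_ y1 y2 y3 y4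
    · rw [nodup_four]
      grind
    all_goals
      simp only [List.mem_cons, List.not_mem_nil]
      grind
  have hi' := (hmem i).1 (hU hi)
  have hj' := (hmem j).1 (hU hj)
  have m1 := main b c hb hc hnd hbc
  have m2 := main c b hc hb hnd' hcb
  grind

/-- An irregular set of four elements is separable. -/
lemma Irregular.separable {n : ℕ} [NeZero n] {S : Finset (ZMod n)} (hS : Irregular S)
    (hcard : S.card = 4) : Separable n S := by
  by_contra hsep
  have hbad : ∀ a ∈ S, ∀ b ∈ S, ∀ c ∈ S, ∀ x ∈ S, [a, b, c, x].Nodup →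
      a + a = b + b ∨ a + a = c + c ∨ b + b = c + c ∨ a + a = b + c ∨ b + b = a + c ∨
        c + c = a + b := by
    intro a ha b hb c hc x hx hnd
    by_contra hno
    refine hsep (hS.separable_of_free hcard hx fun i hi j hj k hk hijk => ?_)
    have hm := mem_iff_of_card_four hcard ha hb hc hx hnd
    have hi' := (hm i).1 hi
    have hj' := (hm j).1 hj
    have hk' := (hm k).1 hk
    rw [nodup_four] at hijk
    grind
  have hspec : ∀ a ∈ S, ∀ b ∈ S, ∀ c ∈ S, ∀ x ∈ S, [a, b, c, x].Nodup →
      a + a = x + x → a + a ≠ b + c := fun a ha b hb c hc x hx hnd e₁ e₂ =>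
    hsep (hS.separable_of_special hcard ha hb hc hx hnd e₁ e₂)
  have hanti : ∀ p ∈ S, ∀ q ∈ S, ∀ r ∈ S, ∀ s ∈ S, [p, q, r, s].Nodup → p + p ≠ q + q := by
    intro p hp q hq r hr s hs hnd e
    obtain ⟨hpq, hpr, hps, hqr, hqs, hrs⟩ := nodup_four.1 hnd
    have hp' := hbad q hq r hr s hs p hp (nodup_four.2
      ⟨hqr, hqs, hpq.symm, hrs, hpr.symm, hps.symm⟩)
    have hq' := hbad p hp r hr s hs q hq (nodup_four.2
      ⟨hpr, hps, hpq, hrs, hqr.symm, hqs.symm⟩)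
    have s1 := hspec p hp r hr s hs q hq (nodup_four.2
      ⟨hpr, hps, hpq, hrs, hqr.symm, hqs.symm⟩) e
    have h1 := hS.instances hp hq hr hs hnd
    have h2 := hS.instances hp hq hs hr (nodup_four.2 ⟨hpq, hps, hpr, hqs, hqr, hrs.symm⟩)
    have h3 := hS.instances hp hr hs hq (nodup_four.2
      ⟨hpr, hps, hpq, hrs, hqr.symm, hqs.symm⟩)
    have h4 := hS.instances hp hs hr hq (nodup_four.2
      ⟨hps, hpr, hpq, hrs.symm, hqs.symm, hqr.symm⟩)
    have u1 : ∀ t w : ZMod n, t + t = w + w → t ≠ w → p - q = t - w := fun t w e' htw =>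
      ZMod.eq_of_add_self (by linear_combination e) (by linear_combination e')
        (sub_ne_zero.2 hpq) (sub_ne_zero.2 htw)
    have u2 := u1 r s
    have u3 := u1 q r
    have u4 := u1 q s
    have u5 := u1 r p
    have u6 := u1 s p
    clear u1 hbad hspec hnd
    grind
  obtain ⟨x, hx⟩ : S.Nonempty := Finset.card_pos.1 (by omega)
  obtain ⟨i, hi, hix, -, -⟩ := exists_third hcard x x x
  obtain ⟨j, hj, hji, hjx, -⟩ := exists_third hcard i x x
  obtain ⟨k, hk, hki, hkj, hkx⟩ := exists_third hcard i j x
  have hmid : ∀ p ∈ S, ∀ q ∈ S, ∀ r ∈ S, ∀ s ∈ S, [p, q, r, s].Nodup → q + q ≠ p + r := by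
    intro p hp q hq r hr s hs hnd e
    obtain ⟨hpq, hpr, hps, hqr, hqs, hrs⟩ := nodup_four.1 hnd
    have hp' := hbad q hq r hr s hs p hp (nodup_four.2
      ⟨hqr, hqs, hpq.symm, hrs, hpr.symm, hps.symm⟩)
    have hr' := hbad p hp q hq s hs r hr (nodup_four.2
      ⟨hpq, hps, hpr, hqs, hqr, hrs.symm⟩)
    have a1 := hanti q hq r hr s hs p hp (nodup_four.2
      ⟨hqr, hqs, hpq.symm, hrs, hpr.symm, hps.symm⟩)
    have a2 := hanti q hq s hs r hr p hp (nodup_four.2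
      ⟨hqs, hqr, hpq.symm, hrs.symm, hps.symm, hpr.symm⟩)
    have a3 := hanti r hr s hs q hq p hp (nodup_four.2
      ⟨hrs, hqr.symm, hpr.symm, hqs.symm, hps.symm, hpq.symm⟩)
    have a4 := hanti p hp q hq r hr s hs hnd
    have a5 := hanti p hp s hs r hr q hq (nodup_four.2
      ⟨hps, hpr, hpq, hrs.symm, hqs.symm, hqr.symm⟩)
    have h1 := hS.instances hp hq hr hs hnd
    have h2 := hS.instances hs hp hq hr (nodup_four.2
      ⟨hps.symm, hqs.symm, hrs.symm, hpq, hpr, hqr⟩)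
    clear hbad hspec hanti hnd
    grind
  have hnd : [i, j, k, x].Nodup := nodup_four.2
    ⟨hji.symm, hki.symm, hix, hkj.symm, hjx, hkx⟩
  have hnd₁ : [j, i, k, x].Nodup := nodup_four.2
    ⟨hji, hkj.symm, hjx, hki.symm, hix, hkx⟩
  have hnd₂ : [i, k, j, x].Nodup := nodup_four.2
    ⟨hki.symm, hji.symm, hix, hkj, hkx, hjx⟩
  rcases hbad i hi j hj k hk x hx hnd with e | e | e | e | e | e
  · exact hanti i hi j hj k hk x hx hnd e
  · exact hanti i hi k hk j hj x hx hnd₂ e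
  · exact hanti j hj k hk i hi x hx
      (nodup_four.2 ⟨hkj.symm, hji, hjx, hki, hkx, hix⟩) e
  · exact hmid j hj i hi k hk x hx hnd₁ e
  · exact hmid i hi j hj k hk x hx hnd e
  · exact hmid i hi k hk j hj x hx hnd₂ e

lemma stdAddChar_pow_eq_one_iff {n : ℕ} [NeZero n] (k : ℕ) (m : ZMod n) :
    (ZMod.stdAddChar m : ℂ) ^ k = 1 ↔ k • m = 0 := by
  rw [← stdAddChar_nsmul]
  constructor
  · intro h
    exact ZMod.injective_stdAddChar (by rw [h, AddChar.map_zero_eq_one])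
  · intro h
    rw [h, AddChar.map_zero_eq_one]

lemma sq_eq_sub_one_of_cube {w : ℂ} (h : w ^ 3 = -1) (h1 : w ≠ -1) : w ^ 2 = w - 1 := by
  have : (w + 1) * (w ^ 2 - w + 1) = 0 := by linear_combination h
  rcases mul_eq_zero.1 this with h' | h'
  · exact absurd (eq_neg_of_add_eq_zero_left h') h1
  · linear_combination h'

lemma separable_of_coset {n : ℕ} [NeZero n] {S : Finset (ZMod n)} (hcard : S.card = 4)
    {p q r : ZMod n} (hp : p ∈ S) (hq : q ∈ S) (hr : r ∈ S) (hnd : [p, q, r].Nodup)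
    (e₁ : q + q = p + r) (e₂ : r + r = p + q) : Separable n S := by
  obtain ⟨hpq, hpr, hqr⟩ := nodup_three.1 hnd
  obtain ⟨x, hx, hxp, hxq, hxr⟩ := exists_third hcard p q r
  have hmem := mem_iff_of_card_four hcard hp hq hr hx (nodup_four.2
    ⟨hpq, hpr, hxp.symm, hqr, hxq.symm, hxr.symm⟩)
  have hT : ∀ s, s ∈ S.erase x ↔ s = p ∨ s = q ∨ s = r := by
    intro s
    rw [Finset.mem_erase, hmem]
    grind
  have hcl : ∀ j ∈ S.erase x, ∀ k ∈ S.erase x, ∀ s ∈ S.erase x, j - k + s ∈ S.erase x := by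
    intro j hj k hk s hs
    rw [hT] at *
    rcases hj with rfl | rfl | rfl <;> rcases hk with rfl | rfl | rfl <;>
      rcases hs with rfl | rfl | rfl <;> grind
  have ep : p ∈ S.erase x := (hT p).2 (by simp)
  have eq : q ∈ S.erase x := (hT q).2 (by simp)
  have er : r ∈ S.erase x := (hT r).2 (by simp)
  obtain ⟨g, hgc, hg⟩ := exists_isGeneric n
  refine Separable.push hx ⟨p, ep⟩ hgc ?_
  rintro z hz U hU ⟨i, hi, hix⟩ hc - hp'
  have ei : i ∈ S.erase x := Finset.mem_erase.2 ⟨hix, hU hi⟩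
  have hno : ∀ s ∈ S.erase x, ∀ t ∈ S.erase x, s ≠ i - x + t := by
    intro s hs t ht hst
    have : x = i - s + t := by linear_combination hst
    have hx' := hcl i ei s hs t ht
    rw [← this] at hx'
    exact Finset.notMem_erase x S hx'
  have hy : ∀ j ∈ S.erase x, ∀ k ∈ S.erase x, orbitVal g z j = orbitVal g z k :=
    fun j hj k hk => hp' j (Finset.mem_of_mem_erase hj) k (Finset.mem_of_mem_erase hk)
      (hcl j hj k hk)
  have hm := hg.twoMatch (ne_zero_of_mem_sphereC2 hz) hnd
    (t₁ := i - x + p) (t₂ := i - x + q) (t₃ := i - x + r)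
    (nodup_three.2 ⟨by simpa using hpq, by simpa using hpr, by simpa using hqr⟩)
    (hy p ep q eq) (hy p ep r er) (hc i hi p ep q eq) (hc i hi p ep r er)
  unfold TwoMatch at hm
  grind

lemma separable_or_of_progression {n : ℕ} [NeZero n] {S : Finset (ZMod n)} (hcard : S.card = 4)
    {p q r s : ZMod n} (hp : p ∈ S) (hq : q ∈ S) (hr : r ∈ S) (hs : s ∈ S)
    (hnd : [p, q, r, s].Nodup) (e₁ : q + q = p + r) (e₂ : r + r = q + s) :
    Separable n S ∨ (∀ s ∈ S, ∀ t ∈ S, 4 * (s - t) = 0) ∨ ∀ s ∈ S, ∀ t ∈ S, 5 * (s - t) = 0 := by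
  obtain ⟨hpq, hpr, hps, hqr, hqs, hrs⟩ := nodup_four.1 hnd
  have hmem := mem_iff_of_card_four hcard hp hq hr hs hnd
  obtain ⟨m, rfl⟩ : ∃ m, q = p + m := ⟨q - p, by ring⟩
  obtain rfl : r = p + 2 * m := by linear_combination -e₁
  obtain rfl : s = p + 3 * m := by linear_combination -e₂
  have hprog : ∀ i : ℕ, i < 4 → p + i • m ∈ S := by
    intro i hi
    rw [hmem]
    interval_cases i <;> simp
  have hk : ∀ k : ℕ, k • m = (k : ZMod n) * m := fun k => nsmul_eq_mul k m
  have n1 : m ≠ 0 := by grind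
  have n2 : 2 * m ≠ 0 := by grind
  have n3 : 3 * m ≠ 0 := by grind
  have ho : addOrderOf m • m = 0 := addOrderOf_nsmul_eq_zero m
  have hpos : 0 < addOrderOf m := addOrderOf_pos m
  rcases Nat.lt_or_ge (addOrderOf m) 7 with h7 | h7
  · generalize addOrderOf m = o at *
    rw [hk] at ho
    interval_cases o
    · exact absurd ho (by simpa using n1)
    · exact absurd ho n2
    · exact absurd ho n3
    · right; left
      intro s hs t ht
      rw [hmem] at hs ht
      push_cast at ho
      rcases hs with rfl | rfl | rfl | rfl <;> rcases ht with rfl | rfl | rfl | rfl <;> grind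
    · right; right
      intro s hs t ht
      rw [hmem] at hs ht
      push_cast at ho
      rcases hs with rfl | rfl | rfl | rfl <;> rcases ht with rfl | rfl | rfl | rfl <;> grind
    · left
      refine separable_of_progression_six (x := p) (m := m) ?_ hprog
      have c6 := (stdAddChar_pow_eq_one_iff 6 m).2 (by rw [hk]; exact ho)
      have c3 := (stdAddChar_pow_eq_one_iff 3 m).not.2 (by rw [hk]; exact n3)
      have c2 := (stdAddChar_pow_eq_one_iff 2 m).not.2 (by rw [hk]; exact n2)
      apply sq_eq_sub_one_of_cube
      · have : ((ZMod.stdAddChar m : ℂ) ^ 3 - 1) * ((ZMod.stdAddChar m : ℂ) ^ 3 + 1) = 0 := by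
          linear_combination c6
        rcases mul_eq_zero.1 this with h' | h'
        · exact absurd (sub_eq_zero.1 h') c3
        · exact eq_neg_of_add_eq_zero_left h'
      · intro h
        exact c2 (by rw [h]; norm_num)
  · exact Or.inl (separable_of_progression h7 hprog)

lemma separable_or_of_rectangle {n : ℕ} [NeZero n] {S : Finset (ZMod n)} (hcard : S.card = 4)
    {p q r s : ZMod n} (hp : p ∈ S) (hq : q ∈ S) (hr : r ∈ S) (hs : s ∈ S)
    (hnd : [p, q, r, s].Nodup) (e₁ : p + p = q + q) (e₂ : p + r = q + s) :
    Separable n S ∨ ∀ s ∈ S, ∀ t ∈ S, 4 * (s - t) = 0 := by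
  obtain ⟨hpq, hpr, hps, hqr, hqs, hrs⟩ := nodup_four.1 hnd
  have hmem := mem_iff_of_card_four hcard hp hq hr hs hnd
  obtain ⟨h, rfl⟩ : ∃ h, q = p + h := ⟨q - p, by ring⟩
  obtain ⟨u, rfl⟩ : ∃ u, r = p + u := ⟨r - p, by ring⟩
  have hh : 2 * h = 0 := by linear_combination -e₁
  obtain rfl : s = p + (u + h) := by linear_combination -hh - e₂
  have hk : ∀ (k : ℕ) (m : ZMod n), k • m = (k : ZMod n) * m := fun k m => nsmul_eq_mul k m
  have ch : (ZMod.stdAddChar h : ℂ) = -1 := by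
    have c2 := (stdAddChar_pow_eq_one_iff 2 h).2 (by rw [hk]; exact hh)
    have c1 := (stdAddChar_pow_eq_one_iff 1 h).not.2 (by rw [one_smul]; grind)
    rw [pow_one] at c1
    have : ((ZMod.stdAddChar h : ℂ) - 1) * (ZMod.stdAddChar h + 1) = 0 := by
      linear_combination c2
    exact eq_neg_of_add_eq_zero_left ((mul_eq_zero.1 this).resolve_left (sub_ne_zero.2 c1))
  have h0 : p + 0 ∈ S := by rwa [add_zero]
  by_cases h4 : 4 * u = 0
  · right
    intro s hs t ht
    rw [hmem] at hs ht
    rcases hs with rfl | rfl | rfl | rfl <;> rcases ht with rfl | rfl | rfl | rfl <;> grind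
  left
  have c4 := (stdAddChar_pow_eq_one_iff 4 u).not.2 (by rw [hk]; exact h4)
  by_cases c6 : (ZMod.stdAddChar u : ℂ) ^ 6 = 1
  · have : ((ZMod.stdAddChar u : ℂ) ^ 3 - 1) * ((ZMod.stdAddChar u : ℂ) ^ 3 + 1) = 0 := by
      linear_combination c6
    rcases mul_eq_zero.1 this with h' | h'
    · have cu : (ZMod.stdAddChar (u + h) : ℂ) = -ZMod.stdAddChar u := by
        rw [AddChar.map_add_eq_mul, ch]
        ring
      refine separable_of_rectangle_six (x := p) (u := u + h) (h := h)
        (sq_eq_sub_one_of_cube ?_ ?_) ch h0 hs hq ?_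
      · rw [cu]
        linear_combination -h'
      · rw [cu]
        intro h''
        exact c4 (by rw [neg_inj.1 h'', one_pow])
      · have : u + h + h = u := by linear_combination hh
        rwa [this]
    · refine separable_of_rectangle_six (x := p) (u := u) (h := h)
        (sq_eq_sub_one_of_cube ?_ ?_) ch h0 hr hq hs
      · linear_combination h'
      · intro h''
        exact c4 (by rw [h'']; norm_num)
  · exact separable_of_rectangle c4 c6 ch h0 hr hq hs

/-- A four-element set of residues is separable unless it consists of multiples of `n / 4` or of
`n / 5`, up to translation. -/
lemma separable_or {n : ℕ} [NeZero n] {S : Finset (ZMod n)} (hcard : S.card = 4) :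
    Separable n S ∨ (∀ s ∈ S, ∀ t ∈ S, 4 * (s - t) = 0) ∨ ∀ s ∈ S, ∀ t ∈ S, 5 * (s - t) = 0 := by
  by_cases hS : Irregular S
  · exact Or.inl (hS.separable hcard)
  by_contra hno
  refine hS ⟨?_, ?_, ?_⟩
  · rintro p hp q hq r hr s hs hnd ⟨e₁, e₂⟩
    exact hno (separable_or_of_progression hcard hp hq hr hs hnd e₁ e₂)
  · rintro p hp q hq r hr hnd ⟨e₁, e₂⟩
    exact hno (Or.inl (separable_of_coset hcard hp hq hr hnd e₁ e₂))
  · rintro p hp q hq r hr s hs hnd ⟨e₁, e₂⟩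
    rcases separable_or_of_rectangle hcard hp hq hr hs hnd e₁ e₂ with h | h
    · exact hno (Or.inl h)
    · exact hno (Or.inr (Or.inl h))

lemma card_partialSums {n a₁ a₂ a₃ a₄ : ℕ} (h1 : 0 < a₁) (h2 : 0 < a₂) (h3 : 0 < a₃)
    (h4 : 0 < a₄) (hsum : a₁ + a₂ + a₃ + a₄ = n) : (partialSums n a₁ a₂ a₃).card = 4 := by
  have key : ∀ a b : ℕ, a < n → b < n → a ≠ b → (a : ZMod n) ≠ b := by
    intro a b ha hb hab h
    rw [ZMod.natCast_eq_natCast_iff'] at h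
    rw [Nat.mod_eq_of_lt ha, Nat.mod_eq_of_lt hb] at h
    exact hab h
  have k1 := key 0 a₁ (by omega) (by omega) (by omega)
  have k2 := key 0 (a₁ + a₂) (by omega) (by omega) (by omega)
  have k3 := key 0 (a₁ + a₂ + a₃) (by omega) (by omega) (by omega)
  have k4 := key a₁ (a₁ + a₂) (by omega) (by omega) (by omega)
  have k5 := key a₁ (a₁ + a₂ + a₃) (by omega) (by omega) (by omega)
  have k6 := key (a₁ + a₂) (a₁ + a₂ + a₃) (by omega) (by omega) (by omega)
  rw [Nat.cast_zero] at k1 k2 k3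
  unfold partialSums
  rw [Finset.card_insert_of_notMem, Finset.card_insert_of_notMem, Finset.card_insert_of_notMem,
    Finset.card_singleton]
  all_goals
    simp only [Finset.mem_insert, Finset.mem_singleton, not_or]
    tauto

lemma not_separable_partialSums {p a₁ a₂ a₃ a₄ : ℕ} {n : ℕ} [NeZero n]
    (hsum : a₁ + a₂ + a₃ + a₄ = n)
    (h : (a₁, a₂, a₃, a₄) = (p, p, p, p) ∨
         (a₁, a₂, a₃, a₄) = (p, p, p, 2 * p) ∨ (a₁, a₂, a₃, a₄) = (p, p, 2 * p, p) ∨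
         (a₁, a₂, a₃, a₄) = (p, 2 * p, p, p) ∨ (a₁, a₂, a₃, a₄) = (2 * p, p, p, p)) :
    ¬ Separable n (partialSums n a₁ a₂ a₃) := by
  have key : ∀ (P : ZMod n → Prop) (i₁ i₂ i₃ : ℕ), a₁ = i₁ * p → a₁ + a₂ = i₂ * p →
      a₁ + a₂ + a₃ = i₃ * p → P ((0 * p : ℕ)) → P ((i₁ * p : ℕ)) → P ((i₂ * p : ℕ)) →
      P ((i₃ * p : ℕ)) → ∀ s ∈ partialSums n a₁ a₂ a₃, P s := by
    intro P i₁ i₂ i₃ e₁ e₂ e₃ p₀ p₁ p₂ p₃ s hs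
    simp only [partialSums, Finset.mem_insert, Finset.mem_singleton] at hs
    rw [← e₁] at p₁
    rw [← e₂] at p₂
    rw [← e₃] at p₃
    rcases hs with rfl | rfl | rfl | rfl
    · simpa using p₀
    · exact p₁
    · exact p₂
    · exact p₃
  simp only [Prod.mk.injEq] at h
  rcases h with ⟨r₁, r₂, r₃, r₄⟩ | ⟨r₁, r₂, r₃, r₄⟩ | ⟨r₁, r₂, r₃, r₄⟩ | ⟨r₁, r₂, r₃, r₄⟩ |
    ⟨r₁, r₂, r₃, r₄⟩
  · exact not_separable_of_four_mul (p := p) (by omega) (key _ 1 2 3 (by omega) (by omega)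
      (by omega) ⟨_, rfl⟩ ⟨_, rfl⟩ ⟨_, rfl⟩ ⟨_, rfl⟩)
  · exact not_separable_of_five_mul (p := p) (k := 4) (by omega) (key _ 1 2 3 (by omega) (by omega)
      (by omega) ⟨0, rfl, by decide⟩ ⟨1, rfl, by decide⟩ ⟨2, rfl, by decide⟩ ⟨3, rfl, by decide⟩)
  · exact not_separable_of_five_mul (p := p) (k := 3) (by omega) (key _ 1 2 4 (by omega) (by omega)
      (by omega) ⟨0, rfl, by decide⟩ ⟨1, rfl, by decide⟩ ⟨2, rfl, by decide⟩ ⟨4, rfl, by decide⟩)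
  · exact not_separable_of_five_mul (p := p) (k := 2) (by omega) (key _ 1 3 4 (by omega) (by omega)
      (by omega) ⟨0, rfl, by decide⟩ ⟨1, rfl, by decide⟩ ⟨3, rfl, by decide⟩ ⟨4, rfl, by decide⟩)
  · exact not_separable_of_five_mul (p := p) (k := 1) (by omega) (key _ 2 3 4 (by omega) (by omega)
      (by omega) ⟨0, rfl, by decide⟩ ⟨2, rfl, by decide⟩ ⟨3, rfl, by decide⟩ ⟨4, rfl, by decide⟩)

lemma exceptional_of_mul_sub_eq_zero {n a₁ a₂ a₃ a₄ : ℕ} (h1 : 0 < a₁)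
    (h2 : 0 < a₂) (h3 : 0 < a₃) (h4 : 0 < a₄) (hsum : a₁ + a₂ + a₃ + a₄ = n)
    (h : (∀ s ∈ partialSums n a₁ a₂ a₃, ∀ t ∈ partialSums n a₁ a₂ a₃, 4 * (s - t) = 0) ∨
      ∀ s ∈ partialSums n a₁ a₂ a₃, ∀ t ∈ partialSums n a₁ a₂ a₃, 5 * (s - t) = 0) :
    ∃ p : ℕ, 0 < p ∧
        ((a₁, a₂, a₃, a₄) = (p, p, p, p) ∨
         (a₁, a₂, a₃, a₄) = (p, p, p, 2 * p) ∨ (a₁, a₂, a₃, a₄) = (p, p, 2 * p, p) ∨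
         (a₁, a₂, a₃, a₄) = (p, 2 * p, p, p) ∨ (a₁, a₂, a₃, a₄) = (2 * p, p, p, p)) := by
  have m0 : (0 : ZMod n) ∈ partialSums n a₁ a₂ a₃ := by simp [partialSums]
  have m1 : ((a₁ : ℕ) : ZMod n) ∈ partialSums n a₁ a₂ a₃ := by simp [partialSums]
  have m2 : ((a₁ + a₂ : ℕ) : ZMod n) ∈ partialSums n a₁ a₂ a₃ := by simp [partialSums]
  have m3 : ((a₁ + a₂ + a₃ : ℕ) : ZMod n) ∈ partialSums n a₁ a₂ a₃ := by simp [partialSums]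
  have key : ∀ k a : ℕ, 0 < k → (k : ZMod n) * ((a : ZMod n) - 0) = 0 → 0 < a → a < n →
      ∃ c, k * a = n * c ∧ 0 < c ∧ c < k := by
    intro k a hk h ha han
    rw [sub_zero, ← Nat.cast_mul, ZMod.natCast_eq_zero_iff] at h
    obtain ⟨c, hc⟩ := h
    refine ⟨c, hc, Nat.pos_of_ne_zero ?_, ?_⟩
    · rintro rfl
      have := Nat.mul_pos hk ha
      omega
    · by_contra hck
      have : n * k ≤ n * c := Nat.mul_le_mul_left n (by omega)
      nlinarith
  simp only [Prod.mk.injEq]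
  rcases h with h | h
  · obtain ⟨c₁, e₁, _, _⟩ := key 4 a₁ (by norm_num) (by exact_mod_cast h _ m1 _ m0) (by omega) (by omega)
    obtain ⟨c₂, e₂, _, _⟩ := key 4 (a₁ + a₂) (by norm_num) (by exact_mod_cast h _ m2 _ m0) (by omega) (by omega)
    obtain ⟨c₃, e₃, _, _⟩ := key 4 (a₁ + a₂ + a₃) (by norm_num) (by exact_mod_cast h _ m3 _ m0) (by omega)
      (by omega)
    refine ⟨a₁, h1, ?_⟩
    interval_cases c₁ <;> interval_cases c₂ <;> interval_cases c₃ <;> omega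
  · obtain ⟨c₁, e₁, _, _⟩ := key 5 a₁ (by norm_num) (by exact_mod_cast h _ m1 _ m0) (by omega) (by omega)
    obtain ⟨c₂, e₂, _, _⟩ := key 5 (a₁ + a₂) (by norm_num) (by exact_mod_cast h _ m2 _ m0) (by omega) (by omega)
    obtain ⟨c₃, e₃, _, _⟩ := key 5 (a₁ + a₂ + a₃) (by norm_num) (by exact_mod_cast h _ m3 _ m0) (by omega)
      (by omega)
    refine ⟨n / 5, ?_, ?_⟩ <;>
      interval_cases c₁ <;> interval_cases c₂ <;> interval_cases c₃ <;> omega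

/-- For `n ≥ 1` and positive integers `a₁ + a₂ + a₃ + a₄ = n`, there is no
continuous `Cₙ`-equivariant map `F : S³ → M(α)` (equivariance: `F(η·x) = σ(F x)`) if and only
if `(a₁,a₂,a₃,a₄)` is a cyclic rotation of `(p,p,p,p)` or of `(p,p,p,2p)` for some `p > 0`. -/
theorem no_cyclic_equivariant_map_iff (n a₁ a₂ a₃ a₄ : ℕ) (hn : 1 ≤ n)
    (h1 : 0 < a₁) (h2 : 0 < a₂) (h3 : 0 < a₃) (h4 : 0 < a₄)
    (hsum : a₁ + a₂ + a₃ + a₄ = n) :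
    (¬ ∃ F : UnitQuat → {x : Fin n → ℝ // x ∈ Mcyc n a₁ a₂ a₃ a₄},
        Continuous F ∧
        ∀ q : UnitQuat,
          (F ⟨etaQ n * q.1, by rw [norm_mul, norm_etaQ, q.2, one_mul]⟩).1
            = cyclicShift n (F q).1) ↔
      (∃ p : ℕ, 0 < p ∧
        ((a₁, a₂, a₃, a₄) = (p, p, p, p) ∨
         (a₁, a₂, a₃, a₄) = (p, p, p, 2 * p) ∨ (a₁, a₂, a₃, a₄) = (p, p, 2 * p, p) ∨
         (a₁, a₂, a₃, a₄) = (p, 2 * p, p, p) ∨ (a₁, a₂, a₃, a₄) = (2 * p, p, p, p))) := by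
  have : NeZero n := ⟨by omega⟩
  rw [exists_equivariant_iff hsum]
  constructor
  · intro h
    exact exceptional_of_mul_sub_eq_zero h1 h2 h3 h4 hsum
      ((separable_or (card_partialSums h1 h2 h3 h4 hsum)).resolve_left h)
  · rintro ⟨p, -, h⟩
    exact not_separable_partialSums hsum h
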